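/- arXiv:1604.00890 — 4 statements merged into one kernel-verified Lean document; each statement's English description precedes it below -/
import Mathlib

section
/- Let X ~ L(n) and let μ = μ(n) = (n − log₂ n + log₂ ln n)/2. There exists n₀ such that for all n ≥ n₀ and every real x > 1: P(|X − μ| ≥ x) ≤ 2^{−(x−2)² + 2} + n^{−n}; and moreover for every real x with 1 < x ≤ n^{2/3}: P(|X − μ| ≥ x) ≥ 2^{−(x+1)² − 1}. Here P(|X − μ| ≥ x) = Σ_{k ∈ {0,…,n}, |k−μ| ≥ x} ℓ_{n,k}/𝓛_n. -/
open scoped Classical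
open Filter

noncomputable section

/-- A finite simple graph is perfect if every induced subgraph has chromatic number
equal to clique number. -/
def IsPerfect {V : Type*} (G : SimpleGraph V) : Prop :=
  ∀ s : Set V, (G.induce s).chromaticNumber = ((G.induce s).cliqueNum : ℕ∞)

/-- `(G, C)` is a unipolar arrangement: `C` is a clique (the central clique) and every
connected component of the subgraph induced on the complement of `C` is a clique. -/
def IsUnipolarArrangement {V : Type*} (G : SimpleGraph V) (C : Set V) : Prop :=
  G.IsClique C ∧
    ∀ u v : (Cᶜ : Set V), (G.induce Cᶜ).Reachable u v → u ≠ v → (G.induce Cᶜ).Adj u v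

def IsUnipolar {V : Type*} (G : SimpleGraph V) : Prop :=
  ∃ C : Set V, IsUnipolarArrangement G C

def IsCoUnipolar {V : Type*} (G : SimpleGraph V) : Prop := IsUnipolar Gᶜ

def IsGenSplit {V : Type*} (G : SimpleGraph V) : Prop := IsUnipolar G ∨ IsCoUnipolar G

/-- the `m`-th Bell number: the number of partitions of an `m`-element set. -/
def bell (m : ℕ) : ℕ := Nat.card (Finpartition (Finset.univ : Finset (Fin m)))

/-- `ℓ_{n,k} = C(n,k) · 2^{k(n-k)} · B_{n-k}` -/
def ell (n k : ℕ) : ℕ := Nat.choose n k * 2 ^ (k * (n - k)) * bell (n - k)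

/-- `𝓛_n = Σ_{k=0}^n ℓ_{n,k}` -/
def scrL (n : ℕ) : ℕ := ∑ k ∈ Finset.range (n + 1), ell n k

/-- the number of perfect graphs on `{1,…,n}` -/
def perfectCount (n : ℕ) : ℕ := Nat.card {G : SimpleGraph (Fin n) // IsPerfect G}

/-- independence number -/
def indepNum {V : Type*} (G : SimpleGraph V) : ℕ := Gᶜ.cliqueNum

/-- `μ(n) = (n − log₂ n + log₂ ln n)/2` -/
def muL (n : ℕ) : ℝ := ((n : ℝ) - Real.logb 2 n + Real.logb 2 (Real.log n)) / 2

/-- `P(|X − μ(n)| ≥ x)` for `X ~ L(n)`. -/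
def tailL (n : ℕ) (x : ℝ) : ℝ :=
  (∑ k ∈ (Finset.range (n + 1)).filter (fun k : ℕ => x ≤ |(k : ℝ) - muL n|), (ell n k : ℝ)) /
    (scrL n : ℝ)


theorem finpartition_ker_part_bijective (α : Type*) [Fintype α] [DecidableEq α] :
    Function.Bijective
      (fun P : Finpartition (Finset.univ : Finset α) => Setoid.ker P.part) := by
  constructor
  · intro P Q h
    have hpart : ∀ a, P.part a = Q.part a := by
      intro a
      ext b
      have hab : P.part b = P.part a ↔ Q.part b = Q.part a := by
        have := congrArg (fun s : Setoid α => s b a) h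
        simpa [Setoid.ker_def] using this
      rw [P.mem_part_iff_part_eq_part (Finset.mem_univ _) (Finset.mem_univ _),
        Q.mem_part_iff_part_eq_part (Finset.mem_univ _) (Finset.mem_univ _), hab]
    have key : ∀ P Q : Finpartition (Finset.univ : Finset α), (∀ a, P.part a = Q.part a) →
        P.parts ⊆ Q.parts := by
      intro P Q hPQ t ht
      obtain ⟨a, ha⟩ := P.nonempty_of_mem_parts ht
      rw [← P.part_eq_of_mem ht ha, hPQ a]
      exact Q.part_mem.2 (Finset.mem_univ a)
    exact Finpartition.ext ((key P Q hpart).antisymm (key Q P fun a => (hpart a).symm))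
  · intro s
    refine ⟨Finpartition.ofSetoid s, ?_⟩
    ext a b
    rw [Setoid.ker_def,
      ← Finpartition.mem_part_iff_part_eq_part _ (Finset.mem_univ _) (Finset.mem_univ _),
      Finpartition.mem_part_ofSetoid_iff_rel]
    exact ⟨s.symm, s.symm⟩

theorem bell_eq_card_setoid (m : ℕ) : bell m = Nat.card (Setoid (Fin m)) := by
  unfold bell
  exact Nat.card_eq_of_bijective _ (finpartition_ker_part_bijective (Fin m))

instance setoidFinFinite (m : ℕ) : Finite (Setoid (Fin m)) :=
  Finite.of_surjective _ (finpartition_ker_part_bijective (Fin m)).surjective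

instance setoidFinFintype (m : ℕ) : Fintype (Setoid (Fin m)) := Fintype.ofFinite _

/-- Functions with kernel `s` are the injections of the quotient by `s`. -/
def kerFiberEquiv {α β : Type*} (s : Setoid α) :
    {f : α → β // Setoid.ker f = s} ≃ (Quotient s ↪ β) where
  toFun f := ⟨Quotient.lift f.1 (fun a b h => by
      have h' : Setoid.ker f.1 a b := by rw [f.2]; exact h
      exact h'), by
    rintro ⟨a⟩ ⟨b⟩ h
    refine Quotient.sound ?_
    have h' : Setoid.ker f.1 a b := h
    rw [f.2] at h'
    exact h'⟩
  invFun g := ⟨fun a => g (Quotient.mk s a), by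
    ext a b
    rw [Setoid.ker_def, g.injective.eq_iff]
    exact Quotient.eq⟩
  left_inv f := rfl
  right_inv g := by
    ext ⟨a⟩
    rfl

theorem pow_eq_sum_descFactorial (m j : ℕ) :
    j ^ m = ∑ s : Setoid (Fin m), j.descFactorial (Fintype.card (Quotient s)) := by
  have h : Fintype.card (Fin m → Fin j)
      = Fintype.card (Σ s : Setoid (Fin m), {f : Fin m → Fin j // Setoid.ker f = s}) :=
    Fintype.card_congr (Equiv.sigmaFiberEquiv _).symm
  rw [Fintype.card_sigma] at h
  simpa [Fintype.card_congr (kerFiberEquiv _), Fintype.card_embedding_eq] using h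

theorem hasSum_descFactorial_div_factorial (c : ℕ) :
    HasSum (fun j : ℕ => (j.descFactorial c : ℝ) / j.factorial) (Real.exp 1) := by
  induction c with
  | zero =>
    have := NormedSpace.expSeries_div_hasSum_exp (1 : ℝ)
    simpa [Real.exp_eq_exp_ℝ] using this
  | succ c ih =>
    refine (hasSum_nat_add_iff' 1).mp ?_
    have h : ∀ j : ℕ, (((j + 1).descFactorial (c + 1) : ℕ) : ℝ) / ((j + 1).factorial : ℕ)
        = (j.descFactorial c : ℝ) / j.factorial := by
      intro j
      rw [Nat.succ_descFactorial_succ, Nat.factorial_succ]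
      push_cast
      rw [mul_div_mul_left]
      positivity
    simp only [h]
    simpa using ih

/-- Dobinski's formula. -/
theorem hasSum_pow_div_factorial (m : ℕ) :
    HasSum (fun j : ℕ => (j : ℝ) ^ m / j.factorial) (bell m * Real.exp 1) := by
  have h := hasSum_sum (s := (Finset.univ : Finset (Setoid (Fin m))))
    (fun s _ => hasSum_descFactorial_div_factorial (Fintype.card (Quotient s)))
  convert h using 1
  · ext j
    rw [← Finset.sum_div]
    congr 1
    exact_mod_cast pow_eq_sum_descFactorial m j
  · simp [bell_eq_card_setoid]

theorem bell_pos (m : ℕ) : 0 < bell m := by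
  rw [bell_eq_card_setoid]
  have : Nonempty (Setoid (Fin m)) := ⟨⊥⟩
  exact Nat.card_pos

theorem bell_le_pow_self (m : ℕ) : bell m ≤ m ^ m := by
  rw [bell_eq_card_setoid, Nat.card_eq_fintype_card, pow_eq_sum_descFactorial m m,
    ← Finset.card_univ, Finset.card_eq_sum_ones]
  refine Finset.sum_le_sum fun s _ => ?_
  refine Nat.succ_le_of_lt (Nat.pos_of_ne_zero fun h => ?_)
  rw [Nat.descFactorial_eq_zero_iff_lt] at h
  have := Fintype.card_quotient_le s
  simp at this
  omega

theorem bell_succ_le_of_pow_le {m J : ℕ}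
    (h : ∀ j : ℕ, J ≤ j → 2 * ((j : ℝ) + 1) ^ m ≤ (j + 1) * (j : ℝ) ^ m) :
    (bell (m + 1) : ℝ) ≤ (J + 1) * bell m := by
  set w : ℕ → ℝ := fun j => (j : ℝ) ^ m / j.factorial with hw
  have hw0 : ∀ j, 0 ≤ w j := fun j => by positivity
  have hwS : HasSum w (bell m * Real.exp 1) := hasSum_pow_div_factorial m
  have hwS' : HasSum (fun j : ℕ => (j : ℝ) * w j) (bell (m + 1) * Real.exp 1) := by
    convert hasSum_pow_div_factorial (m + 1) using 2 with j
    simp only [hw]; ring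
  set g : ℕ → ℝ := fun j => max ((j : ℝ) - J) 0 * w j with hg
  have hg0 : ∀ j, 0 ≤ g j := fun j => mul_nonneg (le_max_right _ _) (hw0 j)
  have hgs : Summable g := by
    refine Summable.of_nonneg_of_le hg0 (fun j => ?_) hwS'.summable
    refine mul_le_mul_of_nonneg_right (max_le ?_ (Nat.cast_nonneg j)) (hw0 j)
    have : (0 : ℝ) ≤ J := Nat.cast_nonneg J
    linarith
  have hstep : ∀ j, g (j + 1) ≤ 1 / 2 * g j + 1 / 2 * w j := by
    intro j
    rcases lt_or_ge j J with hj | hj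
    · have : ((j + 1 : ℕ) : ℝ) - J ≤ 0 := by
        have : ((j + 1 : ℕ) : ℝ) ≤ J := by exact_mod_cast hj
        linarith
      have h0 : g (j + 1) = 0 := by simp only [hg]; rw [max_eq_right this, zero_mul]
      rw [h0]
      have := hg0 j
      have := hw0 j
      positivity
    · have hJ : (J : ℝ) ≤ j := by exact_mod_cast hj
      have hwle : w (j + 1) ≤ 1 / 2 * w j := by
        simp only [hw, Nat.factorial_succ]
        push_cast
        have hf : (0 : ℝ) < j.factorial := by positivity
        rw [div_le_iff₀ (by positivity)]
        have : 1 / 2 * ((j : ℝ) ^ m / j.factorial) * (((j : ℝ) + 1) * j.factorial)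
          = 1 / 2 * ((j + 1) * (j : ℝ) ^ m) := by field_simp
        rw [this]
        linarith [h j hj]
      have e1 : g (j + 1) = ((j : ℝ) - J + 1) * w (j + 1) := by
        simp only [hg]
        rw [max_eq_left (by push_cast; linarith)]
        push_cast; ring
      have e2 : g j = ((j : ℝ) - J) * w j := by
        simp only [hg]
        rw [max_eq_left (by linarith)]
      rw [e1, e2]
      calc ((j : ℝ) - J + 1) * w (j + 1) ≤ ((j : ℝ) - J + 1) * (1 / 2 * w j) :=
            mul_le_mul_of_nonneg_left hwle (by linarith)
        _ = _ := by ring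
  have hg00 : g 0 = 0 := by
    simp [hg]
  have hG : ∑' j, g j ≤ bell m * Real.exp 1 := by
    have h1 : ∑' j, g j = ∑' j, g (j + 1) := by rw [hgs.tsum_eq_zero_add, hg00, zero_add]
    have h2 : ∑' j, g (j + 1) ≤ 1 / 2 * (∑' j, g j) + 1 / 2 * (bell m * Real.exp 1) :=
      hasSum_le hstep ((summable_nat_add_iff 1).2 hgs).hasSum
        ((hgs.hasSum.mul_left _).add (hwS.mul_left _))
    linarith
  have hfin : (bell (m + 1) : ℝ) * Real.exp 1 ≤ J * (bell m * Real.exp 1) + ∑' j, g j := by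
    refine hasSum_le (fun j => ?_) hwS' ((hwS.mul_left (J : ℝ)).add hgs.hasSum)
    have : (j : ℝ) - J ≤ max ((j : ℝ) - J) 0 := le_max_left _ _
    have := mul_le_mul_of_nonneg_right this (hw0 j)
    simp only [hg]
    linarith
  have he := Real.exp_pos 1
  refine le_of_mul_le_mul_right ?_ he
  linarith

theorem le_bell_succ_of_pow_le {m J : ℕ} {η : ℝ} (hη : 0 ≤ η)
    (h : ∀ j : ℕ, j < J → ((j : ℝ) + 1) * (j : ℝ) ^ m ≤ η * ((j : ℝ) + 1) ^ m) :
    (J : ℝ) * (1 - η) * bell m ≤ bell (m + 1) := by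
  set w : ℕ → ℝ := fun j => (j : ℝ) ^ m / j.factorial with hw
  have hw0 : ∀ j, 0 ≤ w j := fun j => by positivity
  have hwS : HasSum w (bell m * Real.exp 1) := hasSum_pow_div_factorial m
  have hwS' : HasSum (fun j : ℕ => (j : ℝ) * w j) (bell (m + 1) * Real.exp 1) := by
    convert hasSum_pow_div_factorial (m + 1) using 2 with j
    simp only [hw]; ring
  have hshift : HasSum (fun j => w (j + 1)) (bell m * Real.exp 1 - w 0) := by
    simpa using (hasSum_nat_add_iff' 1).mpr hwS
  have hJ0 : (0 : ℝ) ≤ J := Nat.cast_nonneg J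
  have hfin : (J : ℝ) * (bell m * Real.exp 1) ≤
      bell (m + 1) * Real.exp 1 + J * η * (bell m * Real.exp 1 - w 0) := by
    refine hasSum_le (fun j => ?_) (hwS.mul_left (J : ℝ)) (hwS'.add (hshift.mul_left (J * η)))
    have h0 := hw0 j
    have h1 := hw0 (j + 1)
    rcases lt_or_ge j J with hj | hj
    · have hwle : w j ≤ η * w (j + 1) := by
        simp only [hw, Nat.factorial_succ]
        push_cast
        have hf : (0 : ℝ) < j.factorial := by positivity
        rw [div_le_iff₀ hf]
        have : η * (((j : ℝ) + 1) ^ m / ((j + 1) * j.factorial)) * j.factorial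
          = η * ((j : ℝ) + 1) ^ m / (j + 1) := by field_simp
        rw [this, le_div_iff₀ (by positivity)]
        linarith [h j hj]
      have := mul_le_mul_of_nonneg_left hwle hJ0
      have : 0 ≤ (j : ℝ) * w j := by positivity
      linarith
    · have hJ : (J : ℝ) ≤ j := by exact_mod_cast hj
      have := mul_le_mul_of_nonneg_right hJ h0
      have : 0 ≤ J * η * w (j + 1) := by positivity
      linarith
  have he := Real.exp_pos 1
  refine le_of_mul_le_mul_right ?_ he
  have : 0 ≤ J * η * w 0 := mul_nonneg (by positivity) (hw0 0)
  linarith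

theorem eventually_bell_ratio :
    ∀ᶠ m : ℕ in atTop, (0.99 : ℝ) * (m / Real.log m) * bell m ≤ bell (m + 1) ∧
      (bell (m + 1) : ℝ) ≤ 1.03 * (m / Real.log m) * bell m := by
  have hlog : Tendsto (fun m : ℕ => Real.log m) atTop atTop :=
    Real.tendsto_log_atTop.comp tendsto_natCast_atTop_atTop
  filter_upwards [hlog.eventually_ge_atTop 100000, eventually_gt_atTop 0] with m hL hm0
  set L := Real.log m with hLdef
  have hm : (0 : ℝ) < m := by exact_mod_cast hm0
  have hexp : Real.exp L = m := Real.exp_log hm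
  have hL0 : 0 < L := by linarith
  have hquad : 1 + L + L ^ 2 / 2 ≤ m := hexp ▸ Real.quadratic_le_exp_of_nonneg hL0.le
  have hR : 50000 ≤ (m : ℝ) / L := by
    rw [le_div_iff₀ hL0]
    nlinarith
  have hB : (0 : ℝ) < bell m := by exact_mod_cast bell_pos m
  constructor
  · set J := ⌊(m : ℝ) / L⌋₊ with hJ
    have hJle : (J : ℝ) ≤ m / L := Nat.floor_le (by positivity)
    have hJge : (m : ℝ) / L - 1 ≤ J := by
      have := Nat.lt_floor_add_one ((m : ℝ) / L)
      linarith
    have hinv : 1 / L ≤ 1 / 100000 := one_div_le_one_div_of_le (by norm_num) hL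
    have key := le_bell_succ_of_pow_le (m := m) (J := J) (η := 1 / L) (by positivity) (by
      intro j hj
      have hj1 : ((j : ℝ) + 1) ≤ J := by exact_mod_cast hj
      have hjp : (0 : ℝ) < (j : ℝ) + 1 := by positivity
      have hb : (j : ℝ) ≤ (j + 1) * Real.exp (-(1 / (j + 1))) := by
        have := Real.add_one_le_exp (-(1 / ((j : ℝ) + 1)))
        calc (j : ℝ) = (j + 1) * (-(1 / ((j : ℝ) + 1)) + 1) := by field_simp; ring
          _ ≤ _ := mul_le_mul_of_nonneg_left this hjp.le
      have hpow : (j : ℝ) ^ m ≤ (j + 1) ^ m * Real.exp (-(m / (j + 1))) := by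
        calc (j : ℝ) ^ m ≤ ((j + 1) * Real.exp (-(1 / (j + 1)))) ^ m :=
              pow_le_pow_left₀ (by positivity) hb m
          _ = _ := by
            rw [mul_pow, ← Real.exp_nat_mul]
            congr 2; ring
      have hle : Real.exp (-(m / ((j : ℝ) + 1))) ≤ 1 / m := by
        rw [one_div, ← hexp, ← Real.exp_neg]
        refine Real.exp_le_exp.2 (neg_le_neg ?_)
        rw [hexp, le_div_iff₀ hjp]
        have := hj1.trans hJle
        rw [le_div_iff₀ hL0] at this
        linarith
      calc ((j : ℝ) + 1) * (j : ℝ) ^ m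
          ≤ (m / L) * ((j + 1) ^ m * (1 / m)) :=
            mul_le_mul (hj1.trans hJle)
              (hpow.trans (mul_le_mul_of_nonneg_left hle (by positivity))) (by positivity)
              (by positivity)
        _ = 1 / L * ((j : ℝ) + 1) ^ m := by field_simp)
    refine le_trans (mul_le_mul_of_nonneg_right ?_ hB.le) key
    calc (0.99 : ℝ) * (m / L) ≤ (m / L - 1) * (1 - 1 / 100000) := by linarith
      _ ≤ J * (1 - 1 / L) :=
        mul_le_mul hJge (by linarith) (by norm_num) (by positivity)
  · set J := ⌈1.02 * ((m : ℝ) / L)⌉₊ with hJ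
    have hJge : 1.02 * ((m : ℝ) / L) ≤ J := Nat.le_ceil _
    have hJle : (J : ℝ) < 1.02 * (m / L) + 1 := Nat.ceil_lt_add_one (by positivity)
    have key := bell_succ_le_of_pow_le (m := m) (J := J) (by
      intro j hj
      have hj1 : (J : ℝ) ≤ j := by exact_mod_cast hj
      have hjR : 1.02 * ((m : ℝ) / L) ≤ j := hJge.trans hj1
      have hjp : (0 : ℝ) < (j : ℝ) := by linarith
      have hb : (j : ℝ) + 1 ≤ j * Real.exp (1 / j) := by
        have := Real.add_one_le_exp (1 / (j : ℝ))
        calc (j : ℝ) + 1 = j * (1 / (j : ℝ) + 1) := by field_simp; ring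
          _ ≤ _ := mul_le_mul_of_nonneg_left this hjp.le
      have hpow : ((j : ℝ) + 1) ^ m ≤ j ^ m * Real.exp (m / j) := by
        calc ((j : ℝ) + 1) ^ m ≤ (j * Real.exp (1 / j)) ^ m :=
              pow_le_pow_left₀ (by positivity) hb m
          _ = _ := by
            rw [mul_pow, ← Real.exp_nat_mul]
            congr 2; ring
      have hmj : (m : ℝ) / j ≤ L / 1.02 := by
        rw [div_le_div_iff₀ hjp (by norm_num)]
        rw [mul_div_assoc', div_le_iff₀ hL0] at hjR
        linarith
      have hE : 2 * Real.exp (m / j) ≤ j + 1 := by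
        have h1 : L * 2 ≤ Real.exp (L / 51) := by
          have := Real.quadratic_le_exp_of_nonneg (x := L / 51) (by positivity)
          nlinarith
        have h2 : Real.exp (L / 1.02) * Real.exp (L / 51) = m := by
          rw [← Real.exp_add, ← hexp]; congr 1; ring
        have h3 : Real.exp (L / 1.02) * (L * 2) ≤ m :=
          h2 ▸ mul_le_mul_of_nonneg_left h1 (Real.exp_pos _).le
        have h4 : Real.exp (L / 1.02) * 2 ≤ m / L := by
          rw [le_div_iff₀ hL0]; linarith
        have := Real.exp_le_exp.2 hmj
        linarith
      have hjm : (0 : ℝ) < (j : ℝ) ^ m := by positivity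
      have := mul_le_mul_of_nonneg_right hE hjm.le
      linarith)
    refine key.trans (mul_le_mul_of_nonneg_right ?_ hB.le)
    linarith

theorem ell_succ_mul {n k m : ℕ} (h : n = k + 1 + m) :
    ell n (k + 1) * (k + 1) * bell (m + 1) * 2 ^ k = ell n k * (m + 1) * bell m * 2 ^ m := by
  have h1 : n - (k + 1) = m := by omega
  have h2 : n - k = m + 1 := by omega
  have hc := Nat.choose_succ_right_eq n k
  rw [h2] at hc
  unfold ell
  rw [h1, h2]
  calc n.choose (k + 1) * 2 ^ ((k + 1) * m) * bell m * (k + 1) * bell (m + 1) * 2 ^ k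
      = (n.choose (k + 1) * (k + 1)) * (2 ^ ((k + 1) * m) * 2 ^ k) * bell m * bell (m + 1) := by
        ring
    _ = (n.choose k * (m + 1)) * (2 ^ (k * (m + 1)) * 2 ^ m) * bell m * bell (m + 1) := by
        rw [hc, ← pow_add, ← pow_add]
        congr 4; ring
    _ = _ := by ring

/-- The discrete Gaussian profile satisfying `profile n (k + 1) / profile n k = 2 ^ (2 (μ - k))`. -/
def profile (n k : ℕ) : ℝ := (2 : ℝ) ^ (-((k : ℝ) - muL n) ^ 2 + ((k : ℝ) - muL n))

theorem profile_pos (n k : ℕ) : 0 < profile n k := Real.rpow_pos_of_pos two_pos _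

theorem profile_succ_mul {n k m : ℕ} (h : n = k + 1 + m) (hL : 0 < Real.log n) :
    profile n (k + 1) * n * 2 ^ k = profile n k * 2 ^ (m + 1) * Real.log n := by
  have hn : (0 : ℝ) < n := by
    have : 0 < n := by omega
    exact_mod_cast this
  have hμ : (2 : ℝ) ^ (2 * muL n) * n = 2 ^ n * Real.log n := by
    have : 2 * muL n = (n : ℝ) - Real.logb 2 n + Real.logb 2 (Real.log n) := by
      unfold muL; ring
    rw [this, Real.rpow_add two_pos, Real.rpow_sub two_pos,
      Real.rpow_logb two_pos (by norm_num) hn, Real.rpow_logb two_pos (by norm_num) hL,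
      Real.rpow_natCast]
    field_simp
  have hs : profile n (k + 1) * 2 ^ (2 * k) = profile n k * (2 : ℝ) ^ (2 * muL n) := by
    unfold profile
    rw [← Real.rpow_natCast 2 (2 * k), ← Real.rpow_add two_pos, ← Real.rpow_add two_pos]
    congr 1
    push_cast; ring
  have hp : (2 : ℝ) ^ n = 2 ^ k * 2 ^ (m + 1) := by rw [h, ← pow_add]; congr 1; ring
  have h2k : (0 : ℝ) < 2 ^ k := by positivity
  refine mul_right_cancel₀ h2k.ne' ?_
  calc profile n (k + 1) * n * 2 ^ k * 2 ^ k = profile n (k + 1) * 2 ^ (2 * k) * n := by ring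
    _ = profile n k * (2 ^ (2 * muL n) * n) := by rw [hs]; ring
    _ = _ := by rw [hμ, hp]; ring

theorem two_rpow_eighth_ge : (1.09 : ℝ) ≤ 2 ^ (1 / 8 : ℝ) := by
  have h : ((1.09 : ℝ) ^ (8 : ℕ)) ^ (1 / 8 : ℝ) = 1.09 := by
    rw [one_div]
    exact Real.pow_rpow_inv_natCast (by norm_num) (by norm_num)
  rw [← h]
  exact Real.rpow_le_rpow (by norm_num) (by norm_num) (by norm_num)

theorem eventually_log_sq_le :
    ∀ᶠ n : ℕ in atTop, 400 ≤ Real.log n ∧ 10 ^ 8 * Real.log n ^ 2 ≤ n := by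
  have hlog : Tendsto (fun m : ℕ => Real.log m) atTop atTop :=
    Real.tendsto_log_atTop.comp tendsto_natCast_atTop_atTop
  have h := (Real.isLittleO_pow_log_id_atTop (n := 2)).bound
    (show (0 : ℝ) < 1 / 10 ^ 8 by norm_num)
  filter_upwards [hlog.eventually_ge_atTop 400, tendsto_natCast_atTop_atTop.eventually h]
    with n h1 h2
  refine ⟨h1, ?_⟩
  simp only [id, Real.norm_eq_abs, abs_pow, sq_abs, Nat.abs_cast] at h2
  linarith

theorem eventually_ell_div_profile_step :
    ∀ᶠ n : ℕ in atTop, ∀ k : ℕ, |(k : ℝ) - n / 2| ≤ n / 1000 →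
      ell n (k + 1) / profile n (k + 1) ≤ 2 ^ (1 / 8 : ℝ) * (ell n k / profile n k) ∧
      ell n k / profile n k ≤ 2 ^ (1 / 8 : ℝ) * (ell n (k + 1) / profile n (k + 1)) := by
  obtain ⟨M, hM⟩ := eventually_atTop.1 eventually_bell_ratio
  filter_upwards [eventually_log_sq_le, eventually_ge_atTop (3 * M)] with n hn hnM k hk
  obtain ⟨hL, hLn⟩ := hn
  have hn6 : (10 : ℝ) ^ 8 ≤ n := by nlinarith
  rw [abs_le] at hk
  obtain ⟨hk1, hk2⟩ := hk
  have hkn : k + 1 ≤ n := by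
    have : (k : ℝ) + 1 ≤ n := by linarith
    exact_mod_cast this
  obtain ⟨m, hm⟩ := Nat.exists_eq_add_of_le hkn
  have hmR : (n : ℝ) = k + 1 + m := by exact_mod_cast hm
  have hm3 : (n : ℝ) / 3 ≤ m := by linarith
  have hmM : M ≤ m := by
    have : (3 * M : ℝ) ≤ n := by exact_mod_cast hnM
    have : (M : ℝ) ≤ m := by linarith
    exact_mod_cast this
  obtain ⟨hb1, hb2⟩ := hM m hmM
  have hm0 : (0 : ℝ) < m := by linarith
  have hn0 : (0 : ℝ) < n := by linarith
  have hk0 : (0 : ℝ) < k + 1 := by linarith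
  have hLm : Real.log m ≤ Real.log n := Real.log_le_log hm0 (by linarith)
  have hLm' : 0.995 * Real.log n ≤ Real.log m := by
    have h1 : Real.log (n / 3) ≤ Real.log m := Real.log_le_log (by positivity) hm3
    rw [Real.log_div hn0.ne' (by norm_num)] at h1
    have h2 : Real.log 3 ≤ 3 - 1 := Real.log_le_sub_one_of_pos (by norm_num)
    linarith
  set L := Real.log n with hLdef
  set l := Real.log m with hldef
  have hl0 : 0 < l := by linarith
  have hL0 : 0 < L := by linarith
  have hB0 : (0 : ℝ) < bell m := by exact_mod_cast bell_pos m
  have hB1 : (0 : ℝ) < bell (m + 1) := by exact_mod_cast bell_pos (m + 1)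
  set C : ℝ := 2 ^ (1 / 8 : ℝ) with hC
  have hC1 : 1.09 ≤ C := two_rpow_eighth_ge
  have he : (ell n (k + 1) : ℝ) * (k + 1) * bell (m + 1) * 2 ^ k
      = ell n k * (m + 1) * bell m * 2 ^ m := by exact_mod_cast ell_succ_mul hm
  have hp := profile_succ_mul hm hL0
  have hP0 := profile_pos n k
  have hP1 := profile_pos n (k + 1)
  have hratio : ell n (k + 1) / profile n (k + 1) =
      (((m + 1) * n * bell m) / (2 * (k + 1) * L * bell (m + 1))) * (ell n k / profile n k) := by
    have e1 : (ell n (k + 1) : ℝ)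
        = ell n k * (m + 1) * bell m * 2 ^ m / ((k + 1) * bell (m + 1) * 2 ^ k) := by
      rw [eq_div_iff (by positivity), ← he]; ring
    have e2 : profile n (k + 1) = profile n k * 2 ^ (m + 1) * L / (n * 2 ^ k) := by
      rw [eq_div_iff (by positivity), ← hp]; ring
    rw [e1, e2, pow_succ]
    field_simp
  have hb1' : 0.99 * m * bell m ≤ l * bell (m + 1) := by
    have : (0.99 : ℝ) * (m / l) * bell m = 0.99 * m * bell m / l := by ring
    rw [this, div_le_iff₀ hl0] at hb1
    linarith
  have hb2' : l * bell (m + 1) ≤ 1.03 * m * bell m := by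
    have : (1.03 : ℝ) * (m / l) * bell m = 1.03 * m * bell m / l := by ring
    rw [this, le_div_iff₀ hl0] at hb2
    linarith
  have hq1 : ((m + 1) * n * bell m) / (2 * (k + 1) * L * bell (m + 1)) ≤ C := by
    rw [div_le_iff₀ (by positivity)]
    have h1 : 0.99 * m * bell m ≤ L * bell (m + 1) :=
      hb1'.trans (mul_le_mul_of_nonneg_right hLm hB1.le)
    have h2 : (m + 1 : ℝ) * n ≤ 1.09 * (2 * (k + 1)) * (0.99 * m) := by
      have h3 : (0.998 : ℝ) * n ≤ 2 * (k + 1) := by linarith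
      have h4 : (m : ℝ) + 1 ≤ 1.01 * m := by linarith
      calc (m + 1 : ℝ) * n ≤ (1.01 * m) * n := mul_le_mul_of_nonneg_right h4 hn0.le
        _ = 1.01 * (m * n) := by ring
        _ ≤ 1.09 * 0.99 * 0.998 * (m * n) := by linarith [mul_pos hm0 hn0]
        _ = (1.09 * 0.99 * m) * (0.998 * n) := by ring
        _ ≤ (1.09 * 0.99 * m) * (2 * (k + 1)) :=
          mul_le_mul_of_nonneg_left h3 (by positivity)
        _ = _ := by ring
    calc (m + 1 : ℝ) * n * bell m ≤ 1.09 * (2 * (k + 1)) * (0.99 * m) * bell m :=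
          mul_le_mul_of_nonneg_right h2 hB0.le
      _ = 1.09 * (2 * (k + 1)) * (0.99 * m * bell m) := by ring
      _ ≤ 1.09 * (2 * (k + 1)) * (L * bell (m + 1)) :=
          mul_le_mul_of_nonneg_left h1 (by positivity)
      _ ≤ C * (2 * (k + 1)) * (L * bell (m + 1)) := by gcongr
      _ = _ := by ring
  have hq2 : 1 ≤ C * (((m + 1) * n * bell m) / (2 * (k + 1) * L * bell (m + 1))) := by
    rw [mul_div_assoc', le_div_iff₀ (by positivity), one_mul]
    have h1 : 0.995 * L * bell (m + 1) ≤ 1.03 * m * bell m :=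
      (mul_le_mul_of_nonneg_right hLm' hB1.le).trans hb2'
    have h3 : 2 * ((k : ℝ) + 1) ≤ 1.003 * n := by linarith
    have hmn : 0 < n * m * (bell m : ℝ) := by positivity
    calc 2 * ((k : ℝ) + 1) * L * bell (m + 1)
        = 2 * ((k : ℝ) + 1) * (L * bell (m + 1)) := by ring
      _ ≤ (1.003 * n) * (L * bell (m + 1)) := mul_le_mul_of_nonneg_right h3 (by positivity)
      _ ≤ (1.003 * n) * (1.04 * (m * bell m)) := by
          refine mul_le_mul_of_nonneg_left ?_ (by positivity)
          have := mul_pos hm0 hB0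
          linarith
      _ = 1.003 * 1.04 * (n * m * bell m) := by ring
      _ ≤ 1.09 * (n * m * bell m) := by linarith
      _ = 1.09 * (m * n * bell m) := by ring
      _ ≤ 1.09 * ((m + 1) * n * bell m) := by gcongr; linarith
      _ ≤ C * ((m + 1) * n * bell m) := by gcongr
  have hc0 : 0 ≤ ell n k / profile n k := by positivity
  rw [hratio]
  constructor
  · exact mul_le_mul_of_nonneg_right hq1 hc0
  · rw [← mul_assoc]
    exact le_mul_of_one_le_left hc0 hq2

theorem le_pow_mul_of_forall_step {c : ℕ → ℝ} {C : ℝ} (hC : 0 ≤ C) {a b : ℕ} (hab : a ≤ b)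
    (h : ∀ j, a ≤ j → j < b → c (j + 1) ≤ C * c j ∧ c j ≤ C * c (j + 1)) :
    c b ≤ C ^ (b - a) * c a ∧ c a ≤ C ^ (b - a) * c b := by
  induction b, hab using Nat.le_induction with
  | base => simp
  | succ b hab ih =>
    obtain ⟨h1, h2⟩ := ih fun j hj hj' => h j hj (hj'.trans (Nat.lt_succ_self b))
    obtain ⟨h3, h4⟩ := h b hab (Nat.lt_succ_self b)
    have e : b + 1 - a = (b - a) + 1 := by omega
    rw [e, pow_succ]
    constructor
    · calc c (b + 1) ≤ C * c b := h3
        _ ≤ C * (C ^ (b - a) * c a) := mul_le_mul_of_nonneg_left h1 hC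
        _ = _ := by ring
    · calc c a ≤ C ^ (b - a) * c b := h2
        _ ≤ C ^ (b - a) * (C * c (b + 1)) := mul_le_mul_of_nonneg_left h4 (by positivity)
        _ = _ := by ring

theorem eventually_ell_div_profile_le :
    ∀ᶠ n : ℕ in atTop, ∀ j k : ℕ, |(j : ℝ) - n / 2| ≤ n / 1000 → |(k : ℝ) - n / 2| ≤ n / 1000 →
      ell n k / profile n k ≤ 2 ^ (|(k : ℝ) - j| / 8) * (ell n j / profile n j) := by
  filter_upwards [eventually_ell_div_profile_step] with n hn j k hj hk
  have hC : (0 : ℝ) ≤ 2 ^ (1 / 8 : ℝ) := by positivity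
  have hconv : ∀ a b : ℕ, a ≤ b →
      ((2 : ℝ) ^ (1 / 8 : ℝ)) ^ (b - a) = 2 ^ (|(b : ℝ) - a| / 8) := by
    intro a b hab
    have : (a : ℝ) ≤ b := by exact_mod_cast hab
    rw [← Real.rpow_natCast, ← Real.rpow_mul two_pos.le, Nat.cast_sub hab,
      abs_of_nonneg (by linarith)]
    congr 1; ring
  have hwin : ∀ a b : ℕ, |(a : ℝ) - n / 2| ≤ n / 1000 → |(b : ℝ) - n / 2| ≤ n / 1000 →
      ∀ i, a ≤ i → i < b → |(i : ℝ) - n / 2| ≤ n / 1000 := by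
    intro a b ha hb i hai hib
    have h1 : (a : ℝ) ≤ i := by exact_mod_cast hai
    have h2 : (i : ℝ) ≤ b := by exact_mod_cast hib.le
    rw [abs_le] at *
    constructor <;> linarith [ha.1, hb.2]
  rcases le_total j k with h | h
  · have := (le_pow_mul_of_forall_step (c := fun k => ell n k / profile n k) hC h
      fun i hi hi' => hn i (hwin j k hj hk i hi hi')).1
    rwa [hconv j k h] at this
  · have := (le_pow_mul_of_forall_step (c := fun k => ell n k / profile n k) hC h
      fun i hi hi' => hn i (hwin k j hk hj i hi hi')).2
    rwa [hconv k j h, abs_sub_comm] at this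

theorem eventually_sq_sub_half_le :
    ∀ᶠ n : ℕ in atTop, 1 ≤ muL n ∧ ∀ k : ℕ, muL n ≤ k → (k : ℝ) < muL n + 1 →
      ((k : ℝ) - n / 2) ^ 2 ≤ n := by
  filter_upwards [eventually_log_sq_le] with n hn
  obtain ⟨hL, hLn⟩ := hn
  have hn6 : (10 : ℝ) ^ 8 ≤ n := by nlinarith
  set L := Real.log n with hLdef
  have hlog2 : (1 / 2 : ℝ) < Real.log 2 := by linarith [Real.log_two_gt_d9]
  have hl : Real.logb 2 n ≤ 2 * L := by
    rw [Real.logb, div_le_iff₀ (by linarith)]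
    nlinarith
  have hll0 : 0 ≤ Real.logb 2 L := Real.logb_nonneg (by norm_num) (by linarith)
  have hll1 : Real.logb 2 L ≤ Real.logb 2 n :=
    Real.logb_le_logb_of_le (by norm_num) (by linarith) (by nlinarith)
  have h1 : (n : ℝ) / 2 - L ≤ muL n := by
    unfold muL; linarith
  have h2 : muL n ≤ n / 2 := by
    unfold muL; linarith
  refine ⟨by nlinarith, fun k hk1 hk2 => ?_⟩
  have h3 : |(k : ℝ) - n / 2| ≤ L := by
    rw [abs_le]; constructor <;> linarith
  have := sq_le_sq' (abs_le.1 h3).1 (abs_le.1 h3).2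
  nlinarith

theorem two_pow_mul_sub_eq {n k : ℕ} (hk : k ≤ n) :
    (2 : ℝ) ^ (k * (n - k)) = 2 ^ ((n : ℝ) ^ 2 / 4 - ((k : ℝ) - n / 2) ^ 2) := by
  rw [← Real.rpow_natCast]
  congr 1
  push_cast [Nat.cast_sub hk]
  ring

theorem eventually_sum_ell_far_le :
    ∀ᶠ n : ℕ in atTop, ∀ k₀ : ℕ, muL n ≤ k₀ → (k₀ : ℝ) < muL n + 1 →
      ∑ k ∈ (Finset.range (n + 1)).filter (fun k : ℕ => ¬ |(k : ℝ) - n / 2| ≤ n / 1000),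
        (ell n k : ℝ) ≤ (n : ℝ) ^ (-(n : ℝ)) * ell n k₀ := by
  filter_upwards [eventually_log_sq_le, eventually_sq_sub_half_le] with n hn hμ k₀ hk1 hk2
  obtain ⟨hL, hLn⟩ := hn
  have hsq := hμ.2 k₀ hk1 hk2
  have hn6 : (10 : ℝ) ^ 8 ≤ n := by nlinarith
  have hn0 : (0 : ℝ) < n := by linarith
  have hnN : 0 < n := by exact_mod_cast hn0
  set L := Real.log n with hLdef
  have hlog2 : (1 / 2 : ℝ) < Real.log 2 := by linarith [Real.log_two_gt_d9]
  set l := Real.logb 2 n with hldef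
  have hl : l ≤ 2 * L := by
    rw [hldef, Real.logb, div_le_iff₀ (by linarith)]
    nlinarith
  have hln : 3 + 2 * l ≤ n / 10 ^ 6 := by
    rw [le_div_iff₀ (by norm_num)]; nlinarith
  have hnl : (n : ℝ) = 2 ^ l := (Real.rpow_logb two_pos (by norm_num) hn0).symm
  have hk₀n : k₀ ≤ n := by
    have : |(k₀ : ℝ) - n / 2| ≤ n / 2 := abs_le_of_sq_le_sq (by nlinarith) (by positivity)
    have : (k₀ : ℝ) ≤ n := by linarith [(abs_le.1 this).2]
    exact_mod_cast this
  have hlow : (2 : ℝ) ^ ((n : ℝ) ^ 2 / 4 - n) ≤ ell n k₀ := by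
    have h1 : (2 : ℝ) ^ ((n : ℝ) ^ 2 / 4 - n) ≤ (2 : ℝ) ^ (k₀ * (n - k₀)) := by
      rw [two_pow_mul_sub_eq hk₀n]
      exact Real.rpow_le_rpow_of_exponent_le one_le_two (by linarith)
    have h2 : 2 ^ (k₀ * (n - k₀)) ≤ ell n k₀ := by
      unfold ell
      have hc := Nat.choose_pos hk₀n
      have hb := bell_pos (n - k₀)
      calc 2 ^ (k₀ * (n - k₀)) = 1 * 2 ^ (k₀ * (n - k₀)) * 1 := by ring
        _ ≤ _ := by gcongr <;> omega
    exact h1.trans (by exact_mod_cast h2)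
  have hup : ∀ k ∈ (Finset.range (n + 1)).filter
      (fun k : ℕ => ¬ |(k : ℝ) - n / 2| ≤ n / 1000),
      (ell n k : ℝ) ≤ 2 ^ (n : ℝ) * 2 ^ ((n : ℝ) ^ 2 / 4 - n ^ 2 / 10 ^ 6) * 2 ^ (l * n) := by
    intro k hk
    rw [Finset.mem_filter, Finset.mem_range] at hk
    have hkn : k ≤ n := by omega
    have hfar : (n : ℝ) ^ 2 / 10 ^ 6 ≤ ((k : ℝ) - n / 2) ^ 2 := by
      have h := not_le.1 hk.2
      rw [← sq_abs ((k : ℝ) - n / 2)]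
      have := pow_le_pow_left₀ (by positivity) h.le 2
      calc (n : ℝ) ^ 2 / 10 ^ 6 = (n / 1000) ^ 2 := by ring
        _ ≤ _ := this
    have h1 : (n.choose k : ℝ) ≤ 2 ^ (n : ℝ) := by
      rw [Real.rpow_natCast]
      exact_mod_cast Nat.choose_le_two_pow n k
    have h2 : (2 : ℝ) ^ (k * (n - k)) ≤ 2 ^ ((n : ℝ) ^ 2 / 4 - n ^ 2 / 10 ^ 6) := by
      rw [two_pow_mul_sub_eq hkn]
      exact Real.rpow_le_rpow_of_exponent_le one_le_two (by linarith)
    have h3 : (bell (n - k) : ℝ) ≤ 2 ^ (l * n) := by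
      rw [Real.rpow_mul two_pos.le, ← hnl, Real.rpow_natCast]
      have : bell (n - k) ≤ n ^ n :=
        (bell_le_pow_self _).trans ((Nat.pow_le_pow_left (Nat.sub_le n k) _).trans
          (Nat.pow_le_pow_right hnN (Nat.sub_le n k)))
      exact_mod_cast this
    unfold ell
    push_cast
    gcongr
  refine (Finset.sum_le_card_nsmul _ _ _ hup).trans ?_
  have hcard : (((Finset.range (n + 1)).filter
      (fun k : ℕ => ¬ |(k : ℝ) - n / 2| ≤ n / 1000)).card : ℝ) ≤ 2 ^ (n : ℝ) := by
    rw [Real.rpow_natCast]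
    have h1 := Finset.card_filter_le (Finset.range (n + 1))
      (fun k : ℕ => ¬ |(k : ℝ) - n / 2| ≤ n / 1000)
    rw [Finset.card_range] at h1
    have h2 : n < 2 ^ n := Nat.lt_two_pow_self
    exact_mod_cast h1.trans h2
  rw [nsmul_eq_mul]
  calc _ ≤ (2 : ℝ) ^ (n : ℝ) *
        (2 ^ (n : ℝ) * 2 ^ ((n : ℝ) ^ 2 / 4 - n ^ 2 / 10 ^ 6) * 2 ^ (l * n)) :=
        mul_le_mul_of_nonneg_right hcard (by positivity)
    _ = 2 ^ ((n : ℝ) + (n + ((n : ℝ) ^ 2 / 4 - n ^ 2 / 10 ^ 6) + l * n)) := by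
        rw [Real.rpow_add two_pos, Real.rpow_add two_pos, Real.rpow_add two_pos]
    _ ≤ 2 ^ (l * (-n) + ((n : ℝ) ^ 2 / 4 - n)) := by
        refine Real.rpow_le_rpow_of_exponent_le one_le_two ?_
        have := mul_le_mul_of_nonneg_left hln hn0.le
        nlinarith
    _ = (n : ℝ) ^ (-(n : ℝ)) * 2 ^ ((n : ℝ) ^ 2 / 4 - n) := by
        rw [Real.rpow_add two_pos, Real.rpow_mul two_pos.le, ← hnl]
    _ ≤ _ := mul_le_mul_of_nonneg_left hlow (by positivity)

theorem two_rpow_eighth_le : (2 : ℝ) ^ (1 / 8 : ℝ) ≤ 1.095 := by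
  have h : ((1.095 : ℝ) ^ (8 : ℕ)) ^ (1 / 8 : ℝ) = 1.095 := by
    rw [one_div]
    exact Real.pow_rpow_inv_natCast (by norm_num) (by norm_num)
  rw [← h]
  exact Real.rpow_le_rpow (by norm_num) (by norm_num) (by norm_num)

theorem le_two_rpow_five_halves : (5.6 : ℝ) ≤ 2 ^ (5 / 2 : ℝ) := by
  refine le_of_pow_le_pow_left₀ two_ne_zero (by positivity) ?_
  rw [← Real.rpow_natCast (2 ^ (5 / 2 : ℝ)) 2, ← Real.rpow_mul two_pos.le]
  norm_num

theorem sum_half_pow_le {A : Finset ℕ} {f : ℕ → ℕ} (hf : Set.InjOn f A) :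
    ∑ k ∈ A, (1 / 2 : ℝ) ^ f k ≤ 2 := by
  rw [← Finset.sum_image (f := fun i => (1 / 2 : ℝ) ^ i) hf]
  exact (summable_geometric_two.sum_le_tsum _ fun i _ => by positivity).trans_eq
    tsum_geometric_two

theorem half_pow_eq (i : ℕ) : (1 / 2 : ℝ) ^ i = 2 ^ (-(i : ℝ)) := by
  rw [Real.rpow_neg two_pos.le, Real.rpow_natCast, one_div, inv_pow]

/-- If the terms decay at least geometrically away from `[lo, hi]`, so that
`a k ≤ B / 2 ^ (k - hi)` beyond `hi` and `a k ≤ B / 2 ^ (lo - k)` before `lo`,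
then they sum to at most `4 B`. -/
theorem sum_le_four_mul {A : Finset ℕ} {a : ℕ → ℝ} {B : ℝ} {lo hi : ℕ} (hB : 0 ≤ B)
    (h : ∀ k ∈ A, (hi ≤ k ∧ a k ≤ B * (1 / 2) ^ (k - hi)) ∨
      (k ≤ lo ∧ a k ≤ B * (1 / 2) ^ (lo - k))) :
    ∑ k ∈ A, a k ≤ 4 * B := by
  have h1 : ∑ k ∈ A.filter (fun k => hi ≤ k), (1 / 2 : ℝ) ^ (k - hi) ≤ 2 := by
    refine sum_half_pow_le (f := fun k => k - hi) fun i hi' j hj hij => ?_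
    simp only [Finset.coe_filter, Set.mem_ofPred_eq] at hi' hj hij
    omega
  have h2 : ∑ k ∈ A.filter (fun k => k ≤ lo), (1 / 2 : ℝ) ^ (lo - k) ≤ 2 := by
    refine sum_half_pow_le (f := fun k => lo - k) fun i hi' j hj hij => ?_
    simp only [Finset.coe_filter, Set.mem_ofPred_eq] at hi' hj hij
    omega
  rw [Finset.sum_filter] at h1 h2
  have h3 : ∑ k ∈ A, a k ≤ ∑ k ∈ A, B * ((if hi ≤ k then (1 / 2 : ℝ) ^ (k - hi) else 0) +
      (if k ≤ lo then (1 / 2 : ℝ) ^ (lo - k) else 0)) := by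
    refine Finset.sum_le_sum fun k hk => ?_
    rcases h k hk with ⟨hk1, hk2⟩ | ⟨hk1, hk2⟩
    · refine hk2.trans (mul_le_mul_of_nonneg_left ?_ hB)
      rw [if_pos hk1]
      exact le_add_of_nonneg_right (by split_ifs <;> positivity)
    · refine hk2.trans (mul_le_mul_of_nonneg_left ?_ hB)
      rw [if_pos hk1]
      exact le_add_of_nonneg_left (by split_ifs <;> positivity)
  rw [← Finset.mul_sum, Finset.sum_add_distrib] at h3
  nlinarith

theorem ell_le_of_div_profile_le {n j k : ℕ}
    (h : ell n k / profile n k ≤ 2 ^ (|(k : ℝ) - j| / 8) * (ell n j / profile n j)) :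
    (ell n k : ℝ) ≤ ell n j * 2 ^ (|(k : ℝ) - j| / 8
      + (-((k : ℝ) - muL n) ^ 2 + ((k : ℝ) - muL n))
      - (-((j : ℝ) - muL n) ^ 2 + ((j : ℝ) - muL n))) := by
  rw [div_le_iff₀ (profile_pos n k)] at h
  refine h.trans (le_of_eq ?_)
  rw [Real.rpow_sub two_pos, Real.rpow_add two_pos]
  unfold profile
  ring

theorem tailL_le_of_window {n k₀ : ℕ} (hk1 : muL n ≤ k₀) (hk2 : (k₀ : ℝ) < muL n + 1)
    (hk0n : k₀ ≤ n) {W : ℕ → Prop} {η : ℝ}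
    (hW : ∀ k, W k → (ell n k : ℝ) ≤ ell n k₀ * 2 ^ (|(k : ℝ) - k₀| / 8
      + (-((k : ℝ) - muL n) ^ 2 + ((k : ℝ) - muL n))
      - (-((k₀ : ℝ) - muL n) ^ 2 + ((k₀ : ℝ) - muL n))))
    (hfar : ∑ k ∈ (Finset.range (n + 1)).filter (fun k => ¬ W k), (ell n k : ℝ)
      ≤ η * ell n k₀) (hη : 0 ≤ η) (x : ℝ) (hx : 1 < x) :
    tailL n x ≤ 2 ^ (-(x - 2) ^ 2 + 2) + η := by
  have hsum : (scrL n : ℝ) = ∑ k ∈ Finset.range (n + 1), (ell n k : ℝ) := by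
    unfold scrL; push_cast; rfl
  have hA0 : (0 : ℝ) ≤ ell n k₀ := Nat.cast_nonneg _
  have hAle : (ell n k₀ : ℝ) ≤ scrL n := by
    rw [hsum]
    exact Finset.single_le_sum (f := fun k => (ell n k : ℝ)) (fun _ _ => Nat.cast_nonneg _)
      (Finset.mem_range.2 (by omega))
  have hS0 : (0 : ℝ) ≤ scrL n := Nat.cast_nonneg _
  unfold tailL
  rcases le_or_gt x 3 with hx3 | hx3
  · have h1 : (1 : ℝ) ≤ 2 ^ (-(x - 2) ^ 2 + 2) :=
      Real.one_le_rpow one_le_two (by nlinarith)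
    refine le_trans (div_le_one_of_le₀ ?_ hS0) (by linarith)
    rw [hsum]
    exact Finset.sum_le_sum_of_subset_of_nonneg (Finset.filter_subset _ _)
      fun _ _ _ => Nat.cast_nonneg _
  refine div_le_of_le_mul₀ hS0 (by positivity) ?_
  set T := (Finset.range (n + 1)).filter (fun k : ℕ => x ≤ |(k : ℝ) - muL n|) with hT
  rw [← Finset.sum_filter_add_sum_filter_not T W, add_mul]
  have hfar' : ∑ k ∈ T.filter (fun k => ¬ W k), (ell n k : ℝ) ≤ η * scrL n := by
    refine le_trans ?_ (hfar.trans (mul_le_mul_of_nonneg_left hAle hη))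
    exact Finset.sum_le_sum_of_subset_of_nonneg
      (Finset.filter_subset_filter _ (Finset.filter_subset _ _)) fun _ _ _ => Nat.cast_nonneg _
  refine add_le_add ?_ hfar'
  set y₀ := (k₀ : ℝ) - muL n with hy₀
  have hy0 : 0 ≤ y₀ := by linarith
  have hy1 : y₀ < 1 := by linarith
  have hE0 : 0 ≤ -y₀ ^ 2 + y₀ := by nlinarith
  have key : ∑ k ∈ T.filter W, (ell n k : ℝ)
      ≤ 4 * (ell n k₀ * 2 ^ (-(x - 2) ^ 2 + 2 - 5)) := by
    refine sum_le_four_mul (lo := ⌊muL n - x⌋₊) (hi := ⌈muL n + x⌉₊) (by positivity) ?_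
    intro k hk
    simp only [hT, Finset.mem_filter] at hk
    obtain ⟨⟨-, hxk⟩, hWk⟩ := hk
    have hb := hW k hWk
    set y := (k : ℝ) - muL n with hy
    have hkk : (k : ℝ) - k₀ = y - y₀ := by rw [hy, hy₀]; ring
    rw [hkk] at hb
    have hfin : ∀ i : ℕ, (|y - y₀| / 8 + (-y ^ 2 + y) - (-y₀ ^ 2 + y₀)
        ≤ (-(x - 2) ^ 2 + 2 - 5) + (-(i : ℝ))) →
        (ell n k : ℝ) ≤ ell n k₀ * 2 ^ (-(x - 2) ^ 2 + 2 - 5) * (1 / 2) ^ i := by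
      intro i hi
      rw [half_pow_eq, mul_assoc, ← Real.rpow_add two_pos]
      exact hb.trans (mul_le_mul_of_nonneg_left
        (Real.rpow_le_rpow_of_exponent_le one_le_two hi) hA0)
    rcases le_abs.1 hxk with hyx | hyx
    · left
      have hc : ⌈muL n + x⌉₊ ≤ k := Nat.ceil_le.2 (by linarith)
      refine ⟨hc, hfin _ ?_⟩
      have hc' : ((k - ⌈muL n + x⌉₊ : ℕ) : ℝ) ≤ y - x := by
        rw [Nat.cast_sub hc]
        have := Nat.le_ceil (muL n + x)
        linarith
      rw [abs_of_nonneg (by linarith)]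
      nlinarith [mul_nonneg (sub_nonneg.2 hyx) (sub_nonneg.2 hx3.le)]
    · right
      have hk0 : (0 : ℝ) ≤ k := Nat.cast_nonneg k
      have hc : k ≤ ⌊muL n - x⌋₊ := Nat.le_floor (by linarith)
      refine ⟨hc, hfin _ ?_⟩
      have hc' : ((⌊muL n - x⌋₊ - k : ℕ) : ℝ) ≤ -y - x := by
        rw [Nat.cast_sub hc]
        have := Nat.floor_le (show 0 ≤ muL n - x by linarith)
        linarith
      rw [abs_of_nonpos (by linarith)]
      nlinarith [mul_nonneg (sub_nonneg.2 hyx) (sub_nonneg.2 hx3.le)]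
  refine key.trans ?_
  rw [Real.rpow_sub two_pos]
  have h32 : (2 : ℝ) ^ (5 : ℝ) = 32 := by
    rw [show (5 : ℝ) = ((5 : ℕ) : ℝ) by norm_num, Real.rpow_natCast]; norm_num
  rw [h32]
  set P := (2 : ℝ) ^ (-(x - 2) ^ 2 + 2) with hP
  have hP0 : 0 < P := by positivity
  calc 4 * ((ell n k₀ : ℝ) * (P / 32)) = P * ell n k₀ / 8 := by ring
    _ ≤ P * ell n k₀ := by linarith [mul_nonneg hP0.le hA0]
    _ ≤ P * scrL n := mul_le_mul_of_nonneg_left hAle hP0.le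

theorem scrL_le_of_window {n k₀ : ℕ} (hk1 : muL n ≤ k₀) (hk2 : (k₀ : ℝ) < muL n + 1)
    {W : ℕ → Prop} {η : ℝ}
    (hW : ∀ k, W k → (ell n k : ℝ) ≤ ell n k₀ * 2 ^ (|(k : ℝ) - k₀| / 8
      + (-((k : ℝ) - muL n) ^ 2 + ((k : ℝ) - muL n))
      - (-((k₀ : ℝ) - muL n) ^ 2 + ((k₀ : ℝ) - muL n))))
    (hfar : ∑ k ∈ (Finset.range (n + 1)).filter (fun k => ¬ W k), (ell n k : ℝ)
      ≤ η * ell n k₀) :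
    (scrL n : ℝ) ≤ (5.38 + η) * ell n k₀ := by
  have hsum : (scrL n : ℝ) = ∑ k ∈ Finset.range (n + 1), (ell n k : ℝ) := by
    unfold scrL; push_cast; rfl
  have hA0 : (0 : ℝ) ≤ ell n k₀ := Nat.cast_nonneg _
  rw [hsum, ← Finset.sum_filter_add_sum_filter_not _ W, add_mul]
  refine add_le_add ?_ hfar
  set T := (Finset.range (n + 1)).filter W with hT
  have hsub : ∑ k ∈ T, (ell n k : ℝ) ≤ ell n k₀ + ∑ k ∈ T.erase k₀, (ell n k : ℝ) := by
    by_cases h : k₀ ∈ T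
    · rw [Finset.add_sum_erase T (fun k => (ell n k : ℝ)) h]
    · rw [Finset.erase_eq_of_notMem h]; linarith
  set y₀ := (k₀ : ℝ) - muL n with hy₀
  have hy0 : 0 ≤ y₀ := by linarith
  have hy1 : y₀ < 1 := by linarith
  have key : ∑ k ∈ T.erase k₀, (ell n k : ℝ) ≤ 4 * (ell n k₀ * 2 ^ (1 / 8 : ℝ)) := by
    refine sum_le_four_mul (lo := k₀ - 1) (hi := k₀ + 1) (by positivity) ?_
    intro k hk
    simp only [hT, Finset.mem_erase, Finset.mem_filter] at hk
    obtain ⟨hne, -, hWk⟩ := hk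
    have hb := hW k hWk
    have hfin : ∀ i : ℕ, (|(k : ℝ) - k₀| / 8 + (-((k : ℝ) - muL n) ^ 2 + ((k : ℝ) - muL n))
        - (-y₀ ^ 2 + y₀) ≤ 1 / 8 + (-(i : ℝ))) →
        (ell n k : ℝ) ≤ ell n k₀ * 2 ^ (1 / 8 : ℝ) * (1 / 2) ^ i := by
      intro i hi
      rw [half_pow_eq, mul_assoc, ← Real.rpow_add two_pos]
      exact hb.trans (mul_le_mul_of_nonneg_left
        (Real.rpow_le_rpow_of_exponent_le one_le_two hi) hA0)
    have hquad : ∀ i : ℕ, 0 ≤ (i : ℝ) * (i - 1 / 8) := by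
      intro i
      rcases Nat.eq_zero_or_pos i with h | h
      · simp [h]
      · have : (1 : ℝ) ≤ i := by exact_mod_cast h
        exact mul_nonneg (by linarith) (by linarith)
    rcases lt_or_gt_of_ne hne with h | h
    · right
      refine ⟨by omega, hfin _ ?_⟩
      obtain ⟨i, rfl⟩ := Nat.exists_eq_add_of_lt h
      have e : k + i + 1 - 1 - k = i := by omega
      rw [e]
      have hq := hquad i
      have hi0 : (0 : ℝ) ≤ i := Nat.cast_nonneg i
      push_cast at hy₀ ⊢
      have hk : (k : ℝ) - muL n = y₀ - i - 1 := by rw [hy₀]; ring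
      rw [hk, show (k : ℝ) - (k + i + 1) = -(i + 1) by ring, abs_neg,
        abs_of_nonneg (by linarith)]
      nlinarith [mul_nonneg hi0 (sub_nonneg.2 hy1.le)]
    · left
      refine ⟨by omega, hfin _ ?_⟩
      obtain ⟨i, rfl⟩ := Nat.exists_eq_add_of_lt h
      have e : k₀ + i + 1 - (k₀ + 1) = i := by omega
      rw [e]
      have hq := hquad i
      have hi0 : (0 : ℝ) ≤ i := Nat.cast_nonneg i
      push_cast
      have hk : (k₀ : ℝ) + i + 1 - muL n = y₀ + i + 1 := by rw [hy₀]; ring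
      rw [hk, show (k₀ : ℝ) + i + 1 - k₀ = i + 1 by ring, abs_of_nonneg (by linarith)]
      nlinarith [mul_nonneg hi0 hy0]
  have := mul_le_mul_of_nonneg_left two_rpow_eighth_le hA0
  linarith

theorem le_tailL_of_scrL_le {n k₀ k : ℕ} (hk2 : (k₀ : ℝ) < muL n + 1)
    {x : ℝ} (hx : 1 < x) (hkn : k ≤ n) (hxk : muL n + x ≤ k) (hxk' : (k : ℝ) < muL n + x + 1)
    (hk : (ell n k₀ : ℝ) ≤ ell n k * 2 ^ (|(k₀ : ℝ) - k| / 8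
      + (-((k₀ : ℝ) - muL n) ^ 2 + ((k₀ : ℝ) - muL n))
      - (-((k : ℝ) - muL n) ^ 2 + ((k : ℝ) - muL n))))
    (hS : (scrL n : ℝ) ≤ 5.6 * ell n k₀) :
    (2 : ℝ) ^ (-(x + 1) ^ 2 - 1) ≤ tailL n x := by
  have hkpos : 0 < ell n k := by
    unfold ell
    have := Nat.choose_pos hkn
    have := bell_pos (n - k)
    positivity
  have hkposR : (0 : ℝ) < ell n k := by exact_mod_cast hkpos
  have hS0 : (0 : ℝ) < scrL n := by
    have : 0 < scrL n := Finset.sum_pos' (fun _ _ => Nat.zero_le _)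
      ⟨k, Finset.mem_range.2 (by omega), hkpos⟩
    exact_mod_cast this
  unfold tailL
  rw [le_div_iff₀ hS0]
  have hmem : (ell n k : ℝ) ≤
      ∑ k ∈ (Finset.range (n + 1)).filter (fun k : ℕ => x ≤ |(k : ℝ) - muL n|), (ell n k : ℝ) := by
    refine Finset.single_le_sum (f := fun k => (ell n k : ℝ)) (fun _ _ => Nat.cast_nonneg _) ?_
    rw [Finset.mem_filter, Finset.mem_range]
    exact ⟨by omega, le_abs.2 (Or.inl (by linarith))⟩
  refine le_trans ?_ hmem
  set y₀ := (k₀ : ℝ) - muL n with hy₀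
  set y := (k : ℝ) - muL n with hy
  have hkk : (k₀ : ℝ) - k = y₀ - y := by rw [hy, hy₀]; ring
  rw [hkk, abs_of_nonpos (by linarith)] at hk
  set e := -(y₀ - y) / 8 + (-y₀ ^ 2 + y₀) - (-y ^ 2 + y) with he
  have hexp : -(x + 1) ^ 2 - 1 + 5 / 2 + e ≤ 0 := by
    have h1 : 0 ≤ (x + 1 - y) * (x + 1 + y - 7 / 8) :=
      mul_nonneg (by linarith) (by linarith)
    nlinarith [sq_nonneg (y₀ - 1 / 2)]
  have hP0 : (0 : ℝ) < 2 ^ (-(x + 1) ^ 2 - 1) := by positivity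
  calc (2 : ℝ) ^ (-(x + 1) ^ 2 - 1) * (scrL n : ℝ)
      ≤ 2 ^ (-(x + 1) ^ 2 - 1) * (2 ^ (5 / 2 : ℝ) * (ell n k * 2 ^ e)) := by
        refine mul_le_mul_of_nonneg_left (hS.trans ?_) hP0.le
        exact mul_le_mul le_two_rpow_five_halves hk (Nat.cast_nonneg _) (by positivity)
    _ = (ell n k : ℝ) * 2 ^ (-(x + 1) ^ 2 - 1 + 5 / 2 + e) := by
        rw [Real.rpow_add two_pos, Real.rpow_add two_pos]; ring
    _ ≤ (ell n k : ℝ) * 1 :=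
        mul_le_mul_of_nonneg_left
          (Real.rpow_le_one_of_one_le_of_nonpos one_le_two hexp) hkposR.le
    _ = (ell n k : ℝ) := mul_one _

/-- Concentration of the distribution `L(n)`: for large `n` and every `x > 1`,
`P(|X − μ| ≥ x) ≤ 2^{−(x−2)²+2} + n^{−n}`, and moreover for `1 < x ≤ n^{2/3}`,
`P(|X − μ| ≥ x) ≥ 2^{−(x+1)²−1}`. -/
theorem concentration_L :
    ∃ n₀ : ℕ, ∀ n : ℕ, n₀ ≤ n → ∀ x : ℝ, 1 < x →
      tailL n x ≤ (2 : ℝ) ^ (-(x - 2) ^ 2 + 2) + (n : ℝ) ^ (-(n : ℝ)) ∧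
        (x ≤ (n : ℝ) ^ ((2 : ℝ) / 3) → (2 : ℝ) ^ (-(x + 1) ^ 2 - 1) ≤ tailL n x) := by
  refine eventually_atTop.1 ?_
  filter_upwards [eventually_log_sq_le, eventually_sq_sub_half_le, eventually_sum_ell_far_le,
    eventually_ell_div_profile_le] with n hn hμ hfar hW x hx
  obtain ⟨hL, hLn⟩ := hn
  obtain ⟨hμ1, hsq⟩ := hμ
  have hn13 : (10 : ℝ) ^ 13 ≤ n := by nlinarith
  have hn0 : (0 : ℝ) < n := by linarith
  set k₀ := ⌈muL n⌉₊ with hk₀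
  have hk1 : muL n ≤ k₀ := Nat.le_ceil _
  have hk2 : (k₀ : ℝ) < muL n + 1 := Nat.ceil_lt_add_one (by linarith)
  have hclose : |(k₀ : ℝ) - n / 2| ≤ n / 10 ^ 4 :=
    abs_le_of_sq_le_sq ((hsq k₀ hk1 hk2).trans (by nlinarith)) (by positivity)
  have hwin : |(k₀ : ℝ) - n / 2| ≤ n / 1000 := hclose.trans (by linarith)
  rw [abs_le] at hclose
  have hk₀n : k₀ ≤ n := by
    have : (k₀ : ℝ) ≤ n := by linarith
    exact_mod_cast this
  have hη0 : (0 : ℝ) ≤ (n : ℝ) ^ (-(n : ℝ)) := by positivity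
  have hup := fun k hk => ell_le_of_div_profile_le (hW k₀ k hwin hk)
  refine ⟨tailL_le_of_window hk1 hk2 hk₀n hup (hfar k₀ hk1 hk2) hη0 x hx, fun hxn => ?_⟩
  have hη : (n : ℝ) ^ (-(n : ℝ)) ≤ 0.22 := by
    calc (n : ℝ) ^ (-(n : ℝ)) ≤ (n : ℝ) ^ (-(1 : ℝ)) :=
          Real.rpow_le_rpow_of_exponent_le (by linarith) (by linarith)
      _ = 1 / n := by rw [Real.rpow_neg_one, one_div]
      _ ≤ 0.22 := by rw [div_le_iff₀ hn0]; linarith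
  have hxn' : x ≤ n / 4000 := by
    have h1 : (4000 : ℝ) ≤ (n : ℝ) ^ (1 / 3 : ℝ) := by
      have h : ((4000 : ℝ) ^ (3 : ℕ)) ^ (1 / 3 : ℝ) = 4000 := by
        rw [one_div]
        exact Real.pow_rpow_inv_natCast (by norm_num) (by norm_num)
      rw [← h]
      exact Real.rpow_le_rpow (by norm_num) (by linarith) (by norm_num)
    have h2 : (n : ℝ) ^ (2 / 3 : ℝ) * (n : ℝ) ^ (1 / 3 : ℝ) = n := by
      rw [← Real.rpow_add hn0]; norm_num
    rw [le_div_iff₀ (by norm_num)]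
    calc x * 4000 ≤ (n : ℝ) ^ (2 / 3 : ℝ) * (n : ℝ) ^ (1 / 3 : ℝ) :=
          mul_le_mul hxn h1 (by norm_num) (by positivity)
      _ = n := h2
  set k := ⌈muL n + x⌉₊ with hk
  have hxk : muL n + x ≤ k := Nat.le_ceil _
  have hxk' : (k : ℝ) < muL n + x + 1 := Nat.ceil_lt_add_one (by linarith)
  have hwk : |(k : ℝ) - n / 2| ≤ n / 1000 := by
    rw [abs_le]; constructor <;> linarith
  have hkn : k ≤ n := by
    have : (k : ℝ) ≤ n := by linarith
    exact_mod_cast this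
  refine le_tailL_of_scrL_le hk2 hx hkn hxk hxk'
    (ell_le_of_div_profile_le (hW k k₀ hwk hwin)) ?_
  refine (scrL_le_of_window hk1 hk2 hup (hfar k₀ hk1 hk2)).trans ?_
  exact mul_le_mul_of_nonneg_right (by linarith) (Nat.cast_nonneg _)
end
end

section
/- For every ε > 0 there exists n₀ such that for all n ≥ n₀, the probability that the random bipartite graph G_{n,n,1/2} fails to be Hamiltonian (i.e. fails to contain a cycle through all 2n vertices) satisfies 2^{−(1+ε)n} ≤ P(G_{n,n,1/2} is not Hamiltonian) ≤ 2^{−(1−ε)n}. -/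
open scoped Classical
open Filter

noncomputable section

/-- the bipartite graph with parts `Fin n` and `Fin m` and edge set `E` -/
def bipGraph (n m : ℕ) (E : Finset (Fin n × Fin m)) : SimpleGraph (Fin n ⊕ Fin m) :=
  SimpleGraph.fromRel (fun u v => ∃ a b, u = Sum.inl a ∧ v = Sum.inr b ∧ (a, b) ∈ E)

/-- the probability that the random bipartite graph `G_{n,n,1/2}` is not Hamiltonian -/
def bipNonHamProb (n : ℕ) : ℝ :=
  (Nat.card {E : Finset (Fin n × Fin n) // ¬ (bipGraph n n E).IsHamiltonian} : ℝ) /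
    (2 : ℝ) ^ (n * n)

open SimpleGraph

/-- A cyclic list of at least three vertices covering the graph, with consecutive vertices
adjacent, witnesses Hamiltonicity. -/
theorem isHamiltonian_of_isChain {V : Type*} [Fintype V] [DecidableEq V] {G : SimpleGraph V}
    (l : List V) (hlen : l.length = Fintype.card V) (hmem : ∀ v, v ∈ l) (h3 : 3 ≤ l.length)
    (hchain : l.IsChain G.Adj) (hclose : ∀ x ∈ l.head?, ∀ y ∈ l.getLast?, G.Adj y x) :
    G.IsHamiltonian := by
  intro _
  have hnd : l.Nodup := by
    rw [← Multiset.coe_nodup, ← Multiset.toFinset_card_eq_card_iff_nodup, Multiset.coe_card, hlen]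
    rw [← Finset.card_univ]
    congr 1
    ext v
    simp [hmem]
  have hne : l ≠ [] := by rintro rfl; simp at h3
  have hadj : G.Adj (l.getLast hne) (l.head hne) :=
    hclose _ (by simp [List.head?_eq_some_head hne]) _ (by simp [List.getLast?_eq_some_getLast hne])
  refine ⟨_, .cons hadj (.ofSupport l hne hchain), ?_⟩
  rw [Walk.isHamiltonianCycle_iff_isCycle_and_length_eq]
  have hp : (Walk.ofSupport l hne hchain).IsPath := by
    rw [Walk.isPath_def, Walk.support_ofSupport]; exact hnd
  refine ⟨?_, ?_⟩
  · rw [Walk.cons_isCycle_iff]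
    refine ⟨hp, fun h => ?_⟩
    have := hp.length_eq_one_of_mem_edges (by rwa [Sym2.eq_swap])
    simp at this
    omega
  · simp; omega

/-- Consecutive values of a sequence form a chain if consecutive terms are adjacent. -/
theorem isChain_map_range' {V : Type*} {G : SimpleGraph V} {f : ℕ → V} {s k N : ℕ}
    (hf : ∀ i, i + 1 < N → G.Adj (f i) (f (i + 1))) (h : s + k ≤ N) :
    ((List.range' s k).map f).IsChain G.Adj := by
  rw [List.isChain_iff_getElem]
  intro i hi
  simp at hi ⊢
  exact hf _ (by omega)

/-- A Hamiltonian path `f 0, …, f (N - 1)` with chords `f 0 f k` and `f m f (N - 1)`, `k ≤ m`,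
closes up to a Hamiltonian cycle if `f (k - 1)` and `f (m + 1)` are adjacent. -/
theorem isHamiltonian_of_noncrossing {V : Type*} [Fintype V] [DecidableEq V] {G : SimpleGraph V}
    {f : ℕ → V} {N k m : ℕ} (hN : N = Fintype.card V) (h3 : 3 ≤ N)
    (hsurj : ∀ v, ∃ i < N, f i = v) (hf : ∀ i, i + 1 < N → G.Adj (f i) (f (i + 1)))
    (hk : 1 ≤ k) (hkm : k ≤ m) (hm : m + 1 < N)
    (hadj₀ : G.Adj (f 0) (f k)) (hadj₁ : G.Adj (f m) (f (N - 1)))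
    (hadj : G.Adj (f (k - 1)) (f (m + 1))) : G.IsHamiltonian := by
  have hc := fun s j => isChain_map_range' (s := s) (k := j) hf
  have hr : ∀ s j, s + j ≤ N → ((List.range' s j).map f).reverse.IsChain G.Adj := by
    intro s j h
    rw [List.isChain_reverse]
    simpa only [G.adj_comm] using hc s j h
  refine isHamiltonian_of_isChain (((List.range' 0 k).map f).reverse ++
    ((List.range' k (m + 1 - k)).map f ++
      ((List.range' (m + 1) (N - m - 1)).map f).reverse)) ?_ ?_ ?_ ?_ ?_
  · simp; omega
  · intro v
    obtain ⟨i, hi, rfl⟩ := hsurj v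
    simp only [List.mem_append, List.mem_reverse]
    rcases lt_or_ge i k with h | h
    · exact .inl (List.mem_map_of_mem (by simp; omega))
    rcases lt_or_ge i (m + 1) with h' | h'
    · exact .inr (.inl (List.mem_map_of_mem (by simp; omega)))
    · exact .inr (.inr (List.mem_map_of_mem (by simp; omega)))
  · simp; omega
  · have e1 : k ≠ 0 := by omega
    have e2 : m + 1 - k ≠ 0 := by omega
    have e3 : N - m - 1 ≠ 0 := by omega
    have e4 : k + (m + 1 - k) - 1 = m := by omega
    have e5 : m + 1 + (N - m - 1) - 1 = N - 1 := by omega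
    rw [List.isChain_append, List.isChain_append]
    refine ⟨hr _ _ (by omega), ⟨hc _ _ (by omega), hr _ _ (by omega), ?_⟩, ?_⟩
    · simp [List.getLast?_range', e2, e3, e4, e5, hadj₁]
    · simp [List.head?_range', List.getLast?_range', e1, e2, e3, e5, hadj₀]
  · have e1 : k ≠ 0 := by omega
    have e3 : N - m - 1 ≠ 0 := by omega
    simp [List.head?_range', List.getLast?_range', e1, e3, hadj.symm]

/-- A Hamiltonian path `f 0, …, f (N - 1)` with chords `f 0 f k` and `f m f (N - 1)`, `m < k`,
closes up to a Hamiltonian cycle if `f (k + 1)` and `f (m + 1)` are adjacent. -/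
theorem isHamiltonian_of_crossing {V : Type*} [Fintype V] [DecidableEq V] {G : SimpleGraph V}
    {f : ℕ → V} {N k m : ℕ} (hN : N = Fintype.card V) (h3 : 3 ≤ N)
    (hsurj : ∀ v, ∃ i < N, f i = v) (hf : ∀ i, i + 1 < N → G.Adj (f i) (f (i + 1)))
    (hmk : m < k) (hk : k + 1 < N)
    (hadj₀ : G.Adj (f 0) (f k)) (hadj₁ : G.Adj (f m) (f (N - 1)))
    (hadj : G.Adj (f (k + 1)) (f (m + 1))) : G.IsHamiltonian := by
  have hc := fun s j => isChain_map_range' (s := s) (k := j) hf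
  have hr : ∀ s j, s + j ≤ N → ((List.range' s j).map f).reverse.IsChain G.Adj := by
    intro s j h
    rw [List.isChain_reverse]
    simpa only [G.adj_comm] using hc s j h
  refine isHamiltonian_of_isChain ((List.range' (k + 1) (N - k - 1)).map f ++
    (((List.range' 0 (m + 1)).map f).reverse ++
      ((List.range' (m + 1) (k - m)).map f).reverse)) ?_ ?_ ?_ ?_ ?_
  · simp; omega
  · intro v
    obtain ⟨i, hi, rfl⟩ := hsurj v
    simp only [List.mem_append, List.mem_reverse]
    rcases lt_or_ge i (m + 1) with h | h
    · exact .inr (.inl (List.mem_map_of_mem (by simp; omega)))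
    rcases lt_or_ge i (k + 1) with h' | h'
    · exact .inr (.inr (List.mem_map_of_mem (by simp; omega)))
    · exact .inl (List.mem_map_of_mem (by simp; omega))
  · simp; omega
  · have e2 : k - m ≠ 0 := by omega
    have e3 : N - k - 1 ≠ 0 := by omega
    have e4 : m + 1 + (k - m) - 1 = k := by omega
    have e5 : k + 1 + (N - k - 1) - 1 = N - 1 := by omega
    rw [List.isChain_append, List.isChain_append]
    refine ⟨hc _ _ (by omega), ⟨hr _ _ (by omega), hr _ _ (by omega), ?_⟩, ?_⟩
    · simp [List.head?_range', List.getLast?_range', e2, e4, hadj₀]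
    · simp [List.getLast?_range', e2, e3, e4, e5, hadj₁.symm]
  · have e2 : k - m ≠ 0 := by omega
    have e3 : N - k - 1 ≠ 0 := by omega
    simp [List.head?_range', List.getLast?_range', e2, e3, hadj.symm]

/-- If adding the edge `ab` makes a graph Hamiltonian, then either it was Hamiltonian already or
it has a Hamiltonian path from `a` to `b`. -/
theorem isHamiltonian_or_exists_path {V : Type*} [Fintype V] [DecidableEq V] [Nontrivial V]
    {G H : SimpleGraph V} {a b : V} (hGH : ∀ u v, H.Adj u v → G.Adj u v ∨ s(u, v) = s(a, b))
    (hH : H.IsHamiltonian) : G.IsHamiltonian ∨ ∃ p : G.Walk a b, p.IsHamiltonian := by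
  obtain ⟨p, hp⟩ := hH.exists_isHamiltonianCycle a
  have hedge : ∀ e ∈ H.edgeSet, e ≠ s(a, b) → e ∈ G.edgeSet := by
    intro e
    induction e with | h u v =>
    intro h hne
    exact (hGH u v h).resolve_right hne
  by_cases hab : s(a, b) ∈ p.edges
  · right
    have key : ∀ q : H.Walk a a, q.IsHamiltonianCycle → q.snd = b →
        ∃ p : G.Walk a b, p.IsHamiltonian := by
      intro q hq hb
      cases q with
      | nil => exact absurd hq.isCycle (by simp)
      | @cons _ c _ h q =>
        simp only [Walk.snd_cons] at hb
        subst hb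
        have hq' := hq.isHamiltonian_tail
        have hcyc := (Walk.cons_isCycle_iff _ _).1 hq.isCycle
        have ht : ∀ e ∈ q.edges, e ∈ G.edgeSet := fun e he =>
          hedge e (q.edges_subset_edgeSet he) (by rintro rfl; exact hcyc.2 he)
        refine ⟨(q.transfer G ht).reverse, ?_⟩
        intro v
        have := hq' v
        simpa using this
    have : b = p.snd ∨ b = p.penultimate := by
      cases p with
      | nil => exact absurd hp.isCycle (by simp)
      | @cons _ c _ h q =>
        have hcyc := (Walk.cons_isCycle_iff _ _).1 hp.isCycle
        rw [Walk.edges_cons, List.mem_cons] at hab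
        rcases hab with hab | hab
        · left
          have : b = c ∨ a = c ∧ b = a := by simpa using hab
          rw [Walk.snd_cons]
          exact this.resolve_right fun hc => h.ne hc.1
        · right
          have hnil : ¬ q.Nil := fun hn => h.ne hn.eq.symm
          rw [hcyc.1.eq_penultimate_of_mem_edges hab, Walk.penultimate_cons_of_not_nil _ _ hnil]
    have hrev : p.reverse.IsHamiltonianCycle := by
      rw [Walk.isHamiltonianCycle_iff_isCycle_and_length_eq] at hp ⊢
      exact ⟨hp.1.reverse, by simpa using hp.2⟩
    rcases this with h | h
    · exact key p hp h.symm
    · exact key p.reverse hrev (by simp [h])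
  · left
    intro _
    refine ⟨a, p.transfer G fun e he => hedge e (p.edges_subset_edgeSet he)
      (by rintro rfl; exact hab he), ?_⟩
    rw [Walk.isHamiltonianCycle_iff_isCycle_and_length_eq] at hp ⊢
    exact ⟨hp.1.transfer _, by simpa using hp.2⟩

theorem bipGraph_adj_inl_inr {n m : ℕ} {E : Finset (Fin n × Fin m)} {a : Fin n} {b : Fin m} :
    (bipGraph n m E).Adj (.inl a) (.inr b) ↔ (a, b) ∈ E := by
  simp [bipGraph]

theorem bipGraph_adj_inr_inl {n m : ℕ} {E : Finset (Fin n × Fin m)} {a : Fin n} {b : Fin m} :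
    (bipGraph n m E).Adj (.inr b) (.inl a) ↔ (a, b) ∈ E := by
  simp [bipGraph]

theorem exists_of_bipGraph_adj_inl {n m : ℕ} {E : Finset (Fin n × Fin m)} {a : Fin n}
    {v : Fin n ⊕ Fin m} (h : (bipGraph n m E).Adj (.inl a) v) : ∃ b, v = .inr b := by
  cases v with
  | inl a' => simp [bipGraph] at h
  | inr b => exact ⟨b, rfl⟩

theorem exists_of_bipGraph_adj_inr {n m : ℕ} {E : Finset (Fin n × Fin m)} {b : Fin m}
    {v : Fin n ⊕ Fin m} (h : (bipGraph n m E).Adj (.inr b) v) : ∃ a, v = .inl a := by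
  cases v with
  | inl a => exact ⟨a, rfl⟩
  | inr b' => simp [bipGraph] at h

/-- A median of a finite set of natural numbers. -/
theorem exists_le_card_filter_le_and_ge (K : Finset ℕ) {s : ℕ} (hK : 2 * s ≤ K.card) :
    ∃ t, s ≤ (K.filter (· ≤ t)).card ∧ s ≤ (K.filter (t ≤ ·)).card := by
  have hex : ∃ t, s ≤ (K.filter (· ≤ t)).card := by
    refine ⟨K.sup id, ?_⟩
    rw [Finset.filter_true_of_mem fun k hk => show k ≤ K.sup id from Finset.le_sup (f := id) hk]
    omega
  obtain ⟨t, ht, hmin⟩ : ∃ t, s ≤ (K.filter (· ≤ t)).card ∧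
      ∀ t' < t, ¬ s ≤ (K.filter (· ≤ t')).card :=
    ⟨Nat.find hex, Nat.find_spec hex, fun _ => Nat.find_min hex⟩
  refine ⟨t, ht, ?_⟩
  rcases Nat.eq_zero_or_pos t with h0 | hpos
  · simp [h0]; omega
  · have hlt := hmin (t - 1) (by omega)
    have hsplit := Finset.card_filter_add_card_filter_not (s := K) (p := (t ≤ ·))
    have : K.filter (fun k => ¬ t ≤ k) = K.filter (· ≤ t - 1) :=
      Finset.filter_congr fun k _ => by omega
    rw [this] at hsplit
    omega

/-- If any two large vertex sets on opposite sides span an edge, this holds for sets of vertices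
given as images of index sets. -/
theorem exists_adj_of_injOn {n s : ℕ} {E : Finset (Fin n × Fin n)}
    (hE : ∀ A B : Finset (Fin n), s ≤ A.card → s ≤ B.card → ∃ a ∈ A, ∃ b ∈ B, (a, b) ∈ E)
    {K M : Finset ℕ} {g h : ℕ → Fin n ⊕ Fin n} (hK : s ≤ K.card) (hM : s ≤ M.card)
    (hg : Set.InjOn g K) (hh : Set.InjOn h M) (hgl : ∀ k ∈ K, ∃ a, g k = .inl a)
    (hhr : ∀ m ∈ M, ∃ b, h m = .inr b) :
    ∃ k ∈ K, ∃ m ∈ M, (bipGraph n n E).Adj (g k) (h m) := by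
  obtain ⟨a, ha, b, hb, hab⟩ := hE {a | .inl a ∈ K.image g} {b | .inr b ∈ M.image h}
    (by
      rw [← Finset.card_image_of_injOn hg] at hK
      refine hK.trans ?_
      rw [← Finset.card_map (s := Finset.filter _ _) Function.Embedding.inl]
      refine Finset.card_le_card fun v hv => ?_
      obtain ⟨k, hk, rfl⟩ := Finset.mem_image.1 hv
      obtain ⟨a, ha⟩ := hgl k hk
      rw [ha] at hv ⊢
      simpa using hv)
    (by
      rw [← Finset.card_image_of_injOn hh] at hM
      refine hM.trans ?_
      rw [← Finset.card_map (s := Finset.filter _ _) Function.Embedding.inr]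
      refine Finset.card_le_card fun v hv => ?_
      obtain ⟨k, hk, rfl⟩ := Finset.mem_image.1 hv
      obtain ⟨a, ha⟩ := hhr k hk
      rw [ha] at hv ⊢
      simpa using hv)
  rw [Finset.mem_filter_univ, Finset.mem_image] at ha hb
  obtain ⟨k, hk, hka⟩ := ha
  obtain ⟨m, hm, hmb⟩ := hb
  exact ⟨k, hk, m, hm, by rwa [hka, hmb, bipGraph_adj_inl_inr]⟩

/-- A Hamiltonian path in a bipartite graph with large minimum degree and without large empty
rectangles can be rotated and closed to a Hamiltonian cycle. -/
theorem bipGraph_isHamiltonian_of_path {n s : ℕ} {E : Finset (Fin n × Fin n)} (hn : 2 ≤ n)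
    (hE : ∀ A B : Finset (Fin n), s ≤ A.card → s ≤ B.card → ∃ a ∈ A, ∃ b ∈ B, (a, b) ∈ E)
    {a b : Fin n} (ha : 2 * s ≤ (Finset.univ.filter fun b' => (a, b') ∈ E).card)
    (hb : 2 * s ≤ (Finset.univ.filter fun a' => (a', b) ∈ E).card) (hab : (a, b) ∉ E)
    {p : (bipGraph n n E).Walk (.inl a) (.inr b)} (hp : p.IsHamiltonian) :
    (bipGraph n n E).IsHamiltonian := by
  let G := bipGraph n n E
  set f := p.getVert with hfdef
  have hcard : Fintype.card (Fin n ⊕ Fin n) = 2 * n := by simp; omega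
  have hlen : p.length = 2 * n - 1 := by rw [hp.length_eq, hcard]
  have hinj : ∀ i j, i < 2 * n → j < 2 * n → f i = f j → i = j := fun i j hi hj h =>
    hp.isPath.getVert_injOn (show i ≤ p.length by omega) (show j ≤ p.length by omega) h
  have hsurj : ∀ v, ∃ i < 2 * n, f i = v := by
    intro v
    obtain ⟨i, hi, hle⟩ := Walk.mem_support_iff_exists_getVert.1 (hp.mem_support v)
    exact ⟨i, by omega, hi⟩
  have hf : ∀ i, i + 1 < 2 * n → G.Adj (f i) (f (i + 1)) := fun i hi =>
    p.adj_getVert_succ (by omega)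
  have hf0 : f 0 = .inl a := by simp [hfdef]
  have hfl : f (2 * n - 1) = .inr b := by rw [← hlen]; simp [hfdef]
  have hcount : ∀ (w : Fin n ⊕ Fin n) (S : Finset (Fin n ⊕ Fin n)), (∀ v ∈ S, G.Adj w v) →
      S.card ≤ ((Finset.range (2 * n)).filter fun k => G.Adj w (f k)).card := by
    intro w S hS
    refine le_trans (Finset.card_le_card fun v hv => ?_) (Finset.card_image_le (f := f))
    obtain ⟨i, hi, rfl⟩ := hsurj v
    exact Finset.mem_image_of_mem f (by simp [hi, hS _ hv])
  set K := (Finset.range (2 * n)).filter fun k => G.Adj (.inl a) (f k)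
  set M := (Finset.range (2 * n)).filter fun m => G.Adj (.inr b) (f m)
  have hKc : 2 * s ≤ K.card := by
    refine ha.trans ?_
    rw [← Finset.card_map Function.Embedding.inr]
    refine hcount _ _ fun v hv => ?_
    obtain ⟨b', hb', rfl⟩ := Finset.mem_map.1 hv
    exact bipGraph_adj_inl_inr.2 (by simpa using hb')
  have hMc : 2 * s ≤ M.card := by
    refine hb.trans ?_
    rw [← Finset.card_map Function.Embedding.inl]
    refine hcount _ _ fun v hv => ?_
    obtain ⟨b', hb', rfl⟩ := Finset.mem_map.1 hv
    exact bipGraph_adj_inr_inl.2 (by simpa using hb')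
  have hKp : ∀ k ∈ K, 1 ≤ k ∧ k + 1 < 2 * n ∧ G.Adj (f 0) (f k) ∧ ∃ b', f k = .inr b' := by
    intro k hk
    obtain ⟨hk1, hk2⟩ := Finset.mem_filter.1 hk
    rw [Finset.mem_range] at hk1
    refine ⟨?_, ?_, by rwa [hf0], exists_of_bipGraph_adj_inl hk2⟩
    · rcases Nat.eq_zero_or_pos k with rfl | h
      · rw [hf0] at hk2; exact absurd hk2 (G.irrefl)
      · exact h
    · by_contra h
      obtain rfl : k = 2 * n - 1 := by omega
      rw [hfl] at hk2
      exact hab (bipGraph_adj_inl_inr.1 hk2)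
  have hMp : ∀ m ∈ M, m + 1 < 2 * n ∧ G.Adj (f m) (f (2 * n - 1)) ∧ ∃ b', f (m + 1) = .inr b' := by
    intro m hm
    obtain ⟨hm1, hm2⟩ := Finset.mem_filter.1 hm
    rw [Finset.mem_range] at hm1
    have hlt : m + 1 < 2 * n := by
      by_contra h
      obtain rfl : m = 2 * n - 1 := by omega
      rw [hfl] at hm2
      exact absurd hm2 (G.irrefl)
    refine ⟨hlt, by rw [hfl]; exact hm2.symm, ?_⟩
    obtain ⟨a', ha'⟩ := exists_of_bipGraph_adj_inr hm2
    have := hf m hlt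
    rw [ha'] at this
    exact exists_of_bipGraph_adj_inl this
  have hMinj : ∀ M' ⊆ M, Set.InjOn (fun m => f (m + 1)) M' := by
    intro M' hM' i hi j hj h
    have := hinj _ _ (hMp i (hM' hi)).1 (hMp j (hM' hj)).1 h
    omega
  obtain ⟨t, ht₁, ht₂⟩ := exists_le_card_filter_le_and_ge K hKc
  have hMsplit := Finset.card_filter_add_card_filter_not (s := M) (p := (t ≤ ·))
  rcases le_or_gt s (M.filter (t ≤ ·)).card with hM1 | hM1
  · obtain ⟨k, hk, m, hm, hadj⟩ := exists_adj_of_injOn hE (g := fun k => f (k - 1)) ht₁ hM1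
      (by
        intro i hi j hj h
        have hi' := hKp i (Finset.filter_subset _ _ hi)
        have hj' := hKp j (Finset.filter_subset _ _ hj)
        have := hinj _ _ (by omega) (by omega) h
        omega)
      (hMinj _ (Finset.filter_subset _ _))
      (by
        intro k hk
        obtain ⟨h1, h2, -, b', h4⟩ := hKp k (Finset.filter_subset _ _ hk)
        have := hf (k - 1) (by omega)
        rw [Nat.sub_add_cancel h1, h4] at this
        exact exists_of_bipGraph_adj_inr this.symm)
      (fun m hm => (hMp m (Finset.filter_subset _ _ hm)).2.2)
    rw [Finset.mem_filter] at hk hm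
    obtain ⟨h1, h2, h3, -⟩ := hKp k hk.1
    obtain ⟨h4, h5, -⟩ := hMp m hm.1
    exact isHamiltonian_of_noncrossing hcard.symm (by omega) hsurj hf h1 (hk.2.trans hm.2)
      h4 h3 h5 hadj
  · obtain ⟨k, hk, m, hm, hadj⟩ := exists_adj_of_injOn hE (g := fun k => f (k + 1)) ht₂
      (show s ≤ (M.filter fun m => ¬ t ≤ m).card by omega)
      (by
        intro i hi j hj h
        have hi' := hKp i (Finset.filter_subset _ _ hi)
        have hj' := hKp j (Finset.filter_subset _ _ hj)
        have := hinj _ _ (by omega) (by omega) h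
        omega)
      (hMinj _ (Finset.filter_subset _ _))
      (by
        intro k hk
        obtain ⟨h1, h2, -, b', h4⟩ := hKp k (Finset.filter_subset _ _ hk)
        have := hf k (by omega)
        rw [h4] at this
        exact exists_of_bipGraph_adj_inr this)
      (fun m hm => (hMp m (Finset.filter_subset _ _ hm)).2.2)
    rw [Finset.mem_filter] at hk hm
    obtain ⟨h1, h2, h3, -⟩ := hKp k hk.1
    obtain ⟨h4, h5, -⟩ := hMp m hm.1
    exact isHamiltonian_of_crossing hcard.symm (by omega) hsurj hf (by omega)
      h2 h3 h5 hadj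

theorem bipGraph_univ_isHamiltonian {n : ℕ} (hn : 2 ≤ n) :
    (bipGraph n n Finset.univ).IsHamiltonian := by
  have : NeZero n := ⟨by omega⟩
  let f : ℕ → Fin n ⊕ Fin n := fun i =>
    if i % 2 = 0 then .inl (Fin.ofNat n (i / 2)) else .inr (Fin.ofNat n (i / 2))
  have hf : ∀ i j, (i + j) % 2 = 1 → (bipGraph n n Finset.univ).Adj (f i) (f j) := by
    intro i j h
    rcases Nat.mod_two_eq_zero_or_one i with hi | hi
    · have hj : j % 2 ≠ 0 := by omega
      simp [f, hi, hj, bipGraph_adj_inl_inr]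
    · have hj : j % 2 = 0 := by omega
      simp [f, hi, hj, bipGraph_adj_inr_inl]
  refine isHamiltonian_of_isChain ((List.range' 0 (2 * n)).map f) ?_ ?_ ?_
    (isChain_map_range' (fun i _ => hf i (i + 1) (by omega)) (zero_add _).le) ?_
  · simp; omega
  · rintro (a | b)
    · refine List.mem_map.2 ⟨2 * a, by simp, ?_⟩
      simp [f]
    · refine List.mem_map.2 ⟨2 * b + 1, by simp; omega, ?_⟩
      have : (2 * (b : ℕ) + 1) / 2 = b := by omega
      simp [f, this]
  · simp; omega
  · have e : n ≠ 0 := by omega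
    simp only [List.head?_map, List.getLast?_map, List.head?_range', List.getLast?_range']
    simp [e, hf _ _ (show (2 * n - 1 + 0) % 2 = 1 by omega)]

/-- A balanced bipartite graph with minimum degree at least `2 * s` in which any two sets of `s`
vertices on opposite sides span an edge is Hamiltonian. -/
theorem bipGraph_isHamiltonian_of_degree {n s : ℕ} (hn : 2 ≤ n) (E : Finset (Fin n × Fin n))
    (hE : ∀ A B : Finset (Fin n), s ≤ A.card → s ≤ B.card → ∃ a ∈ A, ∃ b ∈ B, (a, b) ∈ E)
    (hl : ∀ a, 2 * s ≤ (Finset.univ.filter fun b => (a, b) ∈ E).card)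
    (hr : ∀ b, 2 * s ≤ (Finset.univ.filter fun a => (a, b) ∈ E).card) :
    (bipGraph n n E).IsHamiltonian := by
  induction h : Eᶜ.card generalizing E with
  | zero =>
    rw [Finset.card_eq_zero, Finset.compl_eq_empty_iff] at h
    rw [h]
    exact bipGraph_univ_isHamiltonian hn
  | succ k ih =>
    obtain ⟨⟨a, b⟩, hab⟩ := Finset.card_pos.1 (show 0 < Eᶜ.card by omega)
    have hsub : E ⊆ insert (a, b) E := Finset.subset_insert _ _
    have hins := ih (insert (a, b) E)
      (fun A B hA hB => by
        obtain ⟨x, hx, y, hy, hxy⟩ := hE A B hA hB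
        exact ⟨x, hx, y, hy, hsub hxy⟩)
      (fun a => (hl a).trans (Finset.card_le_card (Finset.monotone_filter_right _ fun _ _ h => hsub h)))
      (fun b => (hr b).trans (Finset.card_le_card (Finset.monotone_filter_right _ fun _ _ h => hsub h)))
      (by rw [Finset.compl_insert, Finset.card_erase_of_mem hab]; omega)
    have : Nontrivial (Fin n ⊕ Fin n) := ⟨.inl a, .inr b, by simp⟩
    rcases isHamiltonian_or_exists_path (G := bipGraph n n E) (a := .inl a) (b := .inr b)
      (by
        rintro (u | u) (v | v) huv
        · simp [bipGraph] at huv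
        · rw [bipGraph_adj_inl_inr, Finset.mem_insert] at huv
          rw [bipGraph_adj_inl_inr]
          rcases huv with huv | huv
          · right; cases huv; rfl
          · exact .inl huv
        · rw [bipGraph_adj_inr_inl, Finset.mem_insert] at huv
          rw [bipGraph_adj_inr_inl]
          rcases huv with huv | huv
          · right; cases huv; exact Sym2.eq_swap
          · exact .inl huv
        · simp [bipGraph] at huv) hins with hG | ⟨p, hp⟩
    · exact hG
    · exact bipGraph_isHamiltonian_of_path hn hE (hl a) (hr b) (Finset.mem_compl.1 hab) hp

/-- The probability that the random edge set avoids a given set `S` of pairs. -/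
theorem card_powerset_compl_div {n : ℕ} (S : Finset (Fin n × Fin n)) :
    ((Sᶜ).powerset.card : ℝ) / 2 ^ (n * n) = (1 / 2) ^ S.card := by
  have hle : S.card ≤ n * n := by simpa using S.card_le_univ
  have hc : Sᶜ.card = n * n - S.card := by simp [Finset.card_compl]
  rw [Finset.card_powerset, hc, Nat.cast_pow, Nat.cast_ofNat, div_eq_iff (by positivity),
    one_div_pow, ← pow_sub_mul_pow (2 : ℝ) hle]
  field_simp

theorem bipNonHamProb_eq (n : ℕ) : bipNonHamProb n =
    ((Finset.univ.filter fun E : Finset (Fin n × Fin n) =>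
      ¬ (bipGraph n n E).IsHamiltonian).card : ℝ) / 2 ^ (n * n) := by
  rw [bipNonHamProb, Nat.card_eq_fintype_card, Fintype.card_subtype]

/-- A union bound over a family of rectangles one of which is empty in every non-Hamiltonian
graph. -/
theorem bipNonHamProb_le_sum {n : ℕ} {ι : Type*} (I : Finset ι)
    (S : ι → Finset (Fin n × Fin n))
    (h : ∀ E, ¬ (bipGraph n n E).IsHamiltonian → ∃ i ∈ I, E ⊆ (S i)ᶜ) :
    bipNonHamProb n ≤ ∑ i ∈ I, (1 / 2 : ℝ) ^ (S i).card := by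
  simp_rw [bipNonHamProb_eq, ← card_powerset_compl_div, ← Finset.sum_div]
  gcongr
  rw [← Nat.cast_sum, Nat.cast_le]
  refine le_trans (Finset.card_le_card fun E hE => ?_) Finset.card_biUnion_le
  obtain ⟨i, hi, hEi⟩ := h E (Finset.mem_filter.1 hE).2
  exact Finset.mem_biUnion.2 ⟨i, hi, Finset.mem_powerset.2 hEi⟩

/-- If fewer than `d` elements satisfy `p`, some set of `n - d` elements avoids `p`. -/
theorem exists_powersetCard_of_card_filter_lt {n d : ℕ} {p : Fin n → Prop} [DecidablePred p]
    (h : (Finset.univ.filter p).card < d) :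
    ∃ T ∈ Finset.powersetCard (n - d) Finset.univ, ∀ x ∈ T, ¬ p x := by
  have hsplit := Finset.card_filter_add_card_filter_not (s := (Finset.univ : Finset (Fin n))) (p := p)
  rw [Finset.card_univ, Fintype.card_fin] at hsplit
  obtain ⟨T, hT, hTc⟩ := Finset.exists_subset_card_eq
    (s := Finset.univ.filter fun x => ¬ p x) (n := n - d) (by omega)
  exact ⟨T, Finset.mem_powersetCard.2 ⟨Finset.subset_univ _, hTc⟩,
    fun x hx => (Finset.mem_filter.1 (hT hx)).2⟩

theorem bipNonHamProb_le {n s : ℕ} (hn : 2 ≤ n) (hs : 2 * s ≤ n) :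
    bipNonHamProb n ≤
      4 ^ n * (1 / 2) ^ (s * s) + 2 * (n * n ^ (2 * s) * (1 / 2) ^ (n - 2 * s)) := by
  let P := Finset.powersetCard (n - 2 * s) (Finset.univ : Finset (Fin n))
  let I₁ : Finset (Finset (Fin n) × Finset (Fin n)) :=
    Finset.univ.filter fun q => s ≤ q.1.card ∧ s ≤ q.2.card
  let I₂ : Finset (Fin n × Finset (Fin n)) := Finset.univ ×ˢ P
  have hP : (P.card : ℝ) ≤ n ^ (2 * s) := by
    rw [Finset.card_powersetCard, Finset.card_univ, Fintype.card_fin, Nat.choose_symm hs]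
    exact_mod_cast Nat.choose_le_pow n (2 * s)
  have hI₂ : ∀ q ∈ I₂, q.2.card = n - 2 * s := fun q hq =>
    (Finset.mem_powersetCard.1 (Finset.mem_product.1 hq).2).2
  have hI₂c : (I₂.card : ℝ) ≤ n * n ^ (2 * s) := by
    rw [Finset.card_product, Finset.card_univ, Fintype.card_fin, Nat.cast_mul]
    gcongr
  have hI₁c : (I₁.card : ℝ) ≤ 4 ^ n := by
    have := Finset.card_le_univ I₁
    rw [Fintype.card_prod, Fintype.card_finset, Fintype.card_fin, ← mul_pow] at this
    exact_mod_cast this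
  refine (bipNonHamProb_le_sum (I₁.disjSum (I₂.disjSum I₂))
    (Sum.elim (fun q => q.1 ×ˢ q.2)
      (Sum.elim (fun q => {q.1} ×ˢ q.2) (fun q => q.2 ×ˢ {q.1}))) ?_).trans ?_
  · intro E hE
    by_contra! hcon
    refine hE (bipGraph_isHamiltonian_of_degree hn (s := s) E ?_ ?_ ?_)
    · intro A B hA hB
      by_contra! hAB
      refine hcon (.inl (A, B)) (by simp [I₁, hA, hB]) fun e he => ?_
      rw [Finset.mem_compl, Sum.elim_inl, Finset.mem_product]
      exact fun h => hAB e.1 h.1 e.2 h.2 he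
    · intro a
      by_contra! hlt
      obtain ⟨T, hT, hTE⟩ := exists_powersetCard_of_card_filter_lt hlt
      refine hcon (.inr (.inl (a, T))) (by simpa [I₂, P] using hT) fun e he => ?_
      rw [Finset.mem_compl, Sum.elim_inr, Sum.elim_inl, Finset.mem_product, Finset.mem_singleton]
      rintro ⟨rfl, h⟩
      exact hTE _ h he
    · intro b
      by_contra! hlt
      obtain ⟨T, hT, hTE⟩ := exists_powersetCard_of_card_filter_lt hlt
      refine hcon (.inr (.inr (b, T))) (by simpa [I₂, P] using hT) fun e he => ?_
      rw [Finset.mem_compl, Sum.elim_inr, Sum.elim_inr, Finset.mem_product, Finset.mem_singleton]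
      rintro ⟨h, rfl⟩
      exact hTE _ h he
  · rw [Finset.sum_disjSum, Finset.sum_disjSum, two_mul]
    have h₁ : ∑ q ∈ I₁, (1 / 2 : ℝ) ^ (q.1 ×ˢ q.2).card ≤ 4 ^ n * (1 / 2) ^ (s * s) := by
      refine (Finset.sum_le_card_nsmul _ _ ((1 / 2 : ℝ) ^ (s * s)) fun q hq => ?_).trans ?_
      · rw [Finset.card_product]
        have := (Finset.mem_filter.1 hq).2
        exact pow_le_pow_of_le_one (by norm_num) (by norm_num) (Nat.mul_le_mul this.1 this.2)
      · rw [nsmul_eq_mul]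
        gcongr
    have h₂ : ∀ S : Fin n × Finset (Fin n) → Finset (Fin n × Fin n),
        (∀ q, (S q).card = q.2.card) →
        ∑ q ∈ I₂, (1 / 2 : ℝ) ^ (S q).card ≤ n * n ^ (2 * s) * (1 / 2) ^ (n - 2 * s) := by
      intro S hS
      rw [Finset.sum_congr rfl fun q hq => by rw [hS q, hI₂ q hq], Finset.sum_const, nsmul_eq_mul]
      gcongr
    exact add_le_add h₁ (add_le_add (h₂ _ fun q => by simp) (h₂ _ fun q => by simp))

theorem le_bipNonHamProb {n : ℕ} (hn : 1 ≤ n) : (1 / 2 : ℝ) ^ n ≤ bipNonHamProb n := by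
  let a : Fin n := ⟨0, hn⟩
  have hc : (({a} : Finset (Fin n)) ×ˢ (Finset.univ : Finset (Fin n))).card = n := by simp
  rw [bipNonHamProb_eq]
  nth_rw 1 [← hc]
  rw [← card_powerset_compl_div]
  gcongr
  intro E hE
  rw [Finset.mem_powerset] at hE
  rw [Finset.mem_filter_univ]
  intro hH
  have : Nontrivial (Fin n ⊕ Fin n) := ⟨.inl a, .inr a, by simp⟩
  obtain ⟨v, hv⟩ := hH.connected.preconnected.exists_adj_of_nontrivial (.inl a)
  obtain ⟨b, rfl⟩ := exists_of_bipGraph_adj_inl hv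
  simpa using hE (bipGraph_adj_inl_inr.1 hv)

theorem eventually_pow_sqrt_le {ε : ℝ} (hε : 0 < ε) :
    ∀ᶠ n : ℕ in atTop, (2 * n : ℝ) ^ (4 * n.sqrt + 6) ≤ 2 ^ (ε * n) := by
  have hlog : (0 : ℝ) < Real.log 2 := Real.log_pos one_lt_two
  have hc : 0 < ε * Real.log 2 / 20 := by positivity
  have h2n : Tendsto (fun n : ℕ => (2 * n : ℝ)) atTop atTop :=
    tendsto_natCast_atTop_atTop.const_mul_atTop two_pos
  filter_upwards [h2n.eventually ((isLittleO_log_rpow_atTop (half_pos one_pos)).bound hc),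
    eventually_ge_atTop 1] with n hn h1
  have h1' : (1 : ℝ) ≤ n := by exact_mod_cast h1
  rw [← Real.sqrt_eq_rpow, Real.norm_of_nonneg (Real.log_nonneg (by linarith)),
    Real.norm_of_nonneg (Real.sqrt_nonneg _)] at hn
  have hs1 : (1 : ℝ) ≤ √n := Real.one_le_sqrt.2 h1'
  have hs2 : √(2 * n : ℝ) ≤ 2 * √n := by
    rw [Real.sqrt_le_left (by positivity), mul_pow, Real.sq_sqrt (by positivity)]
    linarith
  have hs3 : (n.sqrt : ℝ) ≤ √n := Real.nat_sqrt_le_real_sqrt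
  rw [← Real.log_le_log_iff (by positivity) (by positivity), Real.log_pow,
    Real.log_rpow two_pos]
  push_cast
  calc (4 * (n.sqrt : ℝ) + 6) * Real.log (2 * n)
      ≤ (10 * √n) * (ε * Real.log 2 / 20 * (2 * √n)) := by
        refine mul_le_mul (by linarith) (hn.trans (by gcongr)) (Real.log_nonneg (by linarith))
          (by positivity)
    _ = ε * (√n * √n) * Real.log 2 := by ring
    _ = ε * n * Real.log 2 := by rw [Real.mul_self_sqrt (by positivity)]

/-- The random bipartite graph `G_{n,n,1/2}` is Hamiltonian with probability
`1 − 2^{−(1+o(1))n}`. -/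
theorem bip_random_hamiltonian :
    ∀ ε : ℝ, 0 < ε → ∃ n₀ : ℕ, ∀ n : ℕ, n₀ ≤ n →
      (2 : ℝ) ^ (-(1 + ε) * n) ≤ bipNonHamProb n ∧
        bipNonHamProb n ≤ (2 : ℝ) ^ (-(1 - ε) * n) := by
  intro ε hε
  obtain ⟨n₀, h₀⟩ := eventually_atTop.1 (eventually_pow_sqrt_le hε)
  have hhalf : ∀ k : ℕ, (1 / 2 : ℝ) ^ k = 2 ^ (-(k : ℝ)) := fun k => by
    rw [Real.rpow_neg two_pos.le, Real.rpow_natCast, one_div_pow, one_div]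
  refine ⟨max n₀ 64, fun n hn => ⟨?_, ?_⟩⟩
  · refine le_trans ?_ (le_bipNonHamProb (by omega))
    rw [hhalf]
    refine Real.rpow_le_rpow_of_exponent_le one_le_two ?_
    have : 0 ≤ ε * n := by positivity
    linarith
  · have hq := Nat.sqrt_le n
    have hq' := Nat.lt_succ_sqrt n
    have hpow := h₀ n (le_of_max_le_left hn)
    set r := n.sqrt
    have hr : 7 ≤ r := by
      by_contra! h
      have : r.succ * r.succ ≤ 7 * 7 := Nat.mul_le_mul (by omega) (by omega)
      omega
    have hs : 2 * (2 * (r + 1)) ≤ n := by nlinarith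
    have h1 : (1 : ℝ) ≤ n := by exact_mod_cast (by omega : 1 ≤ n)
    refine (bipNonHamProb_le (by omega) hs).trans ?_
    have hA : (4 : ℝ) ^ n * (1 / 2) ^ (2 * (r + 1) * (2 * (r + 1))) ≤ (1 / 2) ^ n := by
      calc (4 : ℝ) ^ n * (1 / 2) ^ (2 * (r + 1) * (2 * (r + 1)))
          ≤ 4 ^ n * (1 / 2) ^ (3 * n) := by
            gcongr ?_ * ?_
            refine pow_le_pow_of_le_one (by norm_num) (by norm_num) ?_
            simp only [Nat.succ_eq_add_one] at hq'
            nlinarith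
        _ = (1 / 2) ^ n := by rw [pow_mul, ← mul_pow]; norm_num
    have hB : (1 / 2 : ℝ) ^ (n - 2 * (2 * (r + 1))) = (1 / 2) ^ n * 2 ^ (2 * (2 * (r + 1))) := by
      nth_rw 2 [← Nat.sub_add_cancel hs]
      rw [pow_add, mul_assoc, ← mul_pow]
      norm_num
    have hX : (1 : ℝ) ≤ (2 * n) ^ (4 * r + 5) := one_le_pow₀ (by linarith)
    calc (4 : ℝ) ^ n * (1 / 2) ^ (2 * (r + 1) * (2 * (r + 1))) +
          2 * (n * n ^ (2 * (2 * (r + 1))) * (1 / 2) ^ (n - 2 * (2 * (r + 1))))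
        ≤ (1 / 2) ^ n + 2 * (n * n ^ (2 * (2 * (r + 1))) *
            ((1 / 2) ^ n * 2 ^ (2 * (2 * (r + 1))))) := by rw [hB]; gcongr
      _ = (1 / 2) ^ n * (1 + (2 * n) ^ (4 * r + 5)) := by
          rw [show 4 * r + 5 = 2 * (2 * (r + 1)) + 1 by ring, pow_succ, mul_pow]
          ring
      _ ≤ (1 / 2) ^ n * (2 * n) ^ (4 * r + 6) := by
          gcongr
          rw [pow_succ _ (4 * r + 5)]
          nlinarith
      _ ≤ (1 / 2) ^ n * 2 ^ (ε * n) := by gcongr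
      _ = 2 ^ (-(1 - ε) * n) := by
          rw [hhalf, ← Real.rpow_add two_pos]
          congr 1
          ring
end
end

section
/- Let G be a bipartite graph with bipartition (V₁, V₂), where |V₁| = |V₂| = n and n ≥ 2. If δ(G) ≥ 2·α̃(G) + 1, then G is Hamiltonian, i.e. G contains a cycle passing through all 2n vertices exactly once. -/
open scoped Classical

noncomputable section

/-- `α̃(G)` for a bipartite graph on `Fin n ⊕ Fin m`: the largest `k` such that there
exist `S₁ ⊆ V₁` and `S₂ ⊆ V₂` with `|S₁| = |S₂| = k` and no edges between `S₁` and `S₂`. -/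
def bipHole {n m : ℕ} (G : SimpleGraph (Fin n ⊕ Fin m)) : ℕ :=
  sSup {k : ℕ | ∃ S₁ : Finset (Fin n), ∃ S₂ : Finset (Fin m),
    S₁.card = k ∧ S₂.card = k ∧ ∀ a ∈ S₁, ∀ b ∈ S₂, ¬ G.Adj (Sum.inl a) (Sum.inr b)}

namespace SimpleGraph

section Lists

variable {V : Type*} [Fintype V] [DecidableEq V] {G : SimpleGraph V}

/-- A list of at least three vertices enumerating every vertex once, in which consecutive vertices
and the two ends are adjacent, is a Hamiltonian cycle. -/
theorem isHamiltonian_of_isChain {l : List V} (hnd : l.Nodup) (hmem : ∀ v, v ∈ l)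
    (hlen : 3 ≤ l.length) (hchain : l.IsChain G.Adj)
    (hclose : ∀ u ∈ l.getLast?, ∀ v ∈ l.head?, G.Adj u v) : G.IsHamiltonian := by
  intro _
  have hne : l ≠ [] := by rintro rfl; simp at hlen
  have hadj : G.Adj (l.getLast hne) (l.head hne) :=
    hclose _ (by simp [List.getLast?_eq_some_getLast hne]) _ (by simp [List.head?_eq_some_head hne])
  let q := Walk.ofSupport l hne hchain
  have hq : q.IsPath := by
    rw [Walk.isPath_def, Walk.support_ofSupport]
    exact hnd
  refine ⟨_, Walk.cons hadj q, ?_⟩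
  refine Walk.isHamiltonianCycle_isCycle_and_isHamiltonian_tail.2 ⟨?_, ?_⟩
  · rw [Walk.isCycle_iff_isPath_tail_and_le_length]
    refine ⟨by simpa using hq, ?_⟩
    simp only [Walk.length_cons, q, Walk.length_ofSupport]
    omega
  · have : q.IsHamiltonian := hq.isHamiltonian_of_mem fun w => by
      rw [Walk.support_ofSupport]
      exact hmem w
    intro v
    simpa using this v

theorem IsHamiltonian.exists_isChain [Nontrivial V] (hG : G.IsHamiltonian) (x : V) :
    ∃ l : List V, (x :: l).Nodup ∧ (∀ v, v ∈ x :: l) ∧ (x :: (l ++ [x])).IsChain G.Adj := by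
  obtain ⟨p, hp⟩ := hG.exists_isHamiltonianCycle x
  have hsupp : p.support = x :: p.tail.support := by
    rw [Walk.support_tail_of_not_nil _ hp.not_nil, Walk.cons_tail_support]
  have hlast : p.tail.support = p.tail.support.dropLast ++ [x] := by
    conv_lhs => rw [← List.dropLast_append_getLast p.tail.support_ne_nil]
    simp
  have hperm : (x :: p.tail.support.dropLast).Perm p.tail.support := by
    conv_rhs => rw [hlast]
    exact (List.perm_append_singleton _ _).symm
  refine ⟨p.tail.support.dropLast, ?_, fun v => ?_, ?_⟩
  · exact hperm.nodup_iff.2 hp.isHamiltonian_tail.isPath.support_nodup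
  · exact hperm.mem_iff.2 (hp.isHamiltonian_tail.mem_support v)
  · rw [← hlast, ← hsupp]
    exact p.isChain_adj_support

omit [Fintype V] [DecidableEq V] in
theorem isChain_adj_reverse {l : List V} : l.reverse.IsChain G.Adj ↔ l.IsChain G.Adj := by
  simp [List.isChain_reverse, G.adj_comm]

/-- If adding the edge `xy` makes a graph Hamiltonian, then the graph is already Hamiltonian or has
a Hamiltonian path from `x` to `y`. -/
theorem isHamiltonian_or_exists_path_of_sup_edge {x y : V} (hV : 3 ≤ Fintype.card V)
    (hxy : x ≠ y) (h : (G ⊔ edge x y).IsHamiltonian) :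
    G.IsHamiltonian ∨ ∃ l : List V, l.Nodup ∧ (∀ v, v ∈ l) ∧ l.IsChain G.Adj ∧
      l.head? = some x ∧ l.getLast? = some y := by
  have : Nontrivial V := ⟨x, y, hxy⟩
  obtain ⟨l, hnd, hmem, hchain⟩ := h.exists_isChain x
  have hlen : (x :: l).length = Fintype.card V := by
    rw [← List.toFinset_card_of_nodup hnd, ← Finset.card_univ]
    congr 1
    ext v
    simpa using hmem v
  have hadj : ∀ u v, (G ⊔ edge x y).Adj u v → u ≠ x → v ≠ x → G.Adj u v := by
    intro u v huv hu hv
    simp only [sup_adj, edge_adj] at huv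
    tauto
  have hadj' : ∀ v, (G ⊔ edge x y).Adj x v → v ≠ y → G.Adj x v := by
    intro v huv hv
    simp only [sup_adj, edge_adj] at huv
    tauto
  have hxl : x ∉ l := (List.nodup_cons.1 hnd).1
  have hl : l.IsChain G.Adj := by
    have h1 : l.IsChain (G ⊔ edge x y).Adj := by
      rw [← List.cons_append] at hchain
      exact (List.isChain_append.1 hchain).1.tail
    refine h1.imp_of_mem_imp ?_
    intro a b ha hb hab
    exact hadj _ _ hab (fun h => hxl (h ▸ ha)) (fun h => hxl (h ▸ hb))
  have hhead : ∀ v ∈ l.head?, (G ⊔ edge x y).Adj x v := by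
    intro v hv
    cases l with
    | nil => simp at hv
    | cons a l => simp at hv hchain; exact hv ▸ hchain.1
  have hlast : ∀ v ∈ l.getLast?, (G ⊔ edge x y).Adj v x := by
    intro v hv
    rw [← List.cons_append] at hchain
    refine (List.isChain_append.1 hchain).2.2 v ?_ x (by simp)
    rw [Option.mem_def] at hv ⊢
    simp [List.getLast?_cons, hv]
  by_cases hy : l.head? = some y
  · right
    refine ⟨x :: l.reverse, by simpa using hnd, by simpa using hmem, ?_, by simp, ?_⟩
    · rw [List.isChain_cons]
      refine ⟨fun v hv => hadj' v (hlast v (by simpa using hv)).symm ?_, isChain_adj_reverse.2 hl⟩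
      rintro rfl
      cases l with
      | nil => simp at hy
      | cons a l =>
        cases l with
        | nil => simp at hlen; omega
        | cons b l =>
          simp at hy
          subst hy
          rw [List.head?_reverse, Option.mem_def, List.getLast?_cons_cons] at hv
          have := List.mem_of_getLast? hv
          simp at hnd
          simp at this
          tauto
    · simp [List.getLast?_cons, hy]
  · have hc : (x :: l).IsChain G.Adj := by
      rw [List.isChain_cons]
      refine ⟨fun v hv => hadj' v (hhead v hv) ?_, hl⟩
      rintro rfl
      exact hy hv
    by_cases hy' : l.getLast? = some y
    · right
      exact ⟨x :: l, hnd, hmem, hc, by simp, by simp [List.getLast?_cons, hy']⟩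
    · left
      refine isHamiltonian_of_isChain hnd hmem (by omega) hc ?_
      intro u hu v hv
      obtain rfl : x = v := by simpa using hv
      have hu' : u ∈ l.getLast? := by
        cases l with
        | nil => simp at hlen; omega
        | cons a l => simpa [List.getLast?_cons_cons] using hu
      refine (hadj' u (hlast u hu').symm ?_).symm
      rintro rfl
      exact (hy' hu').elim

/-- Reversing the outer segments of a Hamiltonian path split into three. -/
theorem isHamiltonian_of_segments {A B C : List V} {x a b b' c y : V}
    (hnd : (A ++ B ++ C).Nodup) (hmem : ∀ v, v ∈ A ++ B ++ C) (hlen : 3 ≤ (A ++ B ++ C).length)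
    (hA : A.IsChain G.Adj) (hB : B.IsChain G.Adj) (hC : C.IsChain G.Adj)
    (hx : A.head? = some x) (ha : A.getLast? = some a) (hb : B.head? = some b)
    (hb' : B.getLast? = some b') (hc : C.head? = some c) (hy : C.getLast? = some y)
    (hxb : G.Adj x b) (hby : G.Adj b' y) (hca : G.Adj c a) : G.IsHamiltonian := by
  have hperm : (A.reverse ++ B ++ C.reverse).Perm (A ++ B ++ C) :=
    ((List.reverse_perm A).append_right B).append (List.reverse_perm C)
  refine isHamiltonian_of_isChain (hperm.nodup_iff.2 hnd) (fun v => hperm.mem_iff.2 (hmem v))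
    (hperm.length_eq ▸ hlen) ?_ ?_
  · simp only [List.isChain_append, isChain_adj_reverse, List.getLast?_append, List.getLast?_reverse,
      List.head?_reverse, hx, hb, hb', hy, hA, hB, hC]
    simp [hxb, hby]
  · simp [ha, hc, hca]

theorem isHamiltonian_of_two_segments {A C : List V} {x a c y : V}
    (hnd : (A ++ C).Nodup) (hmem : ∀ v, v ∈ A ++ C) (hlen : 3 ≤ (A ++ C).length)
    (hA : A.IsChain G.Adj) (hC : C.IsChain G.Adj)
    (hx : A.head? = some x) (ha : A.getLast? = some a) (hc : C.head? = some c)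
    (hy : C.getLast? = some y) (hxc : G.Adj x c) (hya : G.Adj y a) : G.IsHamiltonian := by
  have hperm : (A ++ C.reverse).Perm (A ++ C) := (List.reverse_perm C).append_left A
  refine isHamiltonian_of_isChain (hperm.nodup_iff.2 hnd) (fun v => hperm.mem_iff.2 (hmem v))
    (hperm.length_eq ▸ hlen) ?_ ?_
  · simp [List.isChain_append, isChain_adj_reverse, hA, hC, ha, hy, hya.symm]
  · simp [hc, hx, hxc.symm]

/-- Two crossing patterns of chords that turn a Hamiltonian path into a Hamiltonian cycle. -/
theorem isHamiltonian_of_crossing {l : List V} {p : ℕ → V} {x y : V} {s t : ℕ}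
    (hnd : l.Nodup) (hmem : ∀ v, v ∈ l) (hchain : l.IsChain G.Adj)
    (hx : l.head? = some x) (hy : l.getLast? = some y) (hp : ∀ i < l.length, l[i]? = some (p i))
    (hs : 0 < s) (hst : s < t) (ht : t < l.length)
    (h : G.Adj x (p s) ∧ G.Adj y (p (t - 1)) ∨ G.Adj x (p (t - 1)) ∧ G.Adj y (p s))
    (hclose : G.Adj (p t) (p (s - 1))) : G.IsHamiltonian := by
  have hAB : l.take s ++ (l.take t).drop s = l.take t := by
    conv_rhs => rw [← List.take_append_drop s (l.take t), List.take_take, min_eq_left hst.le]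
  have hl : l.take s ++ (l.take t).drop s ++ l.drop t = l := by
    rw [hAB, List.take_append_drop]
  have hB : ((l.take t).drop s).IsChain G.Adj := (hchain.take t).drop s
  have hxA : (l.take s).head? = some x := by simp [List.head?_take, hs.ne', hx]
  have haA : (l.take s).getLast? = some (p (s - 1)) := by
    simp [List.getLast?_take, hs.ne', hp (s - 1) (by omega)]
  have hbB : ((l.take t).drop s).head? = some (p s) := by
    simp [hst, hp s (by omega)]
  have hbB' : ((l.take t).drop s).getLast? = some (p (t - 1)) := by
    rw [List.getLast?_drop, List.getLast?_take, hp (t - 1) (by omega)]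
    simp; omega
  have hcC : (l.drop t).head? = some (p t) := by simp [hp t ht]
  have hyC : (l.drop t).getLast? = some y := by simp [List.getLast?_drop, hy, ht]
  have hlen : 3 ≤ l.length := by omega
  rcases h with ⟨h1, h2⟩ | ⟨h1, h2⟩
  · exact isHamiltonian_of_segments (by rwa [hl]) (by rwa [hl]) (by rwa [hl]) (hchain.take s) hB
      (hchain.drop t) hxA haA hbB hbB' hcC hyC h1 h2.symm hclose
  · have hperm : (l.take s ++ ((l.take t).drop s).reverse ++ l.drop t).Perm l := by
      conv_rhs => rw [← hl]
      exact ((List.reverse_perm _).append_left _).append_right _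
    exact isHamiltonian_of_segments (hperm.nodup_iff.2 hnd) (fun v => hperm.mem_iff.2 (hmem v))
      (hperm.length_eq ▸ hlen) (hchain.take s) (isChain_adj_reverse.2 hB) (hchain.drop t) hxA haA
      (by rw [List.head?_reverse, hbB']) (by rw [List.getLast?_reverse, hbB]) hcC hyC h1 h2.symm
      hclose

theorem isHamiltonian_of_ends_adj {l : List V} {p : ℕ → V} {x y : V} {s : ℕ}
    (hnd : l.Nodup) (hmem : ∀ v, v ∈ l) (hlen : 3 ≤ l.length) (hchain : l.IsChain G.Adj)
    (hx : l.head? = some x) (hy : l.getLast? = some y) (hp : ∀ i < l.length, l[i]? = some (p i))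
    (hs : s + 1 < l.length) (hxs : G.Adj x (p (s + 1))) (hys : G.Adj y (p s)) :
    G.IsHamiltonian := by
  have hl := List.take_append_drop (s + 1) l
  refine isHamiltonian_of_two_segments (A := l.take (s + 1)) (C := l.drop (s + 1))
    (by rwa [hl]) (by rwa [hl]) (by rwa [hl]) (hchain.take _) (hchain.drop _)
    (a := p s) (c := p (s + 1)) ?_ ?_ ?_ ?_ hxs hys
  · simp [List.head?_take, hx]
  · simp [List.getLast?_take, hp s (by omega)]
  · simp [hp _ hs]
  · simp [List.getLast?_drop, hy, hs]

end Lists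

end SimpleGraph


theorem Finset.exists_median {I : Finset ℕ} {k : ℕ} (h : 2 * k + 1 ≤ I.card) :
    ∃ m ∈ I, k + 1 ≤ (I.filter (· ≤ m)).card ∧ k + 1 ≤ (I.filter (m ≤ ·)).card := by
  have hex : ∃ m, k + 1 ≤ (I.filter (· ≤ m)).card := by
    refine ⟨I.sup id, ?_⟩
    have heq : I.filter (· ≤ I.sup id) = I :=
      Finset.filter_true_of_mem fun i hi => Finset.le_sup (f := id) hi
    rw [heq]
    omega
  obtain ⟨m, hm, hmin⟩ := Nat.findX hex
  have hlt : (I.filter (· < m)).card ≤ k := by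
    rcases Nat.eq_zero_or_pos m with rfl | hpos
    · simp
    · have := hmin (m - 1) (by omega)
      have heq : I.filter (· < m) = I.filter (· ≤ m - 1) :=
        Finset.filter_congr fun i _ => by omega
      rw [heq]; omega
  refine ⟨m, ?_, hm, ?_⟩
  · by_contra hmI
    have heq : I.filter (· ≤ m) = I.filter (· < m) := by
      refine Finset.filter_congr fun i hi => ⟨fun h => lt_of_le_of_ne h ?_, le_of_lt⟩
      rintro rfl
      exact hmI hi
    rw [heq] at hm
    omega
  · have := Finset.card_filter_add_card_filter_not (s := I) (· < m)
    simp only [not_lt] at this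
    omega

/-- Two disjoint sets of positions of size at least `2k + 1` contain subsets of size at least
`k + 1`, one of which lies entirely before the other. -/
theorem Finset.exists_separated {I J : Finset ℕ} {k : ℕ} (hIJ : Disjoint I J)
    (hI : 2 * k + 1 ≤ I.card) (hJ : 2 * k + 1 ≤ J.card) :
    ∃ I' ⊆ I, ∃ J' ⊆ J, k + 1 ≤ I'.card ∧ k + 1 ≤ J'.card ∧
      ((∀ i ∈ I', ∀ j ∈ J', i < j) ∨ ∀ i ∈ I', ∀ j ∈ J', j < i) := by
  obtain ⟨a, haI, ha, ha'⟩ := Finset.exists_median hI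
  obtain ⟨b, hbJ, hb, hb'⟩ := Finset.exists_median hJ
  have hab : a ≠ b := by
    rintro rfl
    exact Finset.disjoint_left.1 hIJ haI hbJ
  rcases lt_or_gt_of_ne hab with h | h
  · refine ⟨_, Finset.filter_subset _ _, _, Finset.filter_subset _ _, ha, hb',
      Or.inl fun i hi j hj => ?_⟩
    simp only [Finset.mem_filter] at hi hj
    omega
  · refine ⟨_, Finset.filter_subset _ _, _, Finset.filter_subset _ _, ha', hb,
      Or.inr fun i hi j hj => ?_⟩
    simp only [Finset.mem_filter] at hi hj
    omega

namespace SimpleGraph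

section Bipartite

variable {α : Type*} [Fintype α] [DecidableEq α]

theorem isHamiltonian_of_forall_adj {G : SimpleGraph (α ⊕ α)} (hα : 2 ≤ Fintype.card α)
    (h : ∀ a b : α, G.Adj (Sum.inl a) (Sum.inr b)) : G.IsHamiltonian := by
  have key : ∀ L : List α, L.Nodup →
      let l : List (α ⊕ α) := L.flatMap fun i => [Sum.inl i, Sum.inr i]
      l.Nodup ∧ l.length = 2 * L.length ∧ l.IsChain G.Adj ∧ (∀ u ∈ l.head?, u.isLeft) ∧
        ∀ u ∈ l.getLast?, u.isRight := by
    intro L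
    induction L with
    | nil => simp
    | cons a L ih =>
      intro hL
      obtain ⟨h1, h2, h3, h4, h5⟩ := ih (List.nodup_cons.1 hL).2
      have ha := (List.nodup_cons.1 hL).1
      set l : List (α ⊕ α) := L.flatMap fun i => [Sum.inl i, Sum.inr i] with hl
      simp only [List.flatMap_cons, ← hl]
      refine ⟨?_, ?_, ?_, by simp, ?_⟩
      · simp [h1, ha, show ∀ v, v ∈ l ↔ ∃ i ∈ L, v = Sum.inl i ∨ v = Sum.inr i by simp [hl]]
      · simp [h2]; ring
      · rw [List.cons_append, List.cons_append, List.nil_append, List.isChain_cons_cons,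
          List.isChain_cons]
        refine ⟨h a a, fun v hv => ?_, h3⟩
        obtain ⟨b, rfl⟩ := Sum.isLeft_iff.1 (h4 v hv)
        exact (h b a).symm
      · intro u hu
        rw [Option.mem_def, List.getLast?_append] at hu
        cases hlast : l.getLast? with
        | none => simp [hlast] at hu; simp [← hu]
        | some w => simp [hlast] at hu; exact h5 u (by simp [hlast, hu])
  obtain ⟨h1, h2, h3, h4, h5⟩ := key Finset.univ.toList (Finset.nodup_toList _)
  refine isHamiltonian_of_isChain h1 ?_ ?_ h3 ?_
  · rintro (a | a) <;> simp
  · rw [h2, Finset.length_toList, Finset.card_univ]; omega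
  · intro u hu v hv
    obtain ⟨a, rfl⟩ := Sum.isRight_iff.1 (h5 u hu)
    obtain ⟨b, rfl⟩ := Sum.isLeft_iff.1 (h4 v hv)
    exact (h b a).symm

theorem isHamiltonian_of_path {G : SimpleGraph (α ⊕ α)} {k : ℕ} (hα : 2 ≤ Fintype.card α)
    (hbip₁ : ∀ a b : α, ¬ G.Adj (Sum.inl a) (Sum.inl b))
    (hbip₂ : ∀ a b : α, ¬ G.Adj (Sum.inr a) (Sum.inr b))
    (hdeg : ∀ v, 2 * k + 1 ≤ (Finset.univ.filter (G.Adj v)).card)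
    (hhole : ∀ S T : Finset (α ⊕ α), k + 1 ≤ S.card → k + 1 ≤ T.card → (∀ s ∈ S, s.isLeft) →
      (∀ t ∈ T, t.isRight) → ∃ s ∈ S, ∃ t ∈ T, G.Adj s t)
    {a b : α} (hab : ¬ G.Adj (Sum.inl a) (Sum.inr b)) {l : List (α ⊕ α)} (hnd : l.Nodup)
    (hmem : ∀ v, v ∈ l) (hchain : l.IsChain G.Adj) (hx : l.head? = some (Sum.inl a))
    (hy : l.getLast? = some (Sum.inr b)) : G.IsHamiltonian := by
  have hlen : l.length = 2 * Fintype.card α := by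
    rw [← List.toFinset_card_of_nodup hnd, two_mul, ← Fintype.card_sum, ← Finset.card_univ]
    congr 1
    ext v
    simpa using hmem v
  have hr : ∀ {c v}, G.Adj (Sum.inl c) v → v.isRight := by
    rintro c (d | d) h
    · exact absurd h (hbip₁ _ _)
    · rfl
  have hle : ∀ {c v}, G.Adj (Sum.inr c) v → v.isLeft := by
    rintro c (d | d) h
    · rfl
    · exact absurd h (hbip₂ _ _)
  set p : ℕ → α ⊕ α := fun i => l.getD i (Sum.inl a) with hpdef
  have hp : ∀ i < l.length, l[i]? = some (p i) := by
    intro i hi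
    simp [hpdef, hi]
  have hsurj : ∀ v, ∃ i < l.length, p i = v := by
    intro v
    obtain ⟨i, hi, rfl⟩ := List.mem_iff_getElem.1 (hmem v)
    exact ⟨i, hi, by simp [hpdef, hi]⟩
  have hinj : ∀ {i j}, i < l.length → j < l.length → p i = p j → i = j := by
    intro i j hi hj hij
    simp only [hpdef, List.getD_eq_getElem _ _ hi, List.getD_eq_getElem _ _ hj] at hij
    exact (hnd.getElem_inj_iff).1 hij
  have hstep : ∀ {i}, i + 1 < l.length → G.Adj (p i) (p (i + 1)) := by
    intro i hi
    have := List.isChain_iff_getElem.1 hchain i (by omega)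
    simpa only [hpdef, List.getD_eq_getElem _ _ hi, List.getD_eq_getElem _ _ (Nat.lt_of_succ_lt hi)]
  have hp0 : p 0 = Sum.inl a := by
    have := hp 0 (by omega)
    rw [← List.head?_eq_getElem?, hx] at this
    exact (Option.some_injective _ this).symm
  have hpl : p (l.length - 1) = Sum.inr b := by
    have := hp (l.length - 1) (by omega)
    rw [← List.getLast?_eq_getElem?, hy] at this
    exact (Option.some_injective _ this).symm
  by_contra hham
  let I := (Finset.range l.length).filter fun i => i + 1 < l.length ∧ G.Adj (Sum.inl a) (p (i + 1))
  let J := (Finset.range l.length).filter fun i => G.Adj (Sum.inr b) (p i)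
  have hI : 2 * k + 1 ≤ I.card := by
    refine (hdeg (Sum.inl a)).trans ((Finset.card_le_card (t := I.image fun i => p (i + 1)) ?_).trans
      Finset.card_image_le)
    intro v hv
    obtain ⟨i, hi, rfl⟩ := hsurj v
    simp only [Finset.mem_filter, Finset.mem_univ, true_and] at hv
    rcases i with _ | i
    · rw [hp0] at hv
      exact absurd hv (hbip₁ _ _)
    · refine Finset.mem_image.2 ⟨i, ?_, rfl⟩
      simp only [I, Finset.mem_filter, Finset.mem_range]
      exact ⟨by omega, hi, hv⟩
  have hJ : 2 * k + 1 ≤ J.card := by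
    refine (hdeg (Sum.inr b)).trans ((Finset.card_le_card (t := J.image p) ?_).trans
      Finset.card_image_le)
    intro v hv
    obtain ⟨i, hi, rfl⟩ := hsurj v
    simp only [Finset.mem_filter, Finset.mem_univ, true_and] at hv
    exact Finset.mem_image.2 ⟨i, by simp [J, hi, hv], rfl⟩
  have hImem : ∀ {i}, i ∈ I → i + 2 < l.length ∧ G.Adj (Sum.inl a) (p (i + 1)) := by
    intro i hi
    simp only [I, Finset.mem_filter, Finset.mem_range] at hi
    refine ⟨?_, hi.2.2⟩
    by_contra hcon
    have : i + 1 = l.length - 1 := by omega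
    rw [this, hpl] at hi
    exact hab hi.2.2
  have hJmem : ∀ {i}, i ∈ J → 0 < i ∧ i + 1 < l.length ∧ G.Adj (Sum.inr b) (p i) := by
    intro i hi
    simp only [J, Finset.mem_filter, Finset.mem_range] at hi
    refine ⟨Nat.pos_of_ne_zero ?_, ?_, hi.2⟩
    · rintro rfl
      rw [hp0] at hi
      exact hab hi.2.symm
    · by_contra hcon
      have : i = l.length - 1 := by omega
      rw [this, hpl] at hi
      exact hbip₂ _ _ hi.2
  have hIl : ∀ {i}, i ∈ I → (p i).isLeft ∧ (p (i + 2)).isLeft := by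
    intro i hi
    obtain ⟨h1, h2⟩ := hImem hi
    obtain ⟨c, hc⟩ := Sum.isRight_iff.1 (hr h2)
    have h3 := hstep (i := i) (by omega)
    have h4 := hstep (i := i + 1) h1
    rw [hc] at h3 h4
    exact ⟨hle h3.symm, hle h4⟩
  have hJr : ∀ {j}, j ∈ J → (p (j + 1)).isRight ∧ (p (j - 1)).isRight := by
    intro j hj
    obtain ⟨h0, h1, h2⟩ := hJmem hj
    obtain ⟨c, hc⟩ := Sum.isLeft_iff.1 (hle h2)
    have h3 := hstep h1
    have h4 := hstep (i := j - 1) (by omega)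
    rw [Nat.sub_add_cancel h0] at h4
    rw [hc] at h3 h4
    exact ⟨hr h3, hr h4.symm⟩
  have hdisj : Disjoint I J := by
    refine Finset.disjoint_left.2 fun i hi hj => hham ?_
    exact isHamiltonian_of_ends_adj hnd hmem (by omega) hchain hx hy hp (hJmem hj).2.1
      (hImem hi).2 (hJmem hj).2.2
  obtain ⟨I', hI', J', hJ', hIc, hJc, hsep⟩ := Finset.exists_separated hdisj hI hJ
  have hole : ∀ f g : ℕ → ℕ, (∀ i ∈ I', (p (f i)).isLeft ∧ f i < l.length) →
      (∀ j ∈ J', (p (g j)).isRight ∧ g j < l.length) → Set.InjOn f I' → Set.InjOn g J' →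
      ∃ i ∈ I', ∃ j ∈ J', G.Adj (p (f i)) (p (g j)) := by
    intro f g hf hg hfi hgi
    obtain ⟨s, hs, t, ht, hst⟩ := hhole (I'.image fun i => p (f i)) (J'.image fun j => p (g j))
      (by
        rwa [Finset.card_image_of_injOn]
        exact fun i hi j hj hij => hfi hi hj (hinj (hf i hi).2 (hf j hj).2 hij))
      (by
        rwa [Finset.card_image_of_injOn]
        exact fun i hi j hj hij => hgi hi hj (hinj (hg i hi).2 (hg j hj).2 hij))
      (by simpa using fun i hi => (hf i hi).1) (by simpa using fun j hj => (hg j hj).1)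
    obtain ⟨i, hi, rfl⟩ := Finset.mem_image.1 hs
    obtain ⟨j, hj, rfl⟩ := Finset.mem_image.1 ht
    exact ⟨i, hi, j, hj, hst⟩
  rcases hsep with hsep | hsep
  · obtain ⟨i, hi, j, hj, hij⟩ := hole id (· + 1)
      (fun i hi => ⟨(hIl (hI' hi)).1, by have := (hImem (hI' hi)).1; simp; omega⟩)
      (fun j hj => ⟨(hJr (hJ' hj)).1, (hJmem (hJ' hj)).2.1⟩)
      (Set.injOn_id _) (add_left_injective 1).injOn
    have := hsep i hi j hj
    exact hham (isHamiltonian_of_crossing (s := i + 1) (t := j + 1) hnd hmem hchain hx hy hp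
      (by omega) (by omega) (hJmem (hJ' hj)).2.1
      (Or.inl ⟨(hImem (hI' hi)).2, (hJmem (hJ' hj)).2.2⟩) hij.symm)
  · obtain ⟨i, hi, j, hj, hij⟩ := hole (· + 2) (· - 1)
      (fun i hi => ⟨(hIl (hI' hi)).2, (hImem (hI' hi)).1⟩)
      (fun j hj => ⟨(hJr (hJ' hj)).2, by have := (hJmem (hJ' hj)).2.1; simp; omega⟩)
      (add_left_injective 2).injOn
      (fun i hi j hj hij => by
        have h1 := (hJmem (hJ' hi)).1
        have h2 := (hJmem (hJ' hj)).1
        simp only at hij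
        omega)
    have := hsep i hi j hj
    exact hham (isHamiltonian_of_crossing (s := j) (t := i + 2) hnd hmem hchain hx hy hp
      (hJmem (hJ' hj)).1 (by omega) (hImem (hI' hi)).1
      (Or.inr ⟨(hImem (hI' hi)).2, (hJmem (hJ' hj)).2.2⟩) hij)

end Bipartite

end SimpleGraph

theorem exists_adj_of_bipHole_lt {n m : ℕ} {G : SimpleGraph (Fin n ⊕ Fin m)}
    {S : Finset (Fin n)} {T : Finset (Fin m)} (hS : bipHole G < S.card)
    (hT : bipHole G < T.card) : ∃ a ∈ S, ∃ b ∈ T, G.Adj (Sum.inl a) (Sum.inr b) := by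
  by_contra! hcon
  obtain ⟨S', hS', hSc⟩ := Finset.exists_subset_card_eq (Nat.succ_le_of_lt hS)
  obtain ⟨T', hT', hTc⟩ := Finset.exists_subset_card_eq (Nat.succ_le_of_lt hT)
  have hle : (bipHole G).succ ≤ bipHole G := by
    refine le_csSup ⟨n, ?_⟩ ⟨S', T', hSc, hTc, fun a ha b hb => hcon a (hS' ha) b (hT' hb)⟩
    rintro k ⟨A, _, rfl, -, -⟩
    simpa using A.card_le_univ
  omega

/-- An `n × n` bipartite graph with `n ≥ 2` satisfying `δ(G) ≥ 2α̃(G) + 1` is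
Hamiltonian. -/
theorem bip_minDegree_hamiltonian {n : ℕ} (hn : 2 ≤ n) (G : SimpleGraph (Fin n ⊕ Fin n))
    (hbip₁ : ∀ a b : Fin n, ¬ G.Adj (Sum.inl a) (Sum.inl b))
    (hbip₂ : ∀ a b : Fin n, ¬ G.Adj (Sum.inr a) (Sum.inr b))
    (hδ : 2 * bipHole G + 1 ≤ G.minDegree) :
    G.IsHamiltonian := by
  by_contra hG
  obtain ⟨H, hGH, hH⟩ := Finite.exists_le_maximal
    (p := fun H : SimpleGraph (Fin n ⊕ Fin n) =>
      (∀ a b, ¬ H.Adj (Sum.inl a) (Sum.inl b)) ∧ (∀ a b, ¬ H.Adj (Sum.inr a) (Sum.inr b)) ∧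
        ¬ H.IsHamiltonian) ⟨hbip₁, hbip₂, hG⟩
  obtain ⟨hH₁, hH₂, hHam⟩ := hH.prop
  have hcard : 2 ≤ Fintype.card (Fin n) := by simpa using hn
  obtain ⟨a, b, hab⟩ : ∃ a b, ¬ H.Adj (Sum.inl a) (Sum.inr b) := by
    by_contra! hcon
    exact hHam (SimpleGraph.isHamiltonian_of_forall_adj hcard hcon)
  have hsup : (H ⊔ SimpleGraph.edge (Sum.inl a) (Sum.inr b)).IsHamiltonian := by
    by_contra hcon
    refine hab (hH.le_of_ge ⟨fun c d => ?_, fun c d => ?_, hcon⟩ le_sup_left ?_)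
    · simp [SimpleGraph.edge_adj, hH₁]
    · simp [SimpleGraph.edge_adj, hH₂]
    · simp [SimpleGraph.edge_adj]
  rcases SimpleGraph.isHamiltonian_or_exists_path_of_sup_edge
    (by simp; omega) Sum.inl_ne_inr hsup with h | ⟨l, hnd, hmem, hchain, hx, hy⟩
  · exact hHam h
  refine hHam (SimpleGraph.isHamiltonian_of_path hcard hH₁ hH₂ (k := bipHole G) ?_ ?_ hab hnd hmem
    hchain hx hy)
  · intro v
    refine (hδ.trans (G.minDegree_le_degree v)).trans ?_
    rw [← SimpleGraph.card_neighborFinset_eq_degree]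
    refine Finset.card_le_card fun w hw => ?_
    simpa using hGH ((G.mem_neighborFinset v w).1 hw)
  · intro S T hS hT hSl hTr
    have hS' : S.toLeft.card = S.card := by
      have : S.toRight = ∅ := Finset.eq_empty_of_forall_notMem fun c hc => by
        simpa using hSl _ (Finset.mem_toRight.1 hc)
      have h2 := S.card_toLeft_add_card_toRight
      rw [this] at h2
      simpa using h2
    have hT' : T.toRight.card = T.card := by
      have : T.toLeft = ∅ := Finset.eq_empty_of_forall_notMem fun c hc => by
        simpa using hTr _ (Finset.mem_toLeft.1 hc)
      have h2 := T.card_toLeft_add_card_toRight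
      rw [this] at h2
      simpa using h2
    obtain ⟨c, hc, d, hd, hcd⟩ := exists_adj_of_bipHole_lt (G := G) (S := S.toLeft) (T := T.toRight)
      (by omega) (by omega)
    exact ⟨_, Finset.mem_toLeft.1 hc, _, Finset.mem_toRight.1 hd, hGH hcd⟩
end
end

section
/- For a graph G on vertex set {1,…,n}, let R₊(G) denote the number of sets C ⊆ {1,…,n} such that (G, C) is a unipolar arrangement. Then for every integer j ≥ 1 and every ε > 0 there exists n₀ such that for all n ≥ n₀: Σ_G R₊(G)^j ≤ (Σ_G R₊(G)) · (1 + 2^{−(1/2 − ε)n}), where both sums are over all graphs G on vertex set {1,…,n}. -/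
open scoped Classical

noncomputable section

/-- `R₊(G)`: the number of sets `C ⊆ {1,…,n}` such that `(G, C)` is a unipolar
arrangement. -/
def Rplus {n : ℕ} (G : SimpleGraph (Fin n)) : ℕ :=
  Nat.card {C : Set (Fin n) // IsUnipolarArrangement G C}

open Finset

variable {n : ℕ}

/-- A form of `IsUnipolarArrangement` without connectivity: `C` is a clique and adjacency is
transitive outside `C`. -/
def CliqueSplit (G : SimpleGraph (Fin n)) (C : Finset (Fin n)) : Prop :=
  (∀ u ∈ C, ∀ v ∈ C, u ≠ v → G.Adj u v) ∧
    ∀ u ∉ C, ∀ v ∉ C, ∀ w ∉ C, G.Adj u v → G.Adj v w → u ≠ w → G.Adj u w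

theorem isUnipolarArrangement_coe_iff (G : SimpleGraph (Fin n)) (C : Finset (Fin n)) :
    IsUnipolarArrangement G (C : Set (Fin n)) ↔ CliqueSplit G C := by
  constructor
  · rintro ⟨h1, h2⟩
    refine ⟨fun u hu v hv huv => h1 (by simpa using hu) (by simpa using hv) huv, ?_⟩
    intro u hu v hv w hw huv hvw huw
    have e1 : (G.induce (C : Set (Fin n))ᶜ).Adj ⟨u, by simpa using hu⟩ ⟨v, by simpa using hv⟩ := huv
    have e2 : (G.induce (C : Set (Fin n))ᶜ).Adj ⟨v, by simpa using hv⟩ ⟨w, by simpa using hw⟩ := hvw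
    exact h2 _ _ (e1.reachable.trans e2.reachable) (fun h => huw (congrArg Subtype.val h))
  · rintro ⟨h1, h2⟩
    refine ⟨fun u hu v hv huv => h1 u (by simpa using hu) v (by simpa using hv) huv, ?_⟩
    rintro u v ⟨p⟩ huv
    induction p with
    | nil => exact absurd rfl huv
    | @cons a b c hab p ih =>
      by_cases hbc : b = c
      · subst hbc; exact hab
      · exact h2 a (mt mem_coe.2 a.2) b (mt mem_coe.2 b.2) c (mt mem_coe.2 c.2) hab (ih hbc)
          (fun h => huv (Subtype.ext h))

/-- The central cliques of the unipolar arrangements of `G`. -/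
def splits (G : SimpleGraph (Fin n)) : Finset (Finset (Fin n)) :=
  univ.filter (CliqueSplit G)

/-- The graphs for which `C` is a central clique. -/
def graphsOf (C : Finset (Fin n)) : Finset (SimpleGraph (Fin n)) :=
  univ.filter fun G => CliqueSplit G C

theorem mem_splits {G : SimpleGraph (Fin n)} {C : Finset (Fin n)} :
    C ∈ splits G ↔ CliqueSplit G C := by simp [splits]

theorem mem_graphsOf {G : SimpleGraph (Fin n)} {C : Finset (Fin n)} :
    G ∈ graphsOf C ↔ CliqueSplit G C := by simp [graphsOf]

theorem Rplus_eq_card_splits (G : SimpleGraph (Fin n)) : Rplus G = #(splits G) := by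
  unfold Rplus
  rw [← Set.coe_ofPred, Nat.card_coe_set_eq, ← Set.ncard_coe_finset]
  symm
  refine Set.ncard_congr (fun (C : Finset (Fin n)) _ => (C : Set (Fin n))) ?_ ?_ ?_
  · intro C hC
    exact (isUnipolarArrangement_coe_iff G C).2 (mem_splits.1 hC)
  · intro C C' _ _ h
    exact coe_injective h
  · intro C hC
    refine ⟨C.toFinset, mem_splits.2 ((isUnipolarArrangement_coe_iff G _).1 ?_), by simp⟩
    simpa using hC

theorem sum_Rplus : ∑ G : SimpleGraph (Fin n), Rplus G = ∑ C, #(graphsOf (n := n) C) := by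
  simp only [Rplus_eq_card_splits, splits, graphsOf, card_filter]
  exact sum_comm

/-- Replace the neighbourhood of `x` inside `T` by `S`. -/
def restar (G : SimpleGraph (Fin n)) (x : Fin n) (T S : Finset (Fin n)) (hx : x ∉ T) :
    SimpleGraph (Fin n) where
  Adj u v := if u = x ∧ v ∈ T then v ∈ S else if v = x ∧ u ∈ T then u ∈ S else G.Adj u v
  symm := ⟨fun u v => by have := G.adj_comm u v; grind⟩
  loopless := ⟨fun u => by have := G.irrefl (v := u); grind⟩

theorem CliqueSplit.restar {G : SimpleGraph (Fin n)} {C : Finset (Fin n)} (h : CliqueSplit G C)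
    {x : Fin n} {T : Finset (Fin n)} (S : Finset (Fin n)) (hx : x ∉ T)
    (hT : ∀ t ∈ T, t ∈ C ↔ x ∉ C) : CliqueSplit (restar G x T S hx) C := by
  obtain ⟨h1, h2⟩ := h
  refine ⟨?_, ?_⟩
  · intro u hu v hv huv
    have := h1 u hu v hv huv
    simp only [_root_.restar]
    grind
  · intro u hu v hv w hw huv hvw huw
    have := h2 u hu v hv w hw
    simp only [_root_.restar] at *
    grind

/-- Graphs whose star from `x` to `T` is determined by the rest of the graph are rare. -/
theorem card_mul_two_pow_le_of_star (C : Finset (Fin n)) (x : Fin n) (T : Finset (Fin n))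
    (hx : x ∉ T) (hT : ∀ t ∈ T, t ∈ C ↔ x ∉ C) (D : SimpleGraph (Fin n) → Finset (Fin n))
    (hD : ∀ G S, D (restar G x T S hx) = D G) (F : Finset (SimpleGraph (Fin n)))
    (hF : ∀ G ∈ F, CliqueSplit G C ∧ ∀ t ∈ T, G.Adj x t ↔ t ∈ D G) :
    #F * 2 ^ #T ≤ #(graphsOf C) := by
  rw [← card_powerset, ← card_product]
  apply card_le_card_of_injOn (fun p => restar p.1 x T p.2 hx)
  · rintro ⟨G, S⟩ h
    simp only [coe_product, Set.mem_prod, mem_coe] at h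
    exact mem_graphsOf.2 ((hF G h.1).1.restar S hx hT)
  · rintro ⟨G, S⟩ h ⟨G', S'⟩ h' e
    simp only [coe_product, Set.mem_prod, mem_coe, mem_powerset] at h h' e
    have hDD : D G = D G' := by rw [← hD G S, ← hD G' S', e]
    have e' : ∀ u v, (restar G x T S hx).Adj u v ↔ (restar G' x T S' hx).Adj u v := by simp [e]
    simp only [restar] at e'
    have h1 := (hF G h.1).2
    have h2 := (hF G' h'.1).2
    rw [Prod.mk.injEq]
    constructor
    · ext u v
      have := e' u v
      have := G.adj_comm u v
      have := G'.adj_comm u v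
      grind
    · ext t
      have := e' x t
      have := @h.2 t
      have := @h'.2 t
      grind

/-- `P` is a side clique of the arrangement `(G, C)`. -/
def IsSide (G : SimpleGraph (Fin n)) (C P : Finset (Fin n)) : Prop :=
  Disjoint P C ∧ (∀ u ∈ P, ∀ v ∈ P, u ≠ v → G.Adj u v) ∧ ∀ u ∈ P, ∀ v ∉ C, G.Adj u v → v ∈ P

/-- Replace the graph inside `P` by the disjoint union of cliques on the fibres of `g`. -/
def recolor (G : SimpleGraph (Fin n)) (P : Finset (Fin n)) (g : Fin n → Fin n) :
    SimpleGraph (Fin n) where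
  Adj u v := if u ∈ P ∧ v ∈ P then u ≠ v ∧ g u = g v else G.Adj u v
  symm := ⟨fun u v => by have := G.adj_comm u v; grind⟩
  loopless := ⟨fun u => by have := G.irrefl (v := u); grind⟩

theorem card_isSide_mul_pow_le (C P : Finset (Fin n)) (k : ℕ) (hk : k ≤ #P) :
    #{G | CliqueSplit G C ∧ IsSide G C P} * k ^ (#P - k) ≤ #(graphsOf C) := by
  obtain ⟨Q, hQP, hQ⟩ := exists_subset_card_eq hk
  have hcard : k ^ (#P - k) = #(Fintype.piFinset fun u : Fin n => if u ∈ P \ Q then Q else {u}) := by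
    rw [Fintype.card_piFinset, ← hQ, ← card_sdiff_of_subset hQP, ← prod_const,
      ← Finset.prod_subset (subset_univ (P \ Q))]
    · exact prod_congr rfl fun u hu => by simp [hu]
    · intro u _ hu; simp [hu]
  rw [hcard, ← card_product]
  apply card_le_card_of_injOn (fun p => recolor p.1 P p.2)
  · rintro ⟨G, g⟩ h
    simp only [coe_product, Set.mem_prod, mem_coe, mem_filter, mem_univ, true_and] at h
    obtain ⟨⟨⟨h1, h2⟩, h3, h4, h5⟩, -⟩ := h
    rw [disjoint_left] at h3
    refine mem_graphsOf.2 ⟨?_, ?_⟩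
    · intro u hu v hv huv
      have := h1 u hu v hv huv
      simp only [recolor]
      grind
    · intro u hu v hv w hw huv hvw huw
      have := h2 u hu v hv w hw
      have := h5 u
      have := h5 v
      have := h5 w
      have := G.adj_comm u v
      have := G.adj_comm v w
      simp only [recolor] at *
      grind
  · rintro ⟨G, g⟩ h ⟨G', g'⟩ h' e
    simp only [coe_product, Set.mem_prod, mem_coe, mem_filter, mem_univ, true_and,
      Fintype.mem_piFinset] at h h' e
    obtain ⟨⟨-, h3, h4, h5⟩, hg⟩ := h
    obtain ⟨⟨-, h3', h4', h5'⟩, hg'⟩ := h'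
    have e' : ∀ u v, (recolor G P g).Adj u v ↔ (recolor G' P g').Adj u v := by simp [e]
    simp only [recolor] at e'
    rw [Prod.mk.injEq]
    constructor
    · ext u v
      have := e' u v
      have := h4 u
      have := h4' u
      have := G.irrefl (v := u)
      have := G'.irrefl (v := u)
      grind
    · ext1 u
      have a1 := hg u
      have a2 := hg' u
      by_cases hu : u ∈ P \ Q
      · rw [if_pos hu] at a1 a2
        have b1 := hg (g u)
        have b2 := hg' (g u)
        have := e' u (g u)
        have := hQP a1
        have := hQP a2
        simp only [mem_sdiff] at *
        grind
      · simp_all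

theorem two_pow_le_card_graphsOf (C : Finset (Fin n)) :
    2 ^ (#C * (n - #C)) ≤ #(graphsOf C) := by
  have hc : #C * (n - #C) = #(C ×ˢ Cᶜ) := by simp [card_product, card_compl]
  rw [hc, ← card_powerset]
  let F : Finset (Fin n × Fin n) → SimpleGraph (Fin n) := fun E =>
    { Adj := fun u v => u ≠ v ∧ ((u ∈ C ∧ v ∈ C) ∨ (u ∈ C ∧ v ∉ C ∧ (u, v) ∈ E) ∨
        (v ∈ C ∧ u ∉ C ∧ (v, u) ∈ E))
      symm := ⟨fun u v => by grind⟩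
      loopless := ⟨fun u => by grind⟩ }
  apply card_le_card_of_injOn F
  · intro E _
    refine mem_graphsOf.2 ⟨?_, ?_⟩
    · intro u hu v hv huv
      simp only [F]; grind
    · intro u hu v hv w hw huv
      simp only [F] at *; grind
  · intro E hE E' hE' e
    simp only [mem_coe, mem_powerset] at hE hE'
    have e' : ∀ u v, (F E).Adj u v ↔ (F E').Adj u v := by simp [e]
    simp only [F] at e'
    ext ⟨u, v⟩
    have := e' u v
    have := @hE (u, v)
    have := @hE' (u, v)
    simp only [mem_product, mem_compl] at *
    grind

theorem card_graphsOf_le (C : Finset (Fin n)) :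
    #(graphsOf C) ≤ n ^ n * 2 ^ (#C * (n - #C)) := by
  have hc : #C * (n - #C) = #(C ×ˢ Cᶜ) := by simp [card_product, card_compl]
  have hn : n ^ n = #(univ : Finset (Fin n → Fin n)) := by simp
  rw [hc, hn, ← card_powerset, ← card_product]
  let cls : SimpleGraph (Fin n) → Fin n → Finset (Fin n) := fun G v =>
    {w | w ∉ C ∧ (w = v ∨ G.Adj v w)}
  let rep : SimpleGraph (Fin n) → Fin n → Fin n := fun G v =>
    if h : (cls G v).Nonempty then (cls G v).min' h else v
  have key : ∀ G, CliqueSplit G C → ∀ u ∉ C, ∀ v ∉ C, u ≠ v → (G.Adj u v ↔ rep G u = rep G v) := by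
    rintro G ⟨-, h2⟩ u hu v hv huv
    have nu : (cls G u).Nonempty := ⟨u, by simp [cls, hu]⟩
    have nv : (cls G v).Nonempty := ⟨v, by simp [cls, hv]⟩
    constructor
    · intro h
      have : cls G u = cls G v := by
        ext w
        simp only [cls, mem_filter, mem_univ, true_and]
        have := h2 u hu v hv w
        have := h2 v hv u hu w
        have := G.adj_comm u v
        grind
      simp only [rep, this]
      simp [nv]
    · intro h
      simp only [rep, nu, nv, dif_pos] at h
      have m1 := min'_mem _ nu
      have m2 := min'_mem _ nv
      rw [← h] at m2
      simp only [cls, mem_filter, mem_univ, true_and] at m1 m2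
      have := h2 u hu _ m1.1 v hv
      have := G.adj_comm v ((cls G u).min' nu)
      have := G.adj_comm v u
      simp only [cls] at *
      grind
  apply card_le_card_of_injOn
    (fun G => (rep G, (C ×ˢ Cᶜ).filter fun p : Fin n × Fin n => G.Adj p.1 p.2))
  · intro G _
    simp only [coe_product, Set.mem_prod, mem_coe, mem_univ, mem_powerset, true_and]
    exact filter_subset _ _
  · intro G hG G' hG' e
    rw [mem_coe, mem_graphsOf] at hG hG'
    simp only [Prod.mk.injEq] at e
    obtain ⟨e1, e2⟩ := e
    have e3 : ∀ u ∈ C, ∀ v ∉ C, G.Adj u v ↔ G'.Adj u v := by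
      intro u hu v hv
      have := congrArg ((u, v) ∈ ·) e2
      simpa [hu, hv] using this
    ext u v
    by_cases huv : u = v
    · subst huv; simp
    have k1 := key G hG u
    have k2 := key G' hG' u
    have := hG.1 u
    have := hG'.1 u
    have := e3 u
    have := e3 v
    have := G.adj_comm u v
    have := G'.adj_comm u v
    rw [e1] at k1
    clear_value rep
    clear hc hn key e1 e2 e3
    by_cases hu : u ∈ C <;> by_cases hv : v ∈ C <;> grind

/-- Graphs having both `C` and a different set as a central clique are rare. -/
theorem card_two_splits_mul_two_pow_le (C A B : Finset (Fin n)) (hA : A ⊆ C) (hB : Disjoint B C)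
    (hAB : A.Nonempty ∨ B.Nonempty) :
    #{G | CliqueSplit G C ∧ CliqueSplit G (C \ A ∪ B)} * 2 ^ min #(C \ A) (n - #C) ≤
      (n + 1) * #(graphsOf C) := by
  rw [disjoint_left] at hB
  rcases B.eq_empty_or_nonempty with rfl | ⟨b, hb⟩
  · obtain ⟨x, hx⟩ : A.Nonempty := by simpa using hAB
    have hxC := hA hx
    have hxT : x ∉ Cᶜ := by simpa using hxC
    have hT : ∀ t ∈ Cᶜ, t ∈ C ↔ x ∉ C := by simp [hxC]
    let D : Option (Fin n) → SimpleGraph (Fin n) → Finset (Fin n) := fun o G =>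
      match o with
      | none => ∅
      | some w => {t | t ∉ C ∧ w ∉ C ∧ (t = w ∨ G.Adj w t)}
    let F : Option (Fin n) → Finset (SimpleGraph (Fin n)) := fun o =>
      {G | CliqueSplit G C ∧ ∀ t ∈ Cᶜ, G.Adj x t ↔ t ∈ D o G}
    have hF : ∀ o, #(F o) * 2 ^ #Cᶜ ≤ #(graphsOf C) := by
      intro o
      refine card_mul_two_pow_le_of_star C x Cᶜ hxT hT (D o) ?_ (F o) ?_
      · intro G S
        cases o with
        | none => rfl
        | some w =>
          ext t
          simp only [D, restar, mem_filter, mem_univ, true_and, mem_compl]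
          grind
      · intro G hG
        simpa [F] using hG
    have hsub : ({G | CliqueSplit G C ∧ CliqueSplit G (C \ A ∪ ∅)} :
        Finset (SimpleGraph (Fin n))) ⊆ univ.biUnion F := by
      intro G hG
      simp only [mem_filter, mem_univ, true_and, union_empty] at hG
      obtain ⟨hG, -, h2⟩ := hG
      simp only [mem_biUnion, mem_univ, true_and, F, mem_filter]
      by_cases h : ∃ w ∉ C, G.Adj x w
      · obtain ⟨w, hw, hxw⟩ := h
        refine ⟨some w, hG, fun t ht => ?_⟩
        rw [mem_compl] at ht
        simp only [D, mem_filter, mem_univ, true_and]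
        have := h2 x (by simp [hx]) w (by simp [hw]) t (by simp [ht])
        have := h2 w (by simp [hw]) x (by simp [hx]) t (by simp [ht])
        have := G.adj_comm x w
        grind
      · refine ⟨none, hG, fun t ht => ?_⟩
        simp only [D]
        push Not at h
        simpa using h t (by simpa using ht)
    calc _ ≤ (∑ o, #(F o)) * 2 ^ #Cᶜ := by
          gcongr
          · exact (card_le_card hsub).trans card_biUnion_le
          · norm_num
          · rw [card_compl, Fintype.card_fin]; exact min_le_right _ _
      _ = ∑ o, #(F o) * 2 ^ #Cᶜ := sum_mul _ _ _
      _ ≤ ∑ _o : Option (Fin n), #(graphsOf C) := sum_le_sum fun o _ => hF o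
      _ = _ := by simp
  · have hbC := hB hb
    have := card_mul_two_pow_le_of_star C b (C \ A) (by simp [hbC]) (by simp +contextual [hbC])
      (fun _ => C \ A) (fun _ _ => rfl)
      {G | CliqueSplit G C ∧ CliqueSplit G (C \ A ∪ B)} (by
        intro G hG
        simp only [mem_filter, mem_univ, true_and] at hG
        refine ⟨hG.1, fun t ht => ⟨fun _ => ht, fun _ => ?_⟩⟩
        exact hG.2.1 b (mem_union_right _ hb) t (mem_union_left _ ht) (by grind))
    calc _ ≤ _ * 2 ^ #(C \ A) := by
          gcongr
          · norm_num
          · exact min_le_left _ _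
      _ ≤ #(graphsOf C) := this
      _ ≤ _ := Nat.le_mul_of_pos_left _ (by omega)

/-- `G` has only balanced arrangements whose side cliques are small. -/
def Tame (δ : ℝ) (G : SimpleGraph (Fin n)) : Prop :=
  ∀ C, CliqueSplit G C →
    |(#C : ℝ) - n / 2| ≤ δ * n ∧ ∀ P, IsSide G C P → (#P : ℝ) ≤ δ * n

/-- Sets containing at most a proportion `δ` of the vertices. -/
def smallSets (n : ℕ) (δ : ℝ) : Finset (Finset (Fin n)) :=
  {S | (#S : ℝ) ≤ δ * n}

/-- Triples `(C, A, B)` for which both `C` and `C \ A ∪ B` are central cliques of `G`. -/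
def exchanges (δ : ℝ) (G : SimpleGraph (Fin n)) :
    Finset (Finset (Fin n) × Finset (Fin n) × Finset (Fin n)) :=
  {p ∈ univ ×ˢ smallSets n δ ×ˢ smallSets n δ |
    |(#p.1 : ℝ) - n / 2| ≤ δ * n ∧ p.2.1 ⊆ p.1 ∧ Disjoint p.2.2 p.1 ∧
      (p.2.1.Nonempty ∨ p.2.2.Nonempty) ∧ CliqueSplit G p.1 ∧
      CliqueSplit G (p.1 \ p.2.1 ∪ p.2.2)}

theorem Tame.sdiff_mem_smallSets {δ : ℝ} {G : SimpleGraph (Fin n)} (hδ : 0 ≤ δ) (h : Tame δ G)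
    {C C' : Finset (Fin n)} (hC : CliqueSplit G C) (hC' : CliqueSplit G C') :
    C' \ C ∈ smallSets n δ := by
  simp only [smallSets, mem_filter, mem_univ, true_and]
  rcases (C' \ C).eq_empty_or_nonempty with h0 | ⟨b, hb⟩
  · rw [h0]; simp only [card_empty, Nat.cast_zero]; positivity
  · let P : Finset (Fin n) := {v | v ∉ C ∧ (v = b ∨ G.Adj b v)}
    rw [mem_sdiff] at hb
    have hP : IsSide G C P := by
      refine ⟨?_, ?_, ?_⟩
      · rw [disjoint_left]; simp +contextual [P]
      · intro u hu v hv huv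
        simp only [P, mem_filter, mem_univ, true_and] at hu hv
        have := hC.2 u hu.1 b hb.2 v hv.1
        have := G.adj_comm b u
        grind
      · intro u hu v hv huv
        simp only [P, mem_filter, mem_univ, true_and] at hu ⊢
        have := hC.2 b hb.2 u hu.1 v hv
        grind
    refine le_trans ?_ ((h C hC).2 P hP)
    gcongr
    intro v hv
    rw [mem_sdiff] at hv
    simp only [P, mem_filter, mem_univ, true_and]
    have := hC'.1 b hb.1 v hv.1
    grind

theorem exchange_injective : Function.Injective
    (fun p : Finset (Fin n) × Finset (Fin n) => (p.1, p.1 \ p.2, p.2 \ p.1)) := by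
  rintro ⟨C, C'⟩ ⟨D, D'⟩ h
  simp only [Prod.mk.injEq] at h
  obtain ⟨rfl, h1, h2⟩ := h
  have e : ∀ E : Finset (Fin n), E = C \ (C \ E) ∪ E \ C := by intro E; ext; grind
  rw [Prod.mk.injEq]
  exact ⟨rfl, by rw [e C', h1, h2, ← e D']⟩

theorem Tame.card_offDiag_le {δ : ℝ} {G : SimpleGraph (Fin n)} (hδ : 0 ≤ δ) (h : Tame δ G) :
    #(splits G).offDiag ≤ #(exchanges δ G) := by
  apply card_le_card_of_injOn _ _ exchange_injective.injOn
  rintro ⟨C, C'⟩ hp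
  rw [mem_coe, mem_offDiag, mem_splits, mem_splits] at hp
  obtain ⟨hC, hC', hne⟩ := hp
  simp only [exchanges, coe_filter, Set.mem_ofPred_eq, mem_product, mem_univ, true_and]
  refine ⟨⟨h.sdiff_mem_smallSets hδ hC' hC, h.sdiff_mem_smallSets hδ hC hC'⟩, (h C hC).1,
    sdiff_subset, sdiff_disjoint, ?_, hC, ?_⟩
  · by_contra! h0
    obtain ⟨h1, h2⟩ := h0
    rw [sdiff_eq_empty_iff_subset] at h1 h2
    exact hne (h1.antisymm h2)
  · convert hC' using 1
    ext; grind

theorem Tame.card_splits_le {δ : ℝ} {G : SimpleGraph (Fin n)} (hδ : 0 ≤ δ) (h : Tame δ G) :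
    #(splits G) ≤ #(smallSets n δ) ^ 2 := by
  rcases (splits G).eq_empty_or_nonempty with h0 | ⟨C, hC⟩
  · simp [h0]
  rw [sq, ← card_product]
  apply card_le_card_of_injOn (fun C' => (C \ C', C' \ C))
  · intro C' hC'
    rw [mem_coe, mem_splits] at hC'
    rw [mem_splits] at hC
    simpa using ⟨h.sdiff_mem_smallSets hδ hC' hC, h.sdiff_mem_smallSets hδ hC hC'⟩
  · intro C' _ D' _ e
    have := @exchange_injective n (C, C') (C, D') (by simpa using e)
    simpa using this

theorem Tame.Rplus_pow_le {δ M : ℝ} {G : SimpleGraph (Fin n)} (hδ : 0 ≤ δ) (h : Tame δ G)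
    (hM : (#(smallSets n δ) : ℝ) ≤ M) {j : ℕ} (hj : 1 ≤ j) :
    (Rplus G : ℝ) ^ j ≤ Rplus G + #(exchanges δ G) * M ^ (2 * j) := by
  rw [Rplus_eq_card_splits]
  have h1 := h.card_offDiag_le hδ
  have h2 : (#(splits G) : ℝ) ≤ M ^ 2 := by
    refine le_trans (b := (#(smallSets n δ) : ℝ) ^ 2) (by exact_mod_cast h.card_splits_le hδ) ?_
    gcongr
  have hM0 : 0 ≤ M := le_trans (by positivity) hM
  generalize hr : #(splits G) = r at *
  rcases Nat.lt_or_ge r 2 with h3 | h3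
  · have : (r : ℝ) ^ j ≤ r := by interval_cases r <;> simp [show j ≠ 0 by omega]
    have : 0 ≤ (#(exchanges δ G) : ℝ) * M ^ (2 * j) := by positivity
    linarith
  · have h4 : 1 ≤ #(exchanges δ G) := by
      rw [offDiag_card, hr] at h1
      have : 2 * r ≤ r * r := Nat.mul_le_mul_right r h3
      omega
    have h5 : (1 : ℝ) ≤ #(exchanges δ G) := by exact_mod_cast h4
    calc (r : ℝ) ^ j ≤ (M ^ 2) ^ j := by gcongr
      _ = 1 * M ^ (2 * j) := by rw [one_mul, pow_mul]
      _ ≤ #(exchanges δ G) * M ^ (2 * j) := by gcongr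
      _ ≤ _ := by simp

theorem sum_card_exchanges_le {δ M : ℝ} (hδ : 0 ≤ δ) (hM : (#(smallSets n δ) : ℝ) ≤ M) :
    (∑ G : SimpleGraph (Fin n), (#(exchanges δ G) : ℝ)) ≤
      M ^ 2 * ((n + 1) * (2 : ℝ) ^ (-((1 / 2 - 2 * δ) * n))) *
        ∑ G : SimpleGraph (Fin n), (Rplus G : ℝ) := by
  set K : ℝ := (n + 1) * (2 : ℝ) ^ (-((1 / 2 - 2 * δ) * n)) with hK
  have hK0 : 0 ≤ K := by positivity
  have key : ∀ C : Finset (Fin n), ∀ A ∈ smallSets n δ, ∀ B : Finset (Fin n),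
      (#{G : SimpleGraph (Fin n) | |(#C : ℝ) - n / 2| ≤ δ * n ∧ A ⊆ C ∧ Disjoint B C ∧
        (A.Nonempty ∨ B.Nonempty) ∧ CliqueSplit G C ∧ CliqueSplit G (C \ A ∪ B)} : ℝ) ≤
      K * #(graphsOf C) := by
    intro C A hA B
    by_cases h : |(#C : ℝ) - n / 2| ≤ δ * n ∧ A ⊆ C ∧ Disjoint B C ∧ (A.Nonempty ∨ B.Nonempty)
    · obtain ⟨h1, h2, h3, h4⟩ := h
      simp only [h1, h2, h3, h4, true_and]
      have hp : ((#{G | CliqueSplit G C ∧ CliqueSplit G (C \ A ∪ B)} : ℕ) : ℝ) *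
          2 ^ min #(C \ A) (n - #C) ≤ (n + 1) * #(graphsOf C) := by
        exact_mod_cast card_two_splits_mul_two_pow_le C A B h2 h3 h4
      have hm : (2 : ℝ) ^ ((1 / 2 - 2 * δ) * n) ≤ 2 ^ min #(C \ A) (n - #C) := by
        rw [← Real.rpow_natCast]
        refine Real.rpow_le_rpow_of_exponent_le (by norm_num) ?_
        have hCn : #C ≤ n := by simpa using card_le_univ C
        simp only [smallSets, mem_filter, mem_univ, true_and] at hA
        rw [card_sdiff_of_subset h2, Nat.cast_min, Nat.cast_sub (card_le_card h2),
          Nat.cast_sub hCn]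
        rw [abs_le] at h1
        have : 0 ≤ δ * n := by positivity
        refine le_min ?_ ?_ <;> linarith
      rw [hK, Real.rpow_neg (by norm_num)]
      have hpos : (0 : ℝ) < (2 : ℝ) ^ ((1 / 2 - 2 * δ) * n) := by positivity
      have := (mul_le_mul_of_nonneg_left hm (Nat.cast_nonneg _)).trans hp
      rw [← le_div_iff₀ hpos] at this
      exact this.trans_eq (by ring)
    · rw [filter_false_of_mem]
      · simp only [card_empty, Nat.cast_zero]; positivity
      · tauto
  have hswap : ∑ G : SimpleGraph (Fin n), #(exchanges δ G) =
      ∑ C : Finset (Fin n), ∑ A ∈ smallSets n δ, ∑ B ∈ smallSets n δ,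
        #{G : SimpleGraph (Fin n) | |(#C : ℝ) - n / 2| ≤ δ * n ∧ A ⊆ C ∧ Disjoint B C ∧
          (A.Nonempty ∨ B.Nonempty) ∧ CliqueSplit G C ∧ CliqueSplit G (C \ A ∪ B)} := by
    simp only [exchanges, card_filter]
    rw [sum_comm, sum_product]
    exact sum_congr rfl fun C _ => sum_product _ _ _
  have hX : (∑ G : SimpleGraph (Fin n), (Rplus G : ℝ)) =
      ∑ C : Finset (Fin n), (#(graphsOf C) : ℝ) := by exact_mod_cast sum_Rplus
  rw [← Nat.cast_sum, hswap, hX]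
  push_cast
  calc _ ≤ ∑ C : Finset (Fin n), ∑ A ∈ smallSets n δ, ∑ B ∈ smallSets n δ,
        K * (#(graphsOf C) : ℝ) := by
        gcongr with C _ A hA B _
        exact key C A hA B
    _ = (#(smallSets n δ) : ℝ) ^ 2 * K * ∑ C : Finset (Fin n), (#(graphsOf C) : ℝ) := by
        rw [mul_sum]
        refine sum_congr rfl fun C _ => ?_
        rw [sum_const, sum_const, nsmul_eq_mul, nsmul_eq_mul]
        ring
    _ ≤ _ := mul_le_mul_of_nonneg_right
        (mul_le_mul_of_nonneg_right (pow_le_pow_left₀ (Nat.cast_nonneg _) hM 2) hK0)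
        (sum_nonneg fun _ _ => Nat.cast_nonneg _)

theorem card_not_tame_le (δ : ℝ) :
    #{G : SimpleGraph (Fin n) | ¬ Tame δ G} ≤
      ∑ C with ¬ |(#C : ℝ) - n / 2| ≤ δ * n, #(graphsOf (n := n) C) +
      ∑ C : Finset (Fin n), ∑ P with ¬ (#P : ℝ) ≤ δ * n, #{G | CliqueSplit G C ∧ IsSide G C P} := by
  refine le_trans (card_le_card (t := (univ.filter fun C : Finset (Fin n) =>
      ¬ |(#C : ℝ) - n / 2| ≤ δ * n).biUnion graphsOf ∪
      univ.biUnion fun C => (univ.filter fun P : Finset (Fin n) => ¬ (#P : ℝ) ≤ δ * n).biUnion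
        fun P => {G | CliqueSplit G C ∧ IsSide G C P}) ?_) ?_
  · intro G hG
    simp only [Tame] at hG
    simp only [mem_union, mem_biUnion, mem_filter, mem_univ, true_and, mem_graphsOf]
    grind
  · refine (card_union_le _ _).trans (add_le_add card_biUnion_le ?_)
    exact card_biUnion_le.trans (sum_le_sum fun C _ => card_biUnion_le)

theorem exists_card_smallSets_le {η : ℝ} (hη : 0 < η) :
    ∃ δ : ℝ, 0 < δ ∧ δ ≤ η ∧ ∀ n : ℕ, (#(smallSets n δ) : ℝ) ≤ 2 ^ (η * n) := by
  obtain ⟨r, hr⟩ := exists_pow_lt_of_lt_one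
    (sub_pos.2 (Real.one_lt_rpow (by norm_num : (1 : ℝ) < 2) (half_pos hη)))
    (by norm_num : (1 / 2 : ℝ) < 1)
  refine ⟨min η (η / (2 * (r + 1))), by positivity, min_le_left _ _, fun n => ?_⟩
  set δ := min η (η / (2 * (r + 1)))
  set x : ℝ := (1 / 2) ^ r with hx
  have hx0 : 0 < x := by positivity
  have hx2 : x = (2 : ℝ) ^ (-(r : ℝ)) := by
    rw [hx, Real.rpow_neg (by norm_num), Real.rpow_natCast]; simp
  have hδ : r * δ ≤ η / 2 := by
    have h1 : δ ≤ η / (2 * (r + 1)) := min_le_right _ _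
    rw [le_div_iff₀ (by positivity)] at h1
    have h2 : 0 < δ := by positivity
    nlinarith
  have h1 : (#(smallSets n δ) : ℝ) * 2 ^ (-(η / 2) * n) ≤ (x + 1) ^ n := by
    have h2 := Fintype.sum_pow_mul_eq_add_pow (Fin n) x (1 : ℝ)
    rw [Fintype.card_fin] at h2
    rw [← h2, ← nsmul_eq_mul]
    refine (card_nsmul_le_sum (smallSets n δ) (fun S => x ^ #S * 1 ^ (n - #S)) _ ?_).trans
      (sum_le_sum_of_subset_of_nonneg (subset_univ _) fun _ _ _ => by positivity)
    intro S hS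
    simp only [smallSets, mem_filter, mem_univ, true_and] at hS
    rw [one_pow, mul_one, hx2, ← Real.rpow_natCast, ← Real.rpow_mul (by norm_num)]
    refine Real.rpow_le_rpow_of_exponent_le (by norm_num) ?_
    have h3 : (r : ℝ) * #S ≤ r * (δ * n) := by gcongr
    have h4 : r * δ * n ≤ η / 2 * n := by gcongr
    linarith
  have h2 : (x + 1) ^ n ≤ (2 : ℝ) ^ (η / 2 * n) := by
    rw [Real.rpow_mul (by norm_num), Real.rpow_natCast]
    gcongr
    linarith
  calc (#(smallSets n δ) : ℝ)
      = #(smallSets n δ) * 2 ^ (-(η / 2) * n) * 2 ^ (η / 2 * n) := by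
        rw [mul_assoc, ← Real.rpow_add (by norm_num)]; simp
    _ ≤ 2 ^ (η / 2 * n) * 2 ^ (η / 2 * n) := by gcongr; exact h1.trans h2
    _ = _ := by rw [← Real.rpow_add (by norm_num)]; ring_nf

theorem two_rpow_le_sum_Rplus (n : ℕ) :
    (2 : ℝ) ^ ((n : ℝ) ^ 2 / 4 - 1) ≤ ∑ G : SimpleGraph (Fin n), (Rplus G : ℝ) := by
  obtain ⟨C, -, hC⟩ := exists_subset_card_eq (s := (univ : Finset (Fin n))) (n := n / 2)
    (by simpa using Nat.div_le_self n 2)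
  have h1 : #(graphsOf C) ≤ ∑ G : SimpleGraph (Fin n), Rplus G := by
    rw [sum_Rplus]
    exact single_le_sum (f := fun C => #(graphsOf (n := n) C)) (fun _ _ => Nat.zero_le _)
      (mem_univ C)
  have h2 := (two_pow_le_card_graphsOf C).trans h1
  have h3 : (2 : ℝ) ^ (#C * (n - #C)) ≤ ∑ G : SimpleGraph (Fin n), (Rplus G : ℝ) := by
    exact_mod_cast h2
  refine le_trans ?_ h3
  rw [← Real.rpow_natCast 2 (#C * _)]
  refine Real.rpow_le_rpow_of_exponent_le (by norm_num) ?_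
  rw [hC]
  have h4 : n ^ 2 ≤ 4 * (n / 2 * (n - n / 2)) + 4 := by
    rcases Nat.even_or_odd' n with ⟨m, rfl | rfl⟩
    · rw [Nat.mul_div_cancel_left _ (by norm_num), show 2 * m - m = m by omega]; nlinarith
    · rw [show (2 * m + 1) / 2 = m by omega, show 2 * m + 1 - m = m + 1 by omega]; nlinarith
  have h5 : (n : ℝ) ^ 2 ≤ 4 * ((n / 2 * (n - n / 2) : ℕ) : ℝ) + 4 := by exact_mod_cast h4
  linarith

theorem sum_card_unbalanced_le (n : ℕ) {δ : ℝ} (hδ : 0 < δ) :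
    (∑ C with ¬ |(#C : ℝ) - n / 2| ≤ δ * n, (#(graphsOf (n := n) C) : ℝ)) ≤
      2 ^ n * n ^ n * 2 ^ (1 - (δ * n) ^ 2) * ∑ G : SimpleGraph (Fin n), (Rplus G : ℝ) := by
  have h : ∀ C ∈ univ.filter (fun C : Finset (Fin n) => ¬ |(#C : ℝ) - n / 2| ≤ δ * n),
      (#(graphsOf C) : ℝ) ≤ n ^ n * 2 ^ ((n : ℝ) ^ 2 / 4 - (δ * n) ^ 2) := by
    intro C hC
    simp only [mem_filter, mem_univ, true_and, not_le] at hC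
    have h1 : (#(graphsOf C) : ℝ) ≤ n ^ n * 2 ^ (#C * (n - #C)) := by
      exact_mod_cast card_graphsOf_le C
    refine h1.trans ?_
    gcongr
    rw [← Real.rpow_natCast]
    refine Real.rpow_le_rpow_of_exponent_le (by norm_num) ?_
    have hCn : #C ≤ n := by simpa using card_le_univ C
    rw [Nat.cast_mul, Nat.cast_sub hCn]
    have h2 : (δ * n) ^ 2 ≤ ((#C : ℝ) - n / 2) ^ 2 := by
      rw [← sq_abs ((#C : ℝ) - n / 2)]
      gcongr
    linarith
  have h2 := sum_le_card_nsmul _ _ _ h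
  rw [nsmul_eq_mul] at h2
  have h3 : (#{C : Finset (Fin n) | ¬ |(#C : ℝ) - n / 2| ≤ δ * n} : ℝ) ≤ 2 ^ n := by
    have := card_le_univ (univ.filter fun C : Finset (Fin n) => ¬ |(#C : ℝ) - n / 2| ≤ δ * n)
    rw [Fintype.card_finset, Fintype.card_fin] at this
    exact_mod_cast this
  calc _ ≤ _ := h2
    _ ≤ 2 ^ n * (n ^ n * 2 ^ ((n : ℝ) ^ 2 / 4 - (δ * n) ^ 2)) := by gcongr
    _ = 2 ^ n * n ^ n * 2 ^ (1 - (δ * n) ^ 2) * 2 ^ ((n : ℝ) ^ 2 / 4 - 1) := by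
        rw [mul_assoc _ (2 ^ (1 - (δ * n) ^ 2)), ← Real.rpow_add (by norm_num)]; ring_nf
    _ ≤ _ := by gcongr; exact two_rpow_le_sum_Rplus n

theorem sum_card_isSide_le (n : ℕ) {δ : ℝ} (q : ℕ) (hq : (2 : ℝ) ^ q ≤ δ * n) :
    (∑ C : Finset (Fin n), ∑ P with ¬ (#P : ℝ) ≤ δ * n,
      (#{G | CliqueSplit G C ∧ IsSide G C P} : ℝ)) ≤
      2 ^ n * 2 ^ (-(q * (δ * n - 2 ^ q))) * ∑ G : SimpleGraph (Fin n), (Rplus G : ℝ) := by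
  have hX : (∑ G : SimpleGraph (Fin n), (Rplus G : ℝ)) =
      ∑ C : Finset (Fin n), (#(graphsOf C) : ℝ) := by exact_mod_cast sum_Rplus
  rw [hX, mul_sum]
  refine sum_le_sum fun C _ => ?_
  have h : ∀ P ∈ univ.filter (fun P : Finset (Fin n) => ¬ (#P : ℝ) ≤ δ * n),
      (#{G | CliqueSplit G C ∧ IsSide G C P} : ℝ) ≤
        2 ^ (-(q * (δ * n - 2 ^ q))) * #(graphsOf C) := by
    intro P hP
    simp only [mem_filter, mem_univ, true_and, not_le] at hP
    have hk : 2 ^ q ≤ #P := by exact_mod_cast hq.trans hP.le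
    have h1 : ((#{G | CliqueSplit G C ∧ IsSide G C P} : ℕ) : ℝ) * (2 ^ q) ^ (#P - 2 ^ q) ≤
        #(graphsOf C) := by exact_mod_cast card_isSide_mul_pow_le C P (2 ^ q) hk
    have h2 : (2 : ℝ) ^ (q * (δ * n - 2 ^ q)) ≤ (2 ^ q) ^ (#P - 2 ^ q) := by
      rw [← pow_mul, ← Real.rpow_natCast 2 (q * _)]
      refine Real.rpow_le_rpow_of_exponent_le (by norm_num) ?_
      push_cast [hk]
      gcongr
    have hpos : (0 : ℝ) < (2 : ℝ) ^ (q * (δ * n - 2 ^ q)) := by positivity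
    have h3 := (mul_le_mul_of_nonneg_left h2 (Nat.cast_nonneg _)).trans h1
    rw [← le_div_iff₀ hpos] at h3
    rw [Real.rpow_neg (by norm_num)]
    exact h3.trans_eq (by ring)
  have h2 := sum_le_card_nsmul _ _ _ h
  rw [nsmul_eq_mul] at h2
  have h3 : (#{P : Finset (Fin n) | ¬ (#P : ℝ) ≤ δ * n} : ℝ) ≤ 2 ^ n := by
    have := card_le_univ (univ.filter fun P : Finset (Fin n) => ¬ (#P : ℝ) ≤ δ * n)
    rw [Fintype.card_finset, Fintype.card_fin] at this
    exact_mod_cast this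
  rw [mul_assoc]
  exact h2.trans (by gcongr)

theorem eventually_add_one_le_two_rpow {β : ℝ} (hβ : 0 < β) :
    ∀ᶠ n : ℕ in Filter.atTop, (n : ℝ) + 1 ≤ 2 ^ (β * n) := by
  have h1 : (1 : ℝ) < 2 ^ β := Real.one_lt_rpow (by norm_num) hβ
  have h2 := (tendsto_pow_const_div_const_pow_of_one_lt 1 h1).eventually_le_const
    (by norm_num : (0 : ℝ) < 1 / 2)
  filter_upwards [h2, Filter.eventually_ge_atTop 1] with n hn hn1
  rw [div_le_iff₀ (by positivity), ← Real.rpow_natCast (2 ^ β), ← Real.rpow_mul (by norm_num)] at hn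
  have : (1 : ℝ) ≤ n := by exact_mod_cast hn1
  linarith

theorem Rplus_le_two_pow (G : SimpleGraph (Fin n)) : Rplus G ≤ 2 ^ n := by
  rw [Rplus_eq_card_splits]
  simpa using card_le_univ (splits G)

theorem sum_Rplus_pow_le {δ M : ℝ} (hδ : 0 ≤ δ) (hM : (#(smallSets n δ) : ℝ) ≤ M) {j : ℕ}
    (hj : 1 ≤ j) :
    (∑ G : SimpleGraph (Fin n), (Rplus G : ℝ) ^ j) ≤
      (∑ G : SimpleGraph (Fin n), (Rplus G : ℝ)) +
        (∑ G : SimpleGraph (Fin n), (#(exchanges δ G) : ℝ)) * M ^ (2 * j) +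
        #{G : SimpleGraph (Fin n) | ¬ Tame δ G} * (2 ^ n) ^ j := by
  have hM0 : 0 ≤ M := le_trans (by positivity) hM
  rw [card_filter]
  push_cast
  rw [sum_mul, sum_mul, ← sum_add_distrib, ← sum_add_distrib]
  refine sum_le_sum fun G _ => ?_
  by_cases h : Tame δ G
  · simpa [h] using h.Rplus_pow_le hδ hM hj
  · have h1 : (Rplus G : ℝ) ≤ 2 ^ n := by exact_mod_cast Rplus_le_two_pow G
    have h2 : (Rplus G : ℝ) ^ j ≤ (2 ^ n) ^ j := by gcongr
    have h3 : 0 ≤ (Rplus G : ℝ) + #(exchanges δ G) * M ^ (2 * j) := by positivity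
    simp only [h, not_false_eq_true, if_true, one_mul]
    linarith

/-- Moment bound: for each `j ≥ 1`,
`Σ_G R₊(G)^j ≤ (Σ_G R₊(G)) · (1 + 2^{−n/2 + o(n)})`. -/
theorem Rplus_moment_bound :
    ∀ j : ℕ, 1 ≤ j → ∀ ε : ℝ, 0 < ε → ∃ n₀ : ℕ, ∀ n : ℕ, n₀ ≤ n →
      (∑ G : SimpleGraph (Fin n), (Rplus G : ℝ) ^ j) ≤
        (∑ G : SimpleGraph (Fin n), (Rplus G : ℝ)) *
          (1 + (2 : ℝ) ^ (-((1 / 2 - ε) * n))) := by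
  intro j hj ε hε
  set η : ℝ := ε / (2 * j + 6) with hη
  have hη0 : 0 < η := by positivity
  have hηε : (2 * j + 6) * η = ε := by rw [hη]; field_simp
  obtain ⟨δ, hδ, hδη, hsmall⟩ := exists_card_smallSets_le hη0
  obtain ⟨q, hq⟩ := exists_nat_ge ((j + 3) / δ)
  rw [div_le_iff₀ hδ] at hq
  have hlarge : ∀ c : ℝ, ∀ᶠ n : ℕ in Filter.atTop, c ≤ n := fun c =>
    tendsto_natCast_atTop_atTop.eventually_ge_atTop c
  have hev := (eventually_add_one_le_two_rpow hη0).and <|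
    (eventually_add_one_le_two_rpow (β := δ ^ 2 / 2) (by positivity)).and <|
    (hlarge (1 / η)).and <| (hlarge (2 ^ q / δ)).and <| (hlarge (q * 2 ^ q + 2)).and <|
    hlarge (2 * (j + 5) / δ ^ 2)
  rw [Filter.eventually_atTop] at hev
  obtain ⟨n₀, hn₀⟩ := hev
  refine ⟨n₀, fun n hn => ?_⟩
  obtain ⟨h1, h2, h3, h4, h5, h6⟩ := hn₀ n hn
  rw [div_le_iff₀ (by positivity)] at h3 h4 h6
  have hn1 : (1 : ℝ) ≤ n := by
    have : (0 : ℝ) ≤ q * 2 ^ q := by positivity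
    linarith
  have hmain := sum_Rplus_pow_le hδ.le (hsmall n) hj
  have hexch := sum_card_exchanges_le hδ.le (hsmall n)
  have hunbal := sum_card_unbalanced_le n hδ
  have hside := sum_card_isSide_le n (δ := δ) q (by linarith)
  have hbad : (#{G : SimpleGraph (Fin n) | ¬ Tame δ G} : ℝ) ≤
      (∑ C with ¬ |(#C : ℝ) - n / 2| ≤ δ * n, (#(graphsOf (n := n) C) : ℝ)) +
      ∑ C : Finset (Fin n), ∑ P with ¬ (#P : ℝ) ≤ δ * n,
        (#{G | CliqueSplit G C ∧ IsSide G C P} : ℝ) := by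
    exact_mod_cast card_not_tame_le δ
  set X := ∑ G : SimpleGraph (Fin n), (Rplus G : ℝ)
  have hX : 0 ≤ X := sum_nonneg fun _ _ => Nat.cast_nonneg _
  set t : ℝ := 2 ^ (-((1 / 2 - ε) * n)) with ht
  have htwo : (1 : ℝ) ≤ 2 := by norm_num
  have hexch' : ((2 : ℝ) ^ (η * n)) ^ 2 * ((n + 1) * 2 ^ (-((1 / 2 - 2 * δ) * n))) *
      ((2 : ℝ) ^ (η * n)) ^ (2 * j) ≤ t / 2 := by
    calc _ ≤ ((2 : ℝ) ^ (η * n)) ^ 2 * (2 ^ (η * n) * 2 ^ (-((1 / 2 - 2 * δ) * n))) *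
          ((2 : ℝ) ^ (η * n)) ^ (2 * j) := by gcongr
      _ = 2 ^ (η * n * 2 + (η * n + -((1 / 2 - 2 * δ) * n)) + η * n * (2 * j)) := by
          rw [← Real.rpow_natCast, ← Real.rpow_natCast, ← Real.rpow_mul (by norm_num),
            ← Real.rpow_mul (by norm_num), ← Real.rpow_add (by norm_num),
            ← Real.rpow_add (by norm_num), ← Real.rpow_add (by norm_num)]
          push_cast
          rfl
      _ ≤ 2 ^ (-((1 / 2 - ε) * n) - 1) := by
          refine Real.rpow_le_rpow_of_exponent_le htwo ?_
          rw [← hηε]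
          have : δ * n ≤ η * n := by gcongr
          linarith
      _ = t / 2 := by rw [Real.rpow_sub_one (by norm_num)]
  have hquarter : (2 : ℝ) ^ (-(n : ℝ) - 2) ≤ t / 4 := by
    rw [Real.rpow_sub (by norm_num), show (2 : ℝ) ^ (2 : ℝ) = 4 by norm_num]
    gcongr
    refine Real.rpow_le_rpow_of_exponent_le htwo ?_
    have : 0 ≤ ε * n := by positivity
    linarith
  have hunbal' : (2 : ℝ) ^ n * n ^ n * 2 ^ (1 - (δ * n) ^ 2) * (2 ^ n) ^ j ≤ t / 4 := by
    calc _ ≤ (2 : ℝ) ^ n * (2 ^ (δ ^ 2 / 2 * n)) ^ n * 2 ^ (1 - (δ * n) ^ 2) * (2 ^ n) ^ j := by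
          gcongr
          linarith
      _ = 2 ^ (n + δ ^ 2 / 2 * n * n + (1 - (δ * n) ^ 2) + n * j) := by
          rw [← pow_mul, ← Real.rpow_natCast 2 n, ← Real.rpow_natCast _ n,
            ← Real.rpow_natCast _ (n * j), ← Real.rpow_mul (by norm_num),
            ← Real.rpow_add (by norm_num), ← Real.rpow_add (by norm_num),
            ← Real.rpow_add (by norm_num)]
          push_cast
          rfl
      _ ≤ 2 ^ (-(n : ℝ) - 2) := by
          refine Real.rpow_le_rpow_of_exponent_le htwo ?_
          have := mul_le_mul_of_nonneg_right h6 (by positivity : (0 : ℝ) ≤ n)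
          nlinarith
      _ ≤ t / 4 := hquarter
  have hside' : (2 : ℝ) ^ n * 2 ^ (-(q * (δ * n - 2 ^ q))) * (2 ^ n) ^ j ≤ t / 4 := by
    calc _ = (2 : ℝ) ^ (n + -(q * (δ * n - 2 ^ q)) + n * j) := by
          rw [← pow_mul, ← Real.rpow_natCast 2 n, ← Real.rpow_natCast _ (n * j),
            ← Real.rpow_add (by norm_num), ← Real.rpow_add (by norm_num)]
          push_cast
          rfl
      _ ≤ 2 ^ (-(n : ℝ) - 2) := by
          refine Real.rpow_le_rpow_of_exponent_le htwo ?_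
          have := mul_le_mul_of_nonneg_right hq (by positivity : (0 : ℝ) ≤ n)
          linarith
      _ ≤ t / 4 := hquarter
  have e1 := mul_le_mul_of_nonneg_right hexch
    (by positivity : (0 : ℝ) ≤ ((2 : ℝ) ^ (η * n)) ^ (2 * j))
  have e2 := mul_le_mul_of_nonneg_right (hbad.trans (add_le_add hunbal hside))
    (by positivity : (0 : ℝ) ≤ ((2 : ℝ) ^ n) ^ j)
  have f1 := mul_le_mul_of_nonneg_right hexch' hX
  have f2 := mul_le_mul_of_nonneg_right hunbal' hX
  have f3 := mul_le_mul_of_nonneg_right hside' hX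
  linarith
end
end
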